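/- For any A > 0 there exists C(A) such that for all reals Y₀ > 1, x ≥ 1, and coprime integers a, q with q ≥ 1, the indicator function 𝔜₀ of integers all of whose prime factors exceed Y₀ satisfies |∑_{n ≤ x, n ≡ a (mod q)} 𝔜₀(n) − (1/φ(q)) ∑_{n ≤ x, (n,q)=1} 𝔜₀(n)| ≤ C(A)·x/(log 3x)^A. -/

import Mathlib

open Finset Real

/-- The indicator `𝔜₀` of integers all of whose prime factors are `≥ Y₀`
(in particular `𝔜₀(1) = 1`). -/
noncomputable def YInd (Y₀ : ℝ) (n : ℕ) : ℝ :=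
  if ∀ p ∈ n.primeFactors, Y₀ ≤ (p : ℝ) then 1 else 0

namespace SiegelWalfisz

/-- Partial sums of a nonprincipal Dirichlet character are bounded by the modulus. -/
lemma norm_sum_range_character_le {q : ℕ} [NeZero q] {χ : DirichletCharacter ℂ q} (hχ : χ ≠ 1)
    (N : ℕ) : ‖∑ n ∈ range N, χ (n : ZMod q)‖ ≤ q := by
  have hper : ∀ k : ℕ, ∑ n ∈ range (q * k), χ (n : ZMod q) = 0 := by
    intro k
    induction k with
    | zero => simp
    | succ k ih =>
      rw [Nat.mul_succ, Finset.sum_range_add, ih, zero_add]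
      have h0 := MulChar.sum_eq_zero_of_ne_one hχ
      rw [← h0]
      refine Finset.sum_nbij' (fun i => (i : ZMod q)) ZMod.val (by simp)
        (fun a _ => Finset.mem_range.2 (ZMod.val_lt a))
        (fun i hi => ZMod.val_cast_of_lt (Finset.mem_range.1 hi)) (by simp) ?_
      intro i _
      simp
  rw [← Nat.div_add_mod N q, Finset.sum_range_add, hper, zero_add]
  calc _ ≤ ∑ n ∈ range (N % q), ‖χ ((q * (N / q) + n : ℕ) : ZMod q)‖ := norm_sum_le _ _
    _ ≤ ∑ n ∈ range (N % q), (1 : ℝ) := Finset.sum_le_sum fun _ _ => χ.norm_le_one _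
    _ = (N % q : ℕ) := by simp
    _ ≤ q := by exact_mod_cast (Nat.mod_lt _ (NeZero.pos q)).le

lemma norm_cpow_neg_sub_cpow_neg_le {s : ℂ} (hs : 0 < s.re) {a b : ℝ} (ha : 0 < a) (hab : a ≤ b) :
    ‖(a : ℂ) ^ (-s) - (b : ℂ) ^ (-s)‖ ≤ ‖s‖ / s.re * (a ^ (-s.re) - b ^ (-s.re)) := by
  have hs0 : s ≠ 0 := by rintro rfl; simp at hs
  have hmem : (0 : ℝ) ∉ Set.uIcc a b := by
    rw [Set.uIcc_of_le hab]
    exact fun h => absurd h.1 (by linarith)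
  have e1 : (a : ℂ) ^ (-s) - (b : ℂ) ^ (-s) = s * ∫ u in a..b, (u : ℂ) ^ (-s - 1) := by
    rw [integral_cpow (Or.inr ⟨fun h => hs0 (by linear_combination -h), hmem⟩)]
    rw [sub_add_cancel]
    field_simp
    ring
  have e2 : a ^ (-s.re) - b ^ (-s.re) = s.re * ∫ u in a..b, u ^ (-s.re - 1) := by
    rw [integral_rpow (Or.inr ⟨fun h => hs.ne' (by linarith), hmem⟩)]
    rw [sub_add_cancel]
    field_simp
    ring
  rw [e1, e2, norm_mul, ← mul_assoc, div_mul_cancel₀ _ hs.ne']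
  refine mul_le_mul_of_nonneg_left ?_ (norm_nonneg _)
  refine (intervalIntegral.norm_integral_le_integral_norm hab).trans (le_of_eq ?_)
  refine intervalIntegral.integral_congr fun u hu => ?_
  rw [Set.uIcc_of_le hab] at hu
  rw [Complex.norm_cpow_eq_rpow_re_of_pos (by linarith [hu.1])]
  simp

/-- Abel summation bound for Dirichlet polynomials with bounded coefficient sums. -/
lemma norm_sum_Ico_div_cpow_le {f : ℕ → ℂ} {B : ℝ} (hf : ∀ N, ‖∑ n ∈ range N, f n‖ ≤ B)
    {s : ℂ} (hs : 0 < s.re) {N M : ℕ} (hN : 1 ≤ N) (hNM : N ≤ M) :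
    ‖∑ n ∈ Ico N M, f n * (n : ℂ) ^ (-s)‖ ≤ 3 * B * (‖s‖ / s.re) * (N : ℝ) ^ (-s.re) := by
  have hB : 0 ≤ B := (norm_nonneg _).trans (hf 0)
  have hs1 : 1 ≤ ‖s‖ / s.re := (one_le_div hs).2 (Complex.re_le_norm s)
  have hdiff : ∀ n : ℕ, 1 ≤ n → ‖(n : ℂ) ^ (-s) - ((n + 1 : ℕ) : ℂ) ^ (-s)‖ ≤
      ‖s‖ / s.re * ((n : ℝ) ^ (-s.re) - ((n + 1 : ℕ) : ℝ) ^ (-s.re)) := by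
    intro n hn
    have := norm_cpow_neg_sub_cpow_neg_le hs (a := n) (b := (n + 1 : ℕ)) (by exact_mod_cast hn)
      (by push_cast; linarith)
    exact_mod_cast this
  have key : ∀ M, N ≤ M → ‖∑ n ∈ Ico N M, f n * (n : ℂ) ^ (-s) -
      (∑ n ∈ range M, f n) * (M : ℂ) ^ (-s)‖ ≤ B * (N : ℝ) ^ (-s.re) +
        B * (‖s‖ / s.re) * ((N : ℝ) ^ (-s.re) - (M : ℝ) ^ (-s.re)) := by
    intro M hM
    induction M, hM using Nat.le_induction with
    | base =>
      simp only [Ico_self, sum_empty, zero_sub, norm_neg, norm_mul, sub_self, mul_zero, add_zero]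
      rw [Complex.norm_natCast_cpow_of_pos (by omega)]
      rw [Complex.neg_re]
      exact mul_le_mul_of_nonneg_right (hf N) (by positivity)
    | succ M hM ih =>
      rw [Finset.sum_Ico_succ_top hM, Finset.sum_range_succ]
      have e : ∑ n ∈ Ico N M, f n * (n : ℂ) ^ (-s) + f M * (M : ℂ) ^ (-s) -
          (∑ n ∈ range M, f n + f M) * ((M + 1 : ℕ) : ℂ) ^ (-s) =
          (∑ n ∈ Ico N M, f n * (n : ℂ) ^ (-s) - (∑ n ∈ range M, f n) * (M : ℂ) ^ (-s)) +
          (∑ n ∈ range (M + 1), f n) * ((M : ℂ) ^ (-s) - ((M + 1 : ℕ) : ℂ) ^ (-s)) := by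
        rw [Finset.sum_range_succ]; ring
      rw [e]
      refine (norm_add_le _ _).trans ?_
      have h2 : ‖(∑ n ∈ range (M + 1), f n) * ((M : ℂ) ^ (-s) - ((M + 1 : ℕ) : ℂ) ^ (-s))‖ ≤
          B * (‖s‖ / s.re * ((M : ℝ) ^ (-s.re) - ((M + 1 : ℕ) : ℝ) ^ (-s.re))) := by
        rw [norm_mul]
        exact mul_le_mul (hf _) (hdiff M (hN.trans hM)) (norm_nonneg _) hB
      linarith
  have h1 := key M hNM
  have hM1 : 1 ≤ M := hN.trans hNM
  have h2 : ‖(∑ n ∈ range M, f n) * (M : ℂ) ^ (-s)‖ ≤ B * (N : ℝ) ^ (-s.re) := by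
    rw [norm_mul, Complex.norm_natCast_cpow_of_pos (by omega)]
    refine mul_le_mul (hf M) ?_ (by positivity) hB
    rw [Complex.neg_re]
    exact Real.rpow_le_rpow_of_nonpos (by exact_mod_cast hN) (by exact_mod_cast hNM) (by linarith)
  have h3 : ‖∑ n ∈ Ico N M, f n * (n : ℂ) ^ (-s)‖ ≤ ‖∑ n ∈ Ico N M, f n * (n : ℂ) ^ (-s) -
      (∑ n ∈ range M, f n) * (M : ℂ) ^ (-s)‖ + ‖(∑ n ∈ range M, f n) * (M : ℂ) ^ (-s)‖ := by
    simpa using norm_add_le (∑ n ∈ Ico N M, f n * (n : ℂ) ^ (-s) -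
      (∑ n ∈ range M, f n) * (M : ℂ) ^ (-s)) ((∑ n ∈ range M, f n) * (M : ℂ) ^ (-s))
  have hNp : 0 ≤ B * (N : ℝ) ^ (-s.re) := by positivity
  have hMp : 0 ≤ B * (‖s‖ / s.re) * (M : ℝ) ^ (-s.re) := by positivity
  nlinarith

lemma tendsto_sum_character_cpow {q : ℕ} [NeZero q] (χ : DirichletCharacter ℂ q) {s : ℂ}
    (hs : 1 < s.re) : Filter.Tendsto (fun M : ℕ => ∑ n ∈ Ico 1 M, χ (n : ZMod q) * (n : ℂ) ^ (-s))
      Filter.atTop (nhds (χ.LFunction s)) := by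
  rw [χ.LFunction_eq_LSeries hs]
  have h := (χ.LSeriesSummable_of_one_lt_re hs).LSeriesHasSum.tendsto_sum_nat
  refine h.congr fun M => ?_
  rw [Finset.range_eq_Ico]
  rcases Nat.eq_zero_or_pos M with rfl | hM
  · simp
  rw [Finset.sum_eq_sum_Ico_succ_bot hM]
  simp only [LSeries.term_zero, zero_add]
  refine Finset.sum_congr rfl fun n hn => ?_
  rw [LSeries.term_of_ne_zero (by have := (Finset.mem_Ico.1 hn).1; omega), Complex.cpow_neg,
    div_eq_mul_inv]

/-- Truncation of the Dirichlet series of a nonprincipal character in the half-plane `re s > 0`. -/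
lemma norm_LFunction_sub_sum_le {q : ℕ} [NeZero q] {χ : DirichletCharacter ℂ q} (hχ : χ ≠ 1)
    {s : ℂ} (hs : 0 < s.re) {N : ℕ} (hN : 1 ≤ N) :
    ‖χ.LFunction s - ∑ n ∈ Ico 1 N, χ (n : ZMod q) * (n : ℂ) ^ (-s)‖ ≤
      3 * q * (‖s‖ / s.re) * (N : ℝ) ^ (-s.re) := by
  set P : ℕ → ℂ → ℂ := fun N s => ∑ n ∈ Ico 1 N, χ (n : ZMod q) * (n : ℂ) ^ (-s) with hP
  have hdiff : ∀ s : ℂ, 0 < s.re → ∀ N M : ℕ, 1 ≤ N → N ≤ M →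
      ‖P M s - P N s‖ ≤ 3 * q * (‖s‖ / s.re) * (N : ℝ) ^ (-s.re) := by
    intro s hs N M hN hNM
    have e : P M s - P N s = ∑ n ∈ Ico N M, χ (n : ZMod q) * (n : ℂ) ^ (-s) := by
      simp only [hP]
      rw [← Finset.sum_Ico_consecutive _ hN hNM]; ring
    rw [e]
    exact norm_sum_Ico_div_cpow_le (norm_sum_range_character_le hχ) hs hN hNM
  have hlim0 : ∀ r : ℝ, 0 < r → ∀ c : ℝ,
      Filter.Tendsto (fun N : ℕ => c * (N : ℝ) ^ (-r)) Filter.atTop (nhds 0) := by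
    intro r hr c
    simpa using ((tendsto_rpow_neg_atTop hr).comp tendsto_natCast_atTop_atTop).const_mul c
  have hcau : ∀ s : ℂ, 0 < s.re → ∃ l, Filter.Tendsto (fun N => P N s) Filter.atTop (nhds l) := by
    intro s hs
    apply cauchySeq_tendsto_of_complete
    rw [Metric.cauchySeq_iff']
    intro ε hε
    have h1 := (hlim0 s.re hs (3 * q * (‖s‖ / s.re))).eventually (gt_mem_nhds hε)
    obtain ⟨N, hN1, hN⟩ := (h1.and (Filter.eventually_ge_atTop 1)).exists
    refine ⟨N, fun n hn => ?_⟩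
    rw [dist_eq_norm]
    exact (hdiff s hs N n hN hn).trans_lt hN1
  choose! g hg using hcau
  have hgb : ∀ s : ℂ, 0 < s.re → ∀ N : ℕ, 1 ≤ N →
      ‖g s - P N s‖ ≤ 3 * q * (‖s‖ / s.re) * (N : ℝ) ^ (-s.re) := by
    intro s hs N hN
    refine le_of_tendsto ((hg s hs).sub_const (P N s)).norm ?_
    filter_upwards [Filter.eventually_ge_atTop N] with M hM using hdiff s hs N M hN hM
  set U : Set ℂ := {s | 0 < s.re} with hU
  have hUo : IsOpen U := isOpen_lt continuous_const Complex.continuous_re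
  have hloc : TendstoLocallyUniformlyOn P g Filter.atTop U := by
    rw [Metric.tendstoLocallyUniformlyOn_iff]
    intro ε hε s hs
    have hs' : 0 < s.re := hs
    refine ⟨{z | s.re / 2 < z.re} ∩ {z | ‖z‖ < ‖s‖ + 1}, ?_, ?_⟩
    · refine mem_nhdsWithin_of_mem_nhds (Filter.inter_mem ?_ ?_)
      · exact (isOpen_lt continuous_const Complex.continuous_re).mem_nhds
          (show s.re / 2 < s.re by linarith)
      · exact (isOpen_lt continuous_norm continuous_const).mem_nhds
          (show ‖s‖ < ‖s‖ + 1 by linarith)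
    · have h1 := (hlim0 (s.re / 2) (by linarith)
        (3 * q * ((‖s‖ + 1) / (s.re / 2)))).eventually (gt_mem_nhds hε)
      filter_upwards [h1, Filter.eventually_ge_atTop 1] with N hN1 hN z hz
      have hz1 : s.re / 2 < z.re := hz.1
      have hz2 : ‖z‖ < ‖s‖ + 1 := hz.2
      rw [dist_eq_norm]
      refine ((hgb z (by linarith) N hN).trans ?_).trans_lt hN1
      have hN' : (1 : ℝ) ≤ N := by exact_mod_cast hN
      gcongr
  have hgd : DifferentiableOn ℂ g U := by
    refine hloc.differentiableOn (Filter.Eventually.of_forall fun N => ?_) hUo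
    intro z hz
    have hz0 : z ≠ 0 := by rintro rfl; simp [hU] at hz
    refine DifferentiableAt.differentiableWithinAt ?_
    simp only [hP]
    refine DifferentiableAt.fun_sum fun n _ => ?_
    refine (differentiableAt_const _).mul ?_
    exact (differentiableAt_id.neg).const_cpow (Or.inr (neg_ne_zero.2 hz0))
  have heq : Set.EqOn g χ.LFunction U := by
    have hpre : IsPreconnected U := (convex_halfSpace_re_gt 0).isPreconnected
    refine AnalyticOnNhd.eqOn_of_preconnected_of_eventuallyEq (hgd.analyticOnNhd hUo)
      ((DirichletCharacter.differentiable_LFunction hχ).differentiableOn.analyticOnNhd hUo) hpre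
      (show (2 : ℂ) ∈ U by simp [hU]) ?_
    have : {z : ℂ | 1 < z.re} ∈ nhds (2 : ℂ) :=
      (isOpen_lt continuous_const Complex.continuous_re).mem_nhds (by simp)
    filter_upwards [this] with z hz
    have hz' : 1 < z.re := hz
    exact tendsto_nhds_unique (hg z (by linarith)) (tendsto_sum_character_cpow χ hz')
  rw [← heq hs]
  exact hgb s hs N hN

lemma exists_norm_LFunction_le {ε : ℝ} (hε : 0 < ε) : ∃ C > (0 : ℝ), ∃ δ > (0 : ℝ), δ ≤ 1 / 2 ∧
    ∀ (q : ℕ) [NeZero q] (χ : DirichletCharacter ℂ q), χ ≠ 1 → ∀ s : ℂ, 1 - δ ≤ s.re →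
      ‖χ.LFunction s‖ ≤ C * (q * (|s.im| + 2)) ^ ε := by
  set δ : ℝ := min ε 1 / 2 with hδ
  have hδ0 : 0 < δ := by positivity
  have hδ1 : δ ≤ 1 / 2 := by have := min_le_right ε 1; linarith
  have hδε : 2 * δ ≤ ε := by have := min_le_left ε 1; linarith
  have hsum : Summable fun n : ℕ => (n : ℝ) ^ (-(1 + δ)) := by
    rw [Real.summable_nat_rpow]; linarith
  set K := ∑' n : ℕ, (n : ℝ) ^ (-(1 + δ)) with hK
  have hK0 : 0 ≤ K := tsum_nonneg fun n => by positivity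
  refine ⟨(K + 6) * 2, by positivity, δ, hδ0, hδ1, ?_⟩
  intro q _ χ hχ s hs
  have hq : (1 : ℝ) ≤ q := by exact_mod_cast NeZero.pos q
  set Q : ℝ := q * (|s.im| + 2) with hQ
  have ht := abs_nonneg s.im
  have hQ1 : 1 ≤ Q := by nlinarith
  have hσ : 1 / 2 ≤ s.re := by linarith
  set N := ⌈Q⌉₊ with hN
  have hN1 : 1 ≤ N := Nat.one_le_ceil_iff.2 (by linarith)
  have hN1' : (1 : ℝ) ≤ N := by exact_mod_cast hN1
  have hQN : Q ≤ N := Nat.le_ceil Q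
  have hNQ : (N : ℝ) ≤ 2 * Q := by have := Nat.ceil_lt_add_one (show 0 ≤ Q by linarith); linarith
  have htail : 3 * q * (‖s‖ / s.re) * (N : ℝ) ^ (-s.re) ≤ 6 * (N : ℝ) ^ (2 * δ) := by
    have h1 : ‖s‖ / s.re ≤ 2 * (|s.im| + 2) := by
      rw [div_le_iff₀ (by linarith)]
      have := Complex.norm_le_abs_re_add_abs_im s
      rw [abs_of_pos (show 0 < s.re by linarith)] at this
      nlinarith
    calc 3 * q * (‖s‖ / s.re) * (N : ℝ) ^ (-s.re)
        ≤ 3 * q * (2 * (|s.im| + 2)) * (N : ℝ) ^ (-s.re) := by gcongr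
      _ = 6 * Q * (N : ℝ) ^ (-s.re) := by rw [hQ]; ring
      _ ≤ 6 * (N : ℝ) * (N : ℝ) ^ (2 * δ - 1) := by
        gcongr
        linarith
      _ = 6 * (N : ℝ) ^ (2 * δ) := by
        rw [Real.rpow_sub (by linarith), Real.rpow_one]; field_simp
  have hmain : ‖∑ n ∈ Ico 1 N, χ (n : ZMod q) * (n : ℂ) ^ (-s)‖ ≤ K * (N : ℝ) ^ (2 * δ) := by
    calc ‖∑ n ∈ Ico 1 N, χ (n : ZMod q) * (n : ℂ) ^ (-s)‖
        ≤ ∑ n ∈ Ico 1 N, ‖χ (n : ZMod q) * (n : ℂ) ^ (-s)‖ := norm_sum_le _ _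
      _ ≤ ∑ n ∈ Ico 1 N, (n : ℝ) ^ (-(1 + δ)) * (N : ℝ) ^ (2 * δ) := by
        refine Finset.sum_le_sum fun n hn => ?_
        obtain ⟨hn1, hn2⟩ := Finset.mem_Ico.1 hn
        have hn1' : (1 : ℝ) ≤ n := by exact_mod_cast hn1
        have hn2' : (n : ℝ) ≤ N := by exact_mod_cast hn2.le
        rw [norm_mul, Complex.norm_natCast_cpow_of_pos (by omega), Complex.neg_re]
        calc ‖χ (n : ZMod q)‖ * (n : ℝ) ^ (-s.re) ≤ 1 * (n : ℝ) ^ (-(1 + δ) + 2 * δ) := by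
              gcongr
              · exact χ.norm_le_one _
              linarith
          _ = (n : ℝ) ^ (-(1 + δ)) * (n : ℝ) ^ (2 * δ) := by
              rw [one_mul, Real.rpow_add (by linarith)]
          _ ≤ _ := by gcongr
      _ = (∑ n ∈ Ico 1 N, (n : ℝ) ^ (-(1 + δ))) * (N : ℝ) ^ (2 * δ) := by rw [Finset.sum_mul]
      _ ≤ K * (N : ℝ) ^ (2 * δ) := by
        gcongr
        exact hsum.sum_le_tsum _ fun n _ => by positivity
  calc ‖χ.LFunction s‖ ≤ ‖χ.LFunction s - ∑ n ∈ Ico 1 N, χ (n : ZMod q) * (n : ℂ) ^ (-s)‖ +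
        ‖∑ n ∈ Ico 1 N, χ (n : ZMod q) * (n : ℂ) ^ (-s)‖ := by
          simpa using norm_add_le (χ.LFunction s - ∑ n ∈ Ico 1 N, χ (n : ZMod q) * (n : ℂ) ^ (-s))
            (∑ n ∈ Ico 1 N, χ (n : ZMod q) * (n : ℂ) ^ (-s))
    _ ≤ 6 * (N : ℝ) ^ (2 * δ) + K * (N : ℝ) ^ (2 * δ) :=
        add_le_add ((norm_LFunction_sub_sum_le hχ (by linarith) hN1).trans htail) hmain
    _ = (K + 6) * (N : ℝ) ^ (2 * δ) := by ring
    _ ≤ (K + 6) * (2 * Q) ^ (2 * δ) := by gcongr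
    _ = (K + 6) * ((2 : ℝ) ^ (2 * δ) * Q ^ (2 * δ)) := by rw [Real.mul_rpow (by norm_num) (by linarith)]
    _ ≤ (K + 6) * ((2 : ℝ) ^ (1 : ℝ) * Q ^ ε) := by
        gcongr
        · norm_num
        · linarith
    _ = (K + 6) * 2 * Q ^ ε := by rw [Real.rpow_one]; ring

/-- Bounds of size `(q(|t|+2))^ε` for `L(s,χ)` and its derivative slightly to the left of
`re s = 1`. -/
lemma exists_norm_LFunction_deriv_le {ε : ℝ} (hε : 0 < ε) : ∃ C : ℝ, 1 ≤ C ∧ ∃ δ > (0 : ℝ),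
    δ ≤ 1 / 4 ∧ ∀ (q : ℕ) [NeZero q] (χ : DirichletCharacter ℂ q), χ ≠ 1 →
      ∀ s : ℂ, 1 - δ ≤ s.re → ‖χ.LFunction s‖ ≤ C * (q * (|s.im| + 2)) ^ ε ∧
        ‖deriv χ.LFunction s‖ ≤ C * (q * (|s.im| + 2)) ^ ε := by
  obtain ⟨C, hC, δ, hδ, hδ2, h⟩ := exists_norm_LFunction_le hε
  have hC1 : C ≤ max 1 (max C (C * 2 ^ ε / (δ / 2))) := (le_max_left _ _).trans (le_max_right _ _)
  have hC2 : C * 2 ^ ε / (δ / 2) ≤ max 1 (max C (C * 2 ^ ε / (δ / 2))) :=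
    (le_max_right _ _).trans (le_max_right _ _)
  refine ⟨max 1 (max C (C * 2 ^ ε / (δ / 2))), le_max_left _ _, δ / 2, by linarith, by linarith, ?_⟩
  intro q _ χ hχ s hs
  have hq : (1 : ℝ) ≤ q := by exact_mod_cast NeZero.pos q
  have ht := abs_nonneg s.im
  refine ⟨(h q χ hχ s (by linarith)).trans (by gcongr), ?_⟩
  have hbd : ∀ z ∈ Metric.sphere s (δ / 2), ‖χ.LFunction z‖ ≤ C * 2 ^ ε * (q * (|s.im| + 2)) ^ ε := by
    intro z hz
    have hz' : ‖z - s‖ = δ / 2 := by simpa [dist_eq_norm] using hz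
    have h1 : |z.re - s.re| ≤ δ / 2 := by
      rw [← hz', ← Complex.sub_re]; exact Complex.abs_re_le_norm _
    have h2 : |z.im - s.im| ≤ δ / 2 := by
      rw [← hz', ← Complex.sub_im]; exact Complex.abs_im_le_norm _
    have h3 : |z.im| ≤ |s.im| + 1 := by
      have := abs_sub_abs_le_abs_sub z.im s.im; linarith
    refine (h q χ hχ z (by have := (abs_le.1 h1).1; linarith)).trans ?_
    rw [mul_assoc, ← Real.mul_rpow (by norm_num) (by positivity)]
    exact mul_le_mul_of_nonneg_left
      (Real.rpow_le_rpow (by positivity) (by nlinarith) hε.le) hC.le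
  have := Complex.norm_deriv_le_of_forall_mem_sphere_norm_le (half_pos hδ)
    (DirichletCharacter.differentiable_LFunction hχ).diffContOnCl hbd
  refine this.trans ?_
  calc C * 2 ^ ε * (q * (|s.im| + 2)) ^ ε / (δ / 2)
      = (C * 2 ^ ε / (δ / 2)) * (q * (|s.im| + 2)) ^ ε := by ring
    _ ≤ _ := by gcongr

lemma norm_cpow_sub_integral_le {s : ℂ} (hs : 1 < s.re) {n : ℕ} (hn : 1 ≤ n) :
    ‖(n : ℂ) ^ (-s) - ((n : ℂ) ^ (1 - s) - ((n + 1 : ℕ) : ℂ) ^ (1 - s)) / (s - 1)‖ ≤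
      ‖s‖ / s.re * ((n : ℝ) ^ (-s.re) - ((n + 1 : ℕ) : ℝ) ^ (-s.re)) := by
  have hn0 : (0 : ℝ) < n := by exact_mod_cast hn
  have hs0 : 0 < s.re := by linarith
  have hs1 : s - 1 ≠ 0 := by
    intro h
    rw [sub_eq_zero] at h
    simp [h] at hs
  have hmem : (0 : ℝ) ∉ Set.uIcc (n : ℝ) ((n : ℝ) + 1) := by
    rw [Set.uIcc_of_le (by linarith)]
    exact fun h => absurd h.1 (by linarith)
  have hintegrable : IntervalIntegrable (fun u : ℝ => (u : ℂ) ^ (-s)) MeasureTheory.volume (n : ℝ)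
      ((n : ℝ) + 1) := intervalIntegral.intervalIntegrable_cpow (Or.inr hmem)
  have e1 : ((n : ℂ) ^ (1 - s) - ((n + 1 : ℕ) : ℂ) ^ (1 - s)) / (s - 1) =
      ∫ u in (n : ℝ)..((n : ℝ) + 1), (u : ℂ) ^ (-s) := by
    rw [integral_cpow (Or.inr ⟨fun h => hs1 (by linear_combination -h), hmem⟩)]
    push_cast
    rw [show -s + 1 = 1 - s by ring, ← neg_sub s 1, div_neg, ← neg_div]
    ring
  have e2 : (n : ℂ) ^ (-s) = ∫ u in (n : ℝ)..((n : ℝ) + 1), (n : ℂ) ^ (-s) := by simp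
  rw [e1]
  nth_rewrite 1 [e2]
  rw [← intervalIntegral.integral_sub (by simp) hintegrable]
  have := intervalIntegral.norm_integral_le_of_norm_le_const
    (a := (n : ℝ)) (b := (n : ℝ) + 1) (f := fun u : ℝ => (n : ℂ) ^ (-s) - (u : ℂ) ^ (-s))
    (C := ‖s‖ / s.re * ((n : ℝ) ^ (-s.re) - ((n + 1 : ℕ) : ℝ) ^ (-s.re))) ?_
  · simpa using this
  intro u hu
  rw [Set.uIoc_of_le (by linarith)] at hu
  have h1 := norm_cpow_neg_sub_cpow_neg_le hs0 hn0 hu.1.le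
  simp only [Complex.ofReal_natCast] at h1
  refine h1.trans ?_
  gcongr ?_ * (_ - ?_)
  refine Real.rpow_le_rpow_of_nonpos (by linarith [hu.1]) (by push_cast; exact hu.2) (by linarith)

lemma norm_sum_cpow_le {s : ℂ} (hs : 1 < s.re) {N M : ℕ} (hN : 1 ≤ N) (hNM : N ≤ M) :
    ‖∑ n ∈ Ico N M, (n : ℂ) ^ (-s)‖ ≤ 2 / ‖s - 1‖ + ‖s‖ / s.re * (N : ℝ) ^ (-s.re) := by
  have key : ‖∑ n ∈ Ico N M, (n : ℂ) ^ (-s) -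
      ((N : ℂ) ^ (1 - s) - (M : ℂ) ^ (1 - s)) / (s - 1)‖ ≤
      ‖s‖ / s.re * ((N : ℝ) ^ (-s.re) - (M : ℝ) ^ (-s.re)) := by
    induction M, hNM using Nat.le_induction with
    | base => simp
    | succ M hM ih =>
      rw [Finset.sum_Ico_succ_top hM]
      have := norm_cpow_sub_integral_le hs (hN.trans hM)
      refine le_trans (le_trans (le_of_eq ?_) (norm_add_le _ _)) ((add_le_add ih this).trans
        (le_of_eq ?_))
      · congr 1; ring
      · ring
  have hpow : ∀ n : ℕ, 1 ≤ n → ‖(n : ℂ) ^ (1 - s)‖ ≤ 1 := by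
    intro n hn
    rw [Complex.norm_natCast_cpow_of_pos (by omega)]
    exact Real.rpow_le_one_of_one_le_of_nonpos (by exact_mod_cast hn) (by simp; linarith)
  have h2 : ‖((N : ℂ) ^ (1 - s) - (M : ℂ) ^ (1 - s)) / (s - 1)‖ ≤ 2 / ‖s - 1‖ := by
    rw [norm_div]
    gcongr
    refine (norm_sub_le _ _).trans ?_
    linarith [hpow N hN, hpow M (hN.trans hNM)]
  have h3 : 0 ≤ ‖s‖ / s.re * (M : ℝ) ^ (-s.re) := by
    have : 0 < s.re := by linarith
    positivity
  have h4 := norm_add_le (∑ n ∈ Ico N M, (n : ℂ) ^ (-s) -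
      ((N : ℂ) ^ (1 - s) - (M : ℂ) ^ (1 - s)) / (s - 1))
      (((N : ℂ) ^ (1 - s) - (M : ℂ) ^ (1 - s)) / (s - 1))
  rw [sub_add_cancel] at h4
  linarith

lemma exists_norm_riemannZeta_le {ε : ℝ} (hε : 0 < ε) : ∃ C : ℝ, 1 ≤ C ∧ ∀ s : ℂ, 1 < s.re →
    s.re ≤ 2 → ‖riemannZeta s‖ ≤ C * (|s.im| + 2) ^ ε * (1 + 1 / ‖s - 1‖) := by
  have hsum : Summable fun n : ℕ => (n : ℝ) ^ (-(1 + ε)) := by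
    rw [Real.summable_nat_rpow]; linarith
  set K := ∑' n : ℕ, (n : ℝ) ^ (-(1 + ε)) with hK
  have hK0 : 0 ≤ K := tsum_nonneg fun n => by positivity
  have hK2 : 0 ≤ K * 2 ^ ε := by positivity
  refine ⟨K * 2 ^ ε + 4, by linarith, ?_⟩
  intro s hs hs2
  have ht := abs_nonneg s.im
  set T : ℝ := |s.im| + 2 with hT
  set N := ⌈T⌉₊ with hN
  have hN1 : 1 ≤ N := Nat.one_le_ceil_iff.2 (by linarith)
  have hN1' : (1 : ℝ) ≤ N := by exact_mod_cast hN1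
  have hTN : T ≤ N := Nat.le_ceil T
  have hNT : (N : ℝ) ≤ 2 * T := by have := Nat.ceil_lt_add_one (show 0 ≤ T by linarith); linarith
  have hTε : 1 ≤ T ^ ε := Real.one_le_rpow (by linarith) hε.le
  have hinv : 0 ≤ 1 / ‖s - 1‖ := by positivity
  have htail : ‖s‖ / s.re * (N : ℝ) ^ (-s.re) ≤ 1 := by
    have h1 : ‖s‖ / s.re ≤ N := by
      rw [div_le_iff₀ (by linarith)]
      have := Complex.norm_le_abs_re_add_abs_im s
      rw [abs_of_pos (show 0 < s.re by linarith)] at this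
      nlinarith
    have h2 : (N : ℝ) ^ (-s.re) ≤ (N : ℝ) ^ (-1 : ℝ) :=
      Real.rpow_le_rpow_of_exponent_le hN1' (by linarith)
    calc ‖s‖ / s.re * (N : ℝ) ^ (-s.re) ≤ N * (N : ℝ) ^ (-1 : ℝ) := by gcongr
      _ = 1 := by rw [Real.rpow_neg_one, mul_inv_cancel₀ (by linarith)]
  have hmain : ‖∑ n ∈ Ico 1 N, (n : ℂ) ^ (-s)‖ ≤ K * (N : ℝ) ^ ε := by
    calc ‖∑ n ∈ Ico 1 N, (n : ℂ) ^ (-s)‖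
        ≤ ∑ n ∈ Ico 1 N, ‖(n : ℂ) ^ (-s)‖ := norm_sum_le _ _
      _ ≤ ∑ n ∈ Ico 1 N, (n : ℝ) ^ (-(1 + ε)) * (N : ℝ) ^ ε := by
        refine Finset.sum_le_sum fun n hn => ?_
        obtain ⟨hn1, hn2⟩ := Finset.mem_Ico.1 hn
        have hn1' : (1 : ℝ) ≤ n := by exact_mod_cast hn1
        have hn2' : (n : ℝ) ≤ N := by exact_mod_cast hn2.le
        rw [Complex.norm_natCast_cpow_of_pos (by omega), Complex.neg_re]
        calc (n : ℝ) ^ (-s.re) ≤ (n : ℝ) ^ (-(1 + ε) + ε) := by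
              refine Real.rpow_le_rpow_of_exponent_le hn1' (by linarith)
          _ = (n : ℝ) ^ (-(1 + ε)) * (n : ℝ) ^ ε := by rw [Real.rpow_add (by linarith)]
          _ ≤ _ := by gcongr
      _ = (∑ n ∈ Ico 1 N, (n : ℝ) ^ (-(1 + ε))) * (N : ℝ) ^ ε := by rw [Finset.sum_mul]
      _ ≤ K * (N : ℝ) ^ ε := by
        gcongr
        exact hsum.sum_le_tsum _ fun n _ => by positivity
  have hNε : K * (N : ℝ) ^ ε ≤ K * 2 ^ ε * T ^ ε := by
    rw [mul_assoc, ← Real.mul_rpow (by norm_num) (by linarith)]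
    gcongr
  have hlim := tendsto_sum_character_cpow (1 : DirichletCharacter ℂ 1) hs
  rw [DirichletCharacter.LFunction_modOne_eq] at hlim
  refine le_of_tendsto hlim.norm ?_
  filter_upwards [Filter.eventually_ge_atTop N] with M hM
  have e : ∑ n ∈ Ico 1 M, (1 : DirichletCharacter ℂ 1) (n : ZMod 1) * (n : ℂ) ^ (-s) =
      ∑ n ∈ Ico 1 N, (n : ℂ) ^ (-s) + ∑ n ∈ Ico N M, (n : ℂ) ^ (-s) := by
    rw [Finset.sum_Ico_consecutive _ hN1 hM]
    refine Finset.sum_congr rfl fun n _ => ?_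
    rw [MulChar.one_apply (isUnit_of_subsingleton _), one_mul]
  rw [e]
  refine (norm_add_le _ _).trans ?_
  have h5 := norm_sum_cpow_le hs hN1 hM
  have h6 : 2 / ‖s - 1‖ = 2 * (1 / ‖s - 1‖) := by ring
  rw [h6] at h5
  nlinarith [mul_nonneg (mul_nonneg hK2 (show 0 ≤ T ^ ε by linarith)) hinv,
    mul_le_mul_of_nonneg_right hTε hinv]

/-- The number of prime factors of `q` is small: `2 ^ ω(q) ≪ q ^ ε`. -/
lemma exists_two_pow_card_primeFactors_le {ε : ℝ} (hε : 0 < ε) : ∃ C : ℝ, 1 ≤ C ∧ ∀ q : ℕ,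
    q ≠ 0 → (2 : ℝ) ^ #q.primeFactors ≤ C * (q : ℝ) ^ ε := by
  set P := ⌈(2 : ℝ) ^ (1 / ε)⌉₊ with hP
  refine ⟨2 ^ P, one_le_pow₀ (by norm_num), fun q hq => ?_⟩
  calc (2 : ℝ) ^ #q.primeFactors = ∏ p ∈ q.primeFactors, (2 : ℝ) := by simp
    _ ≤ ∏ p ∈ q.primeFactors, ((if p < P then 2 else 1) * (p : ℝ) ^ ε) := by
      refine Finset.prod_le_prod (fun _ _ => by norm_num) fun p hp => ?_
      have hp1 : (1 : ℝ) ≤ p := by exact_mod_cast (Nat.prime_of_mem_primeFactors hp).one_le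
      split_ifs with h
      · have := Real.one_le_rpow hp1 hε.le
        linarith
      · have h1 : (2 : ℝ) ^ (1 / ε) ≤ p := (Nat.le_ceil _).trans (by exact_mod_cast not_lt.1 h)
        have h2 := Real.rpow_le_rpow (by positivity) h1 hε.le
        rw [← Real.rpow_mul (by norm_num), one_div_mul_cancel hε.ne', Real.rpow_one] at h2
        linarith
    _ = (∏ p ∈ q.primeFactors, (if p < P then (2 : ℝ) else 1)) *
        ((∏ p ∈ q.primeFactors, p : ℕ) : ℝ) ^ ε := by
      rw [Finset.prod_mul_distrib]
      push_cast
      rw [Real.finsetProd_rpow _ _ (fun _ _ => by positivity)]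
    _ ≤ 2 ^ P * (q : ℝ) ^ ε := by
      gcongr
      · rw [Finset.prod_ite]
        simp only [prod_const, one_pow, mul_one]
        refine pow_le_pow_right₀ (by norm_num) ?_
        refine (Finset.card_le_card (t := range P) fun p hp => ?_).trans (by simp)
        simpa using (Finset.mem_filter.1 hp).2
      · exact Nat.le_of_dvd (Nat.pos_of_ne_zero hq) (Nat.prod_primeFactors_dvd q)

lemma norm_prod_one_sub_cpow_le {q : ℕ} {s : ℂ} (hs : 0 ≤ s.re) :
    ‖∏ p ∈ q.primeFactors, (1 - (p : ℂ) ^ (-s))‖ ≤ 2 ^ #q.primeFactors := by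
  rw [norm_prod]
  refine (Finset.prod_le_prod (fun _ _ => norm_nonneg _) (g := fun _ => (2 : ℝ)) ?_).trans (by simp)
  intro p hp
  have hp1 := (Nat.prime_of_mem_primeFactors hp).one_le
  refine (norm_sub_le _ _).trans ?_
  rw [Complex.norm_natCast_cpow_of_pos hp1]
  have : (p : ℝ) ^ (-s).re ≤ 1 :=
    Real.rpow_le_one_of_one_le_of_nonpos (by exact_mod_cast hp1) (by simpa using hs)
  simp only [norm_one]
  linarith

lemma exists_norm_LFunctionTrivChar_le {ε : ℝ} (hε : 0 < ε) : ∃ C : ℝ, 1 ≤ C ∧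
    ∀ (q : ℕ) [NeZero q] (s : ℂ), 1 < s.re → s.re ≤ 2 →
      ‖DirichletCharacter.LFunctionTrivChar q s‖ ≤
        C * (q * (|s.im| + 2)) ^ ε * (1 + 1 / ‖s - 1‖) := by
  obtain ⟨C₁, hC₁, h₁⟩ := exists_norm_riemannZeta_le hε
  obtain ⟨C₂, hC₂, h₂⟩ := exists_two_pow_card_primeFactors_le hε
  refine ⟨C₂ * C₁, by nlinarith, fun q _ s hs hs2 => ?_⟩
  have hne : s ≠ 1 := by rintro rfl; simp at hs
  rw [DirichletCharacter.LFunctionTrivChar_eq_mul_riemannZeta hne, norm_mul,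
    Real.mul_rpow (by positivity) (by positivity)]
  calc _ ≤ (C₂ * (q : ℝ) ^ ε) * (C₁ * (|s.im| + 2) ^ ε * (1 + 1 / ‖s - 1‖)) := by
        refine mul_le_mul ?_ (h₁ s hs hs2) (norm_nonneg _) (by positivity)
        exact (norm_prod_one_sub_cpow_le (by linarith)).trans (h₂ q (NeZero.ne q))
    _ = _ := by ring

set_option maxHeartbeats 1600000 in
/-- The lower bound for `L(s,χ)` to the right of the line `re s = 1` coming from the `3-4-1`
inequality, away from a possible exceptional zero. -/
lemma exists_le_norm_LFunction_of_nonexceptional {ε κ : ℝ} (hε : 0 < ε) (hκ : 0 < κ) (hκ1 : κ ≤ 1) :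
    ∃ c > (0 : ℝ), ∀ (q : ℕ) [NeZero q] (χ : DirichletCharacter ℂ q), χ ≠ 1 → ∀ s : ℂ, 1 < s.re →
      s.re ≤ 2 → (χ ^ 2 ≠ 1 ∨ κ * (q * (|s.im| + 2)) ^ (-ε) ≤ |s.im|) →
      c * (q * (|s.im| + 2)) ^ (-(14 * ε)) ≤ ‖χ.LFunction s‖ := by
  obtain ⟨C₁, hC₁, δ, hδ, hδ1, h₁⟩ := exists_norm_LFunction_deriv_le hε
  obtain ⟨C₂, hC₂, h₂⟩ := exists_norm_LFunctionTrivChar_le hε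
  set C : ℝ := C₁ * C₂ * 2 ^ ε * (2 / κ) with hC
  have h2ε : (1 : ℝ) ≤ 2 ^ ε := Real.one_le_rpow (by norm_num) hε.le
  have hκ2 : 2 ≤ 2 / κ := by rw [le_div_iff₀ hκ]; linarith
  have hCpos : 0 < C := by positivity
  refine ⟨1 / (16 * C ^ 7), by positivity, ?_⟩
  intro q _ χ hχ s hs hs2 hcase
  have hq : (1 : ℝ) ≤ q := by exact_mod_cast NeZero.pos q
  have ht := abs_nonneg s.im
  set Q : ℝ := q * (|s.im| + 2) with hQ
  have hQ1 : 1 ≤ Q := by nlinarith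
  have hQε : 1 ≤ Q ^ ε := Real.one_le_rpow hQ1 hε.le
  set M : ℝ := C * Q ^ (2 * ε) with hM
  have hQ2 : Q ^ (2 * ε) = Q ^ ε * Q ^ ε := by rw [two_mul, Real.rpow_add (by linarith)]
  have hMpos : 0 < M := by positivity
  have hCC1 : C₁ ≤ C := by
    rw [hC]
    have : 1 ≤ C₂ * 2 ^ ε * (2 / κ) := by
      have := one_le_mul_of_one_le_of_one_le hC₂ h2ε
      nlinarith
    nlinarith
  have hCC2 : C₁ * 2 ^ ε ≤ C := by
    rw [hC]
    have : 1 ≤ C₂ * (2 / κ) := by nlinarith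
    nlinarith [mul_pos (show 0 < C₁ by linarith) (show (0:ℝ) < 2 ^ ε by positivity)]
  have hCC3 : C₂ * 2 ^ ε * (2 / κ) ≤ C := by
    rw [hC]
    have : 0 < C₂ * 2 ^ ε * (2 / κ) := by positivity
    nlinarith
  have hM1 : 1 ≤ M := by
    rw [hM]; nlinarith [Real.one_le_rpow hQ1 (show 0 ≤ 2 * ε by linarith)]
  have hderiv : ∀ σ : ℝ, 1 ≤ σ → ‖deriv χ.LFunction (σ + s.im * Complex.I)‖ ≤ M := by
    intro σ hσ
    have := (h₁ q χ hχ (σ + s.im * Complex.I) (by simp; linarith)).2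
    simp only [Complex.add_im, Complex.ofReal_im, Complex.mul_im, Complex.ofReal_re, Complex.I_im,
      Complex.I_re, mul_one, mul_zero, add_zero, zero_add] at this
    rw [← hQ] at this
    refine this.trans ?_
    rw [hM, hQ2]
    nlinarith [mul_le_mul_of_nonneg_right hQε (show 0 ≤ Q ^ ε by positivity)]
  have hL0 : ∀ x : ℝ, 0 < x → x ≤ 1 → ‖DirichletCharacter.LFunctionTrivChar q (1 + x)‖ ≤ M / x := by
    intro x hx hx1
    have := h₂ q (1 + x) (by simpa using hx) (by simp; linarith)
    simp only [Complex.add_im, Complex.one_im, Complex.ofReal_im, add_zero, abs_zero, zero_add,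
      add_sub_cancel_left, Complex.norm_real, Real.norm_eq_abs, abs_of_pos hx] at this
    have h3 : ((q : ℝ) * 2) ^ ε ≤ Q ^ ε := by
      refine Real.rpow_le_rpow (by positivity) (by nlinarith) hε.le
    have h4 : 1 + 1 / x ≤ 2 / x := by
      rw [show (2 : ℝ) / x = 1 / x + 1 / x by ring]
      have : 1 ≤ 1 / x := by rw [le_div_iff₀ hx]; linarith
      linarith
    calc _ ≤ C₂ * ((q : ℝ) * 2) ^ ε * (1 + 1 / x) := this
      _ ≤ C₂ * Q ^ ε * (2 / x) := by gcongr
      _ = (C₂ * 1 * 2) * (Q ^ ε * 1) / x := by ring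
      _ ≤ (C₂ * 2 ^ ε * (2 / κ)) * (Q ^ ε * Q ^ ε) / x := by gcongr
      _ ≤ M / x := by rw [hM, hQ2]; gcongr
  have hL2 : ∀ x : ℝ, 0 < x → x ≤ 1 →
      ‖(χ ^ 2).LFunction (1 + x + 2 * Complex.I * s.im)‖ ≤ M := by
    intro x hx hx1
    set z : ℂ := 1 + x + 2 * Complex.I * s.im with hz
    have hzre : z.re = 1 + x := by simp [hz]
    have hzim : z.im = 2 * s.im := by simp [hz]
    have hQz : ((q : ℝ) * (|z.im| + 2)) ^ ε ≤ 2 ^ ε * Q ^ ε := by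
      rw [← Real.mul_rpow (by norm_num) (by linarith), hzim, abs_mul, abs_two]
      exact Real.rpow_le_rpow (by positivity) (by nlinarith) hε.le
    by_cases hsq : χ ^ 2 = 1
    · have hbig : κ * Q ^ (-ε) ≤ |s.im| := hcase.resolve_left (not_not.2 hsq)
      rw [hsq]
      have h5 := h₂ q z (by linarith) (by linarith)
      have hnorm : κ * Q ^ (-ε) ≤ ‖z - 1‖ := by
        have := Complex.abs_im_le_norm (z - 1)
        rw [Complex.sub_im, hzim, Complex.one_im, sub_zero, abs_mul, abs_two] at this
        linarith
      have h6 : 1 + 1 / ‖z - 1‖ ≤ 2 / κ * Q ^ ε := by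
        have h7 : 1 / ‖z - 1‖ ≤ 1 / (κ * Q ^ (-ε)) :=
          one_div_le_one_div_of_le (by positivity) hnorm
        have h8 : 1 / (κ * Q ^ (-ε)) = 1 / κ * Q ^ ε := by
          rw [Real.rpow_neg (by linarith)]; field_simp
        have h9 : 1 ≤ 1 / κ := by rw [le_div_iff₀ hκ]; linarith
        have h10 : 2 / κ = 1 / κ + 1 / κ := by ring
        rw [h8] at h7
        rw [h10, add_mul]
        have h11 := one_le_mul_of_one_le_of_one_le h9 hQε
        linarith
      calc _ ≤ C₂ * ((q : ℝ) * (|z.im| + 2)) ^ ε * (1 + 1 / ‖z - 1‖) := h5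
        _ ≤ C₂ * (2 ^ ε * Q ^ ε) * (2 / κ * Q ^ ε) := by gcongr
        _ = (C₂ * 2 ^ ε * (2 / κ)) * (Q ^ ε * Q ^ ε) := by ring
        _ ≤ M := by rw [hM, hQ2]; gcongr
    · have h5 := (h₁ q (χ ^ 2) hsq z (by linarith)).1
      calc _ ≤ C₁ * ((q : ℝ) * (|z.im| + 2)) ^ ε := h5
        _ ≤ C₁ * (2 ^ ε * Q ^ ε) := by gcongr
        _ = (C₁ * 2 ^ ε) * (Q ^ ε * 1) := by ring
        _ ≤ C * (Q ^ ε * Q ^ ε) := by gcongr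
        _ = M := by rw [hM, hQ2]
  have h341 : ∀ x : ℝ, 0 < x → x ≤ 1 →
      x ^ 3 / M ^ 4 ≤ ‖χ.LFunction ((1 + x : ℝ) + s.im * Complex.I)‖ ^ 4 := by
    intro x hx hx1
    have h := DirichletCharacter.norm_LFunction_product_ge_one (χ := χ) hx s.im
    rw [norm_mul, norm_mul, norm_pow, norm_pow] at h
    have e : (1 + x + Complex.I * s.im : ℂ) = ((1 + x : ℝ) : ℂ) + s.im * Complex.I := by
      push_cast; ring
    rw [e] at h
    rw [div_le_iff₀ (by positivity)]
    have h1 : ‖DirichletCharacter.LFunctionTrivChar q (1 + x)‖ ^ 3 ≤ (M / x) ^ 3 :=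
      pow_le_pow_left₀ (norm_nonneg _) (hL0 x hx hx1) 3
    have h2 : 1 ≤ (M / x) ^ 3 * ‖χ.LFunction ((1 + x : ℝ) + s.im * Complex.I)‖ ^ 4 * M := by
      refine h.le.trans ?_
      gcongr
      exact hL2 x hx hx1
    calc x ^ 3 = x ^ 3 * 1 := (mul_one _).symm
      _ ≤ x ^ 3 * ((M / x) ^ 3 * ‖χ.LFunction ((1 + x : ℝ) + s.im * Complex.I)‖ ^ 4 * M) := by gcongr
      _ = _ := by field_simp
  set x₀ : ℝ := 1 / (16 * M ^ 8) with hx₀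
  have hx₀pos : 0 < x₀ := by positivity
  have hx₀1 : x₀ ≤ 1 := by
    rw [hx₀, div_le_one (by positivity)]
    nlinarith [one_le_pow₀ hM1 (n := 8)]
  have hfar : ∀ x : ℝ, x₀ ≤ x → x ≤ 1 →
      1 / (8 * M ^ 7) ≤ ‖χ.LFunction ((1 + x : ℝ) + s.im * Complex.I)‖ := by
    intro x hx hx1
    refine le_of_pow_le_pow_left₀ (n := 4) (by norm_num) (norm_nonneg _) ?_
    refine le_trans ?_ (h341 x (by linarith) hx1)
    calc (1 / (8 * M ^ 7)) ^ 4 = x₀ ^ 3 / M ^ 4 := by rw [hx₀]; field_simp; norm_num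
      _ ≤ x ^ 3 / M ^ 4 := by gcongr
  have hfinal : 1 / (16 * M ^ 7) ≤ ‖χ.LFunction s‖ := by
    have hs_eq : ((1 + (s.re - 1) : ℝ) : ℂ) + s.im * Complex.I = s := by
      rw [add_sub_cancel]; exact Complex.re_add_im s
    rcases le_total x₀ (s.re - 1) with hx | hx
    · have := hfar (s.re - 1) hx (by linarith)
      rw [hs_eq] at this
      refine le_trans ?_ this
      gcongr
      norm_num
    · have h1 := hfar x₀ le_rfl hx₀1
      have h2 : ‖χ.LFunction ((1 + x₀ : ℝ) + s.im * Complex.I) - χ.LFunction s‖ ≤ M * x₀ := by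
        have hconv : Convex ℝ ({z : ℂ | 1 ≤ z.re} ∩ {z | z.im = s.im}) := by
          refine (convex_halfSpace_re_ge 1).inter ?_
          exact convex_hyperplane Complex.imLm.isLinear s.im
        have := hconv.norm_image_sub_le_of_norm_deriv_le (f := χ.LFunction) (C := M)
          (fun z _ => (DirichletCharacter.differentiable_LFunction hχ).differentiableAt) ?_
          (x := s) (y := ((1 + x₀ : ℝ) : ℂ) + s.im * Complex.I) ⟨hs.le, rfl⟩ ⟨by simp; linarith, by simp⟩
        · refine this.trans ?_
          gcongr
          have : (((1 + x₀ : ℝ) : ℂ) + s.im * Complex.I - s) = ((x₀ - (s.re - 1) : ℝ) : ℂ) := by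
            conv_lhs => rw [← hs_eq]
            simp only [Complex.add_im, Complex.ofReal_im, Complex.mul_im, Complex.I_im,
              Complex.ofReal_re, Complex.I_re]
            push_cast; ring
          rw [this, Complex.norm_real, Real.norm_eq_abs, abs_of_nonneg (by linarith)]
          linarith
        · rintro z ⟨hz1, hz2⟩
          have := hderiv z.re hz1
          rw [← (show z.im = s.im from hz2), Complex.re_add_im] at this
          exact this
      have h3 : M * x₀ = 1 / (16 * M ^ 7) := by rw [hx₀]; field_simp
      have h4 : 1 / (8 * M ^ 7) = 2 * (1 / (16 * M ^ 7)) := by field_simp; norm_num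
      have h5 := norm_sub_norm_le (χ.LFunction ((1 + x₀ : ℝ) + s.im * Complex.I)) (χ.LFunction s)
      linarith
  refine le_trans (le_of_eq ?_) hfinal
  have : M ^ 7 = C ^ 7 * Q ^ (14 * ε) := by
    rw [hM, mul_pow, ← Real.rpow_natCast (Q ^ (2 * ε)), ← Real.rpow_mul (by linarith)]
    congr 2
    push_cast
    ring
  rw [this, Real.rpow_neg (by linarith)]
  field_simp

lemma sub_le_of_hasSum_pow {r : ℕ → ℝ} {y l B S : ℝ} (hy : 1 < y) (hy2 : y ≤ 9 / 8)
    (hB : ∀ m, |r m| ≤ B * (2 / 3) ^ m) (hl : ∀ m, -l ≤ r m) (h0 : 1 - l ≤ r 0)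
    (hS : HasSum (fun m => r m * y ^ m) S) {N : ℕ} (hN : 1 ≤ N) :
    1 - 4 * B * (3 / 4) ^ N - l * (y ^ N - 1) / (y - 1) ≤ S := by
  have hB0 : 0 ≤ B := by simpa using (abs_nonneg _).trans (hB 0)
  have hsplit := hS.summable.sum_add_tsum_nat_add N
  rw [hS.tsum_eq] at hsplit
  have hterm : ∀ m, |r m * y ^ m| ≤ B * (3 / 4) ^ m := by
    intro m
    rw [abs_mul, abs_of_nonneg (by positivity : 0 ≤ y ^ m)]
    calc |r m| * y ^ m ≤ (B * (2 / 3) ^ m) * (9 / 8) ^ m := by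
          gcongr
          exact hB m
      _ = B * (3 / 4) ^ m := by rw [mul_assoc, ← mul_pow]; norm_num
  have hgeo : HasSum (fun m : ℕ => B * (3 / 4 : ℝ) ^ (m + N)) (4 * B * (3 / 4) ^ N) := by
    have h := (hasSum_geometric_of_lt_one (r := (3 / 4 : ℝ)) (by norm_num) (by norm_num)).mul_left
      (B * (3 / 4) ^ N)
    have e1 : (fun m : ℕ => B * (3 / 4 : ℝ) ^ (m + N)) = fun i => B * (3 / 4) ^ N * (3 / 4) ^ i := by
      ext m; rw [pow_add]; ring
    have e2 : 4 * B * (3 / 4 : ℝ) ^ N = B * (3 / 4) ^ N * (1 - 3 / 4)⁻¹ := by norm_num; ring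
    rw [e1, e2]
    exact h
  have htail : -(4 * B * (3 / 4) ^ N) ≤ ∑' m, r (m + N) * y ^ (m + N) := by
    have h := ((summable_nat_add_iff N).2 hS.summable)
    rw [← hgeo.tsum_eq, ← tsum_neg]
    exact hgeo.summable.neg.tsum_le_tsum (fun m => (abs_le.1 (hterm (m + N))).1) h
  have hhead : 1 - l * (y ^ N - 1) / (y - 1) ≤ ∑ m ∈ range N, r m * y ^ m := by
    obtain ⟨M, rfl⟩ : ∃ M, N = M + 1 := ⟨N - 1, by omega⟩
    rw [mul_div_assoc, ← geom_sum_eq hy.ne', sum_range_succ' _ M, sum_range_succ' _ M]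
    have : ∑ m ∈ range M, -l * y ^ (m + 1) ≤ ∑ m ∈ range M, r (m + 1) * y ^ (m + 1) :=
      sum_le_sum fun m _ => mul_le_mul_of_nonneg_right (hl _) (by positivity)
    rw [← mul_sum] at this
    simp only [pow_zero, mul_one]
    linarith
  linarith

lemma exists_half_le_of_hasSum_pow {r : ℕ → ℝ} {y l L B S : ℝ} (hy : 1 < y) (hy2 : y ≤ 9 / 8)
    (hB1 : 1 ≤ B)
    (hB : ∀ m, |r m| ≤ B * (2 / 3) ^ m) (hl : ∀ m, -l ≤ r m) (h0 : 1 - l ≤ r 0)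
    (hS : HasSum (fun m => r m * y ^ m) S) (hL : l ≤ L) (hL0 : 0 ≤ L) :
    1 / 2 ≤ S - l / (y - 1) + L * ((16 * B) ^ (4 * (y - 1)) / (y - 1)) := by
  set N := ⌈4 * Real.log (8 * B)⌉₊ with hN
  have hlog : 0 < Real.log (8 * B) := Real.log_pos (by linarith)
  have hN1 : 1 ≤ N := Nat.one_le_iff_ne_zero.2 (Nat.ceil_pos.2 (by linarith)).ne'
  have h := sub_le_of_hasSum_pow hy hy2 hB hl h0 hS hN1
  have hNlo : 4 * Real.log (8 * B) ≤ N := Nat.le_ceil _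
  have hNhi : (N : ℝ) ≤ 4 * Real.log (16 * B) := by
    have h1 : (N : ℝ) < 4 * Real.log (8 * B) + 1 := Nat.ceil_lt_add_one (by linarith)
    have h2 : Real.log (16 * B) = Real.log 2 + Real.log (8 * B) := by
      rw [← Real.log_mul (by norm_num) (by linarith)]; ring_nf
    linarith [Real.log_two_gt_d9]
  have h34 : (3 / 4 : ℝ) ^ N ≤ 1 / (8 * B) := by
    have h1 : (3 / 4 : ℝ) ≤ Real.exp (-(1 / 4)) := by
      have := Real.add_one_le_exp (-(1 / 4 : ℝ)); linarith
    calc (3 / 4 : ℝ) ^ N ≤ Real.exp (-(1 / 4)) ^ N := by gcongr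
      _ = Real.exp (N * -(1 / 4)) := by rw [← Real.exp_nat_mul]
      _ ≤ Real.exp (-Real.log (8 * B)) := by
          apply Real.exp_le_exp.2; linarith
      _ = 1 / (8 * B) := by rw [Real.exp_neg, Real.exp_log (by linarith), one_div]
  have hyN : y ^ N ≤ (16 * B) ^ (4 * (y - 1)) := by
    have h1 : y ≤ Real.exp (y - 1) := by have := Real.add_one_le_exp (y - 1); linarith
    calc y ^ N ≤ Real.exp (y - 1) ^ N := by gcongr
      _ = Real.exp (N * (y - 1)) := by rw [← Real.exp_nat_mul]
      _ ≤ Real.exp (4 * Real.log (16 * B) * (y - 1)) := by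
          apply Real.exp_le_exp.2
          exact mul_le_mul_of_nonneg_right hNhi (by linarith)
      _ = (16 * B) ^ (4 * (y - 1)) := by
          rw [Real.rpow_def_of_pos (by linarith)]; ring_nf
  have h1 : 4 * B * (3 / 4) ^ N ≤ 1 / 2 := by
    calc 4 * B * (3 / 4) ^ N ≤ 4 * B * (1 / (8 * B)) := by gcongr
      _ = 1 / 2 := by field_simp; norm_num
  have h2 : l * (y ^ N - 1) / (y - 1) = l * y ^ N / (y - 1) - l / (y - 1) := by ring
  have h3 : l * y ^ N / (y - 1) ≤ L * ((16 * B) ^ (4 * (y - 1)) / (y - 1)) := by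
    rw [mul_div_assoc]
    have : 0 < y - 1 := by linarith
    calc l * (y ^ N / (y - 1)) ≤ L * (y ^ N / (y - 1)) := by gcongr
      _ ≤ _ := by gcongr
  linarith

open scoped ComplexOrder in
/-- Estermann's inequality: if `ζ(s)G(s)` is a Dirichlet series with nonnegative coefficients and
leading coefficient `1`, with `G` entire, then its values slightly to the left of `1` are bounded
below in terms of `G(1)`. -/
lemma exists_estermann : ∃ K : ℝ, 1 ≤ K ∧ ∀ (a : ℕ → ℂ) (G : ℂ → ℂ) (M : ℝ),
    0 ≤ a → a 1 = 1 → (∀ s : ℂ, 1 < s.re → LSeriesSummable a s) →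
    (∀ s : ℂ, 1 < s.re → LSeries a s = riemannZeta s * G s) → Differentiable ℂ G → 1 ≤ M →
    (∀ s : ℂ, ‖s - 2‖ ≤ 3 / 2 → ‖G s‖ ≤ M) →
    0 < riemannZeta 2 * G 2 ∧ ∀ σ : ℝ, 7 / 8 ≤ σ → σ < 1 →
      1 / 2 ≤ (riemannZeta σ * G σ).re + ‖G 1‖ * ((K * M) ^ (4 * (1 - σ)) / (1 - σ)) := by
  set W : ℂ → ℂ := DirichletCharacter.LFunctionTrivChar₁ 1 with hW
  have hWd : Differentiable ℂ W := DirichletCharacter.differentiable_LFunctionTrivChar₁ 1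
  have hW1 : W 1 = 1 := by simp [hW, DirichletCharacter.LFunctionTrivChar₁]
  have hWs : ∀ s, s ≠ 1 → W s = (s - 1) * riemannZeta s := by
    intro s hs
    simp only [hW, DirichletCharacter.LFunctionTrivChar₁, Function.update_of_ne hs]
    rw [DirichletCharacter.LFunctionTrivChar, DirichletCharacter.LFunction_modOne_eq]
  obtain ⟨w, hw⟩ := (isCompact_closedBall (2 : ℂ) (3 / 2)).exists_bound_of_continuousOn
    hWd.continuous.continuousOn
  have hw1 : 1 ≤ w := by
    have := hw 1 (by rw [Metric.mem_closedBall, dist_eq_norm]; norm_num)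
    simpa [hW1] using this
  refine ⟨16 * (2 * (w + 1)), by linarith, fun a G M ha ha1 hsum hL hG hM hGM => ?_⟩
  have habs : LSeries.abscissaOfAbsConv a < ((2 : ℝ) : EReal) := by
    have h1 : LSeries.abscissaOfAbsConv a ≤ ((3 / 2 : ℝ) : EReal) := by
      have := (hsum ((3 / 2 : ℝ) : ℂ) (by norm_num)).abscissaOfAbsConv_le
      simpa using this
    refine h1.trans_lt ?_
    exact_mod_cast (by norm_num : (3 / 2 : ℝ) < 2)
  refine ⟨?_, ?_⟩
  · rw [← hL 2 (by norm_num)]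
    exact LSeries.positive ha (by rw [ha1]; exact one_pos) habs
  intro σ hσ hσ1
  set P : ℂ → ℂ := fun s => W s * G s with hP
  have hPd : Differentiable ℂ P := hWd.mul hG
  set H : ℂ → ℂ := dslope P 1 with hH
  have hHd : Differentiable ℂ H := by
    rw [← differentiableOn_univ] at hPd ⊢
    exact (Complex.differentiableOn_dslope Filter.univ_mem).2 hPd
  have hP1 : P 1 = G 1 := by simp [hP, hW1]
  have hHs : ∀ s, s ≠ 1 → H s = riemannZeta s * G s - G 1 * (s - 1)⁻¹ := by
    intro s hs
    have : s - 1 ≠ 0 := sub_ne_zero.2 hs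
    rw [hH, dslope_of_ne _ hs, slope_def_field, hP1, hP]
    simp only [hWs s hs]
    field_simp
  set B : ℝ := 2 * (w + 1) * M with hB
  have hsphere : ∀ z ∈ Metric.sphere (2 : ℂ) (3 / 2), ‖H z‖ ≤ B := by
    intro z hz
    rw [mem_sphere_iff_norm] at hz
    have hz1 : 1 / 2 ≤ ‖z - 1‖ := by
      have := norm_sub_norm_le (z - 2) (-1)
      rw [norm_neg, norm_one, hz] at this
      rw [show z - 1 = z - 2 - -1 by ring]; linarith
    have hz0 : z ≠ 1 := by rintro rfl; norm_num at hz1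
    rw [hH, dslope_of_ne _ hz0, slope_def_field, norm_div, div_le_iff₀ (by linarith), hP1]
    have h1 : ‖P z‖ ≤ w * M := by
      rw [hP, norm_mul]
      exact mul_le_mul (hw z (by rw [Metric.mem_closedBall, dist_eq_norm]; linarith)) (hGM z hz.le)
        (norm_nonneg _) (by linarith)
    have h2 : ‖G 1‖ ≤ M := hGM 1 (by norm_num)
    calc ‖P z - G 1‖ ≤ w * M + M := (norm_sub_le _ _).trans (add_le_add h1 h2)
      _ = B * (1 / 2) := by rw [hB]; ring
      _ ≤ B * ‖z - 1‖ := by gcongr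
  have hderiv : ∀ m : ℕ, iteratedDeriv m H 2 =
      iteratedDeriv m (LSeries a) 2 - G 1 * ((-1) ^ m * m.factorial) := by
    intro m
    have hopen : IsOpen {s : ℂ | 1 < s.re} := Complex.continuous_re.isOpen_preimage _ isOpen_Ioi
    have heq : Set.EqOn H (fun s => LSeries a s - G 1 * (s - 1)⁻¹) {s : ℂ | 1 < s.re} := by
      intro s hs
      have : s ≠ 1 := by rintro rfl; simp at hs
      simp only [hHs s this, hL s hs]
    have h2mem : (2 : ℂ) ∈ {s : ℂ | 1 < s.re} := by simp
    rw [heq.iteratedDeriv_of_isOpen hopen m h2mem]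
    have hA : ContDiffAt ℂ m (LSeries a) 2 := by
      refine AnalyticAt.contDiffAt ?_
      exact LSeries_analyticOnNhd a 2 (by simpa using habs)
    have hI : ContDiffAt ℂ m (fun s : ℂ => (s - 1)⁻¹) 2 :=
      (contDiffAt_id.sub contDiffAt_const).inv (by norm_num)
    rw [iteratedDeriv_fun_sub hA (contDiffAt_const.mul hI), iteratedDeriv_const_mul _ hI]
    have := congrFun (iteratedDeriv_comp_sub_const m (fun s : ℂ => s⁻¹) 1) 2
    rw [this, iteratedDeriv_eq_iterate (f := fun s : ℂ => s⁻¹)]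
    have h3 := iter_deriv_inv m ((2 : ℂ) - 1)
    change deriv^[m] (fun s : ℂ => s⁻¹) (2 - 1) = _ at h3
    rw [h3]
    norm_num
  set r : ℕ → ℝ := fun m => ((-1) ^ m * ((m.factorial : ℂ)⁻¹ * iteratedDeriv m H 2)).re with hr
  have hrr : ∀ m, (-1) ^ m * ((m.factorial : ℂ)⁻¹ * iteratedDeriv m H 2) =
      (m.factorial : ℝ)⁻¹ • ((-1) ^ m * iteratedDeriv m (LSeries a) 2) - G 1 := by
    intro m
    rw [hderiv]
    have h1 : (m.factorial : ℂ) ≠ 0 := by exact_mod_cast m.factorial_ne_zero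
    have h2 : ((-1 : ℂ) ^ m) * (-1) ^ m = 1 := by rw [← mul_pow]; simp
    rw [Complex.real_smul]
    push_cast
    field_simp
    linear_combination (-(m.factorial : ℂ) * G 1) * h2
  have hr1 : ∀ m, -(G 1).re ≤ r m := by
    intro m
    have h1 := LSeries.iteratedDeriv_alternating ha habs m
    have h2 := (Complex.le_def.1 h1).1
    rw [hr]; simp only [hrr, Complex.sub_re, Complex.smul_re, smul_eq_mul]
    have : 0 ≤ (m.factorial : ℝ)⁻¹ * ((-1) ^ m * iteratedDeriv m (LSeries a) 2).re :=
      mul_nonneg (by positivity) (by simpa using h2)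
    linarith
  have hr0 : 1 - (G 1).re ≤ r 0 := by
    rw [hr]; simp only [hrr, Complex.sub_re]
    have h1 : (1 : ℂ) ≤ LSeries a 2 := by
      have hs2 := hsum 2 (by norm_num)
      have := hs2.le_tsum 1 (fun n _ => LSeries.term_nonneg (ha n) 2)
      have e : LSeries.term a 2 1 = 1 := by simp [LSeries.term, ha1]
      rw [e] at this
      exact this
    have := (Complex.le_def.1 h1).1
    simpa using this
  have hrB : ∀ m, |r m| ≤ B * (2 / 3) ^ m := by
    intro m
    refine (Complex.abs_re_le_norm _).trans ?_
    have := Complex.norm_iteratedDeriv_le_of_forall_mem_sphere_norm_le m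
      (by norm_num : (0 : ℝ) < 3 / 2) (hHd.diffContOnCl) hsphere
    rw [norm_mul, norm_pow, norm_neg, norm_one, one_pow, one_mul, norm_mul, norm_inv,
      Complex.norm_natCast, inv_mul_le_iff₀ (by positivity)]
    refine this.trans (le_of_eq ?_)
    rw [div_eq_mul_inv, ← inv_pow]
    norm_num
    ring
  have hS : HasSum (fun m => r m * (2 - σ) ^ m) (H σ).re := by
    have h1 := Complex.hasSum_taylorSeries_on_ball (f := H) (c := 2) (r := 3 / 2) (z := σ)
      hHd.differentiableOn (by
        rw [Metric.mem_ball, dist_eq_norm, show ((σ : ℂ) - 2) = ((σ - 2 : ℝ) : ℂ) by push_cast; ring,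
          Complex.norm_real, Real.norm_eq_abs, abs_lt]
        norm_num; constructor <;> linarith)
    have h2 := Complex.hasSum_re h1
    convert h2 using 1
    ext m
    rw [hr]
    have : ((m.factorial : ℂ)⁻¹ • ((σ : ℂ) - 2) ^ m • iteratedDeriv m H 2) =
        ((2 - σ) ^ m : ℝ) • ((-1) ^ m * ((m.factorial : ℂ)⁻¹ * iteratedDeriv m H 2)) := by
      rw [smul_eq_mul, smul_eq_mul, Complex.real_smul,
        show ((σ : ℂ) - 2) = (-1) * (2 - σ) by ring, mul_pow]
      push_cast; ring
    rw [this, Complex.smul_re, smul_eq_mul]; ring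
  have hmain := exists_half_le_of_hasSum_pow (y := 2 - σ) (by linarith) (by linarith)
    (show 1 ≤ B by rw [hB]; nlinarith) hrB hr1 hr0 hS (Complex.re_le_norm (G 1)) (norm_nonneg _)
  have e1 : 2 - σ - 1 = 1 - σ := by ring
  rw [e1, hHs σ (by exact_mod_cast hσ1.ne)] at hmain
  have e2 : (G 1 * ((σ : ℂ) - 1)⁻¹).re = -((G 1).re / (1 - σ)) := by
    rw [show ((σ : ℂ) - 1)⁻¹ = (((σ - 1)⁻¹ : ℝ) : ℂ) by push_cast; rfl, Complex.re_mul_ofReal,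
      ← div_eq_mul_inv, ← neg_sub 1 σ, div_neg]
  rw [Complex.sub_re, e2] at hmain
  have e3 : 16 * (2 * (w + 1)) * M = 16 * B := by rw [hB]; ring
  rw [e3]
  linarith

section

lemma norm_LFunction_le_of_norm_sub_two_le {q : ℕ} [NeZero q] {χ : DirichletCharacter ℂ q}
    (hχ : χ ≠ 1) {s : ℂ} (hs : ‖s - 2‖ ≤ 3 / 2) : ‖χ.LFunction s‖ ≤ 21 * q := by
  have hre : 1 / 2 ≤ s.re := by
    have := (abs_le.1 ((Complex.abs_re_le_norm (s - 2)).trans hs)).1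
    simp at this; linarith
  have hn : ‖s‖ ≤ 7 / 2 := by
    have := norm_add_le (s - 2) 2
    rw [sub_add_cancel] at this
    norm_num at this; linarith
  have h := norm_LFunction_sub_sum_le hχ (show 0 < s.re by linarith) le_rfl
  simp only [Ico_self, sum_empty, sub_zero, Nat.cast_one, one_rpow, mul_one] at h
  have h2 : ‖s‖ / s.re ≤ 7 := by
    rw [div_le_iff₀ (by linarith)]; linarith
  calc ‖χ.LFunction s‖ ≤ 3 * q * (‖s‖ / s.re) := h
    _ ≤ 3 * q * 7 := by gcongr
    _ = 21 * q := by ring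

open scoped ComplexOrder
open ArithmeticFunction

/-- The arithmetic function attached to a Dirichlet character. -/
noncomputable def charAF {N : ℕ} (χ : DirichletCharacter ℂ N) : ArithmeticFunction ℂ :=
  toArithmeticFunction (χ ·)

lemma charAF_apply {N : ℕ} (χ : DirichletCharacter ℂ N) {n : ℕ} (hn : n ≠ 0) :
    charAF χ n = χ n := (χ.apply_eq_toArithmeticFunction_apply hn).symm

lemma LSeriesSummable_charAF {N : ℕ} [NeZero N] (χ : DirichletCharacter ℂ N) {s : ℂ}
    (hs : 1 < s.re) : LSeriesSummable (charAF χ) s :=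
  (LSeriesSummable_congr _ fun h => charAF_apply χ h).mpr <| ZMod.LSeriesSummable_of_one_lt_re χ hs

lemma LSeries_charAF {N : ℕ} [NeZero N] (χ : DirichletCharacter ℂ N) {s : ℂ}
    (hs : 1 < s.re) : LSeries (charAF χ) s = χ.LFunction s := by
  rw [χ.LFunction_eq_LSeries hs]
  exact LSeries_congr (fun h => charAF_apply χ h) s

/-- The complex-valued arithmetic function `ζ`. -/
noncomputable def zetaAF : ArithmeticFunction ℂ :=
  (ArithmeticFunction.zeta : ArithmeticFunction ℕ)

lemma zetaAF_apply {n : ℕ} (hn : n ≠ 0) : zetaAF n = 1 := by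
  unfold zetaAF
  rw [natCoe_apply, zeta_apply_ne hn, Nat.cast_one]

lemma LSeriesSummable_zetaAF {s : ℂ} (hs : 1 < s.re) : LSeriesSummable zetaAF s :=
  (LSeriesSummable_congr s fun {_} h => zetaAF_apply h).mpr (LSeriesSummable_one_iff.2 hs)

lemma LSeries_zetaAF {s : ℂ} (hs : 1 < s.re) : LSeries zetaAF s = riemannZeta s := by
  rw [← LSeries_one_eq_riemannZeta hs]
  exact LSeries_congr (fun {_} h => zetaAF_apply h) s

lemma zetaMul_eq {N : ℕ} (χ : DirichletCharacter ℂ N) :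
    χ.zetaMul = zetaAF * charAF χ := by
  unfold DirichletCharacter.zetaMul charAF zetaAF
  rfl

lemma LSeries_zetaMul {N : ℕ} [NeZero N] (χ : DirichletCharacter ℂ N) {s : ℂ} (hs : 1 < s.re) :
    LSeries χ.zetaMul s = riemannZeta s * χ.LFunction s := by
  rw [zetaMul_eq, ArithmeticFunction.LSeries_mul' (LSeriesSummable_zetaAF hs)
    (LSeriesSummable_charAF χ hs), LSeries_charAF χ hs, LSeries_zetaAF hs]

/-- The fourfold convolution `1 * χ * ψ * χψ`. -/
noncomputable def fourfold {N : ℕ} (χ ψ : DirichletCharacter ℂ N) : ArithmeticFunction ℂ :=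
  χ.zetaMul * (charAF ψ * charAF (χ * ψ))

lemma pmul_zetaMul {N : ℕ} (χ ψ : DirichletCharacter ℂ N) :
    charAF ψ * charAF (χ * ψ) = (charAF ψ).pmul χ.zetaMul := by
  ext n
  rcases eq_or_ne n 0 with rfl | hn
  · simp
  rw [pmul_apply, zetaMul_eq, mul_apply, mul_apply, mul_sum]
  refine sum_congr rfl fun x hx => ?_
  obtain ⟨hx1, -⟩ := Nat.mem_divisorsAntidiagonal.1 hx
  have h1 : x.1 ≠ 0 := fun h => hn (by rw [← hx1, h, zero_mul])
  have h2 : x.2 ≠ 0 := fun h => hn (by rw [← hx1, h, mul_zero])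
  rw [charAF_apply _ h1, charAF_apply _ h2, charAF_apply _ h2, charAF_apply _ hn,
    zetaAF_apply h1, one_mul, ← hx1, Nat.cast_mul, map_mul ψ, MulChar.mul_apply]
  ring

lemma fourfold_comm {N : ℕ} (χ ψ : DirichletCharacter ℂ N) : fourfold χ ψ = fourfold ψ χ := by
  rw [fourfold, fourfold, zetaMul_eq, zetaMul_eq, mul_comm χ ψ]
  ring

lemma isMultiplicative_fourfold {N : ℕ} (χ ψ : DirichletCharacter ℂ N) :
    (fourfold χ ψ).IsMultiplicative :=
  χ.isMultiplicative_zetaMul.mul ((DirichletCharacter.isMultiplicative_toArithmeticFunction ψ).mul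
    (DirichletCharacter.isMultiplicative_toArithmeticFunction (χ * ψ)))

lemma fourfold_prime_pow_nonneg_of {N : ℕ} {χ ψ : DirichletCharacter ℂ N} (hχ : χ ^ 2 = 1)
    {p : ℕ} (hp : p.Prime) (k : ℕ)
    (h : ∀ j, 0 ≤ ψ p ^ j * χ.zetaMul (p ^ j)) : 0 ≤ fourfold χ ψ (p ^ k) := by
  rw [fourfold, pmul_zetaMul, mul_apply, Nat.sum_divisorsAntidiagonal
    (f := fun a b => χ.zetaMul a * ((charAF ψ).pmul χ.zetaMul) b)]
  refine sum_nonneg fun d hd => ?_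
  refine mul_nonneg (χ.zetaMul_nonneg hχ _) ?_
  obtain ⟨i, hi, rfl⟩ := (Nat.mem_divisors_prime_pow hp k).1 hd
  rw [Nat.pow_div hi hp.pos, pmul_apply, charAF_apply _ (pow_ne_zero _ hp.ne_zero)]
  have := h (k - i)
  rwa [Nat.cast_pow, map_pow]

lemma fourfold_prime_pow_nonneg {N : ℕ} {χ ψ : DirichletCharacter ℂ N} (hχ : χ ^ 2 = 1)
    (hψ : ψ ^ 2 = 1) {p : ℕ} (hp : p.Prime) (k : ℕ) : 0 ≤ fourfold χ ψ (p ^ k) := by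
  by_cases h1 : 0 ≤ ψ p
  · exact fourfold_prime_pow_nonneg_of hχ hp k fun j =>
      mul_nonneg (pow_nonneg h1 _) (χ.zetaMul_nonneg hχ _)
  by_cases h2 : 0 ≤ χ p
  · rw [fourfold_comm]
    exact fourfold_prime_pow_nonneg_of hψ hp k fun j =>
      mul_nonneg (pow_nonneg h2 _) (ψ.zetaMul_nonneg hψ _)
  have h1' : ψ p = -1 := by
    rcases MulChar.isQuadratic_iff_sq_eq_one.mpr hψ p with h | h | h
    · simp [h] at h1
    · simp [h] at h1
    · exact h
  have h2' : χ p = -1 := by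
    rcases MulChar.isQuadratic_iff_sq_eq_one.mpr hχ p with h | h | h
    · simp [h] at h2
    · simp [h] at h2
    · exact h
  refine fourfold_prime_pow_nonneg_of hχ hp k fun j => ?_
  have : χ.zetaMul (p ^ j) = ∑ i ∈ range (j + 1), (-1) ^ i := by
    rw [zetaMul_eq, zetaAF, coe_zeta_mul_apply, Nat.sum_divisors_prime_pow hp]
    refine sum_congr rfl fun i _ => ?_
    rw [charAF_apply _ (pow_ne_zero _ hp.ne_zero), Nat.cast_pow, map_pow, h2']
  rw [this, h1', neg_one_geom_sum]
  split_ifs with hj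
  · simp
  · have : Even j := by
      rw [Nat.even_add_one, not_not] at hj; exact hj
    simp [this.neg_one_pow]

lemma fourfold_nonneg {N : ℕ} {χ ψ : DirichletCharacter ℂ N} (hχ : χ ^ 2 = 1)
    (hψ : ψ ^ 2 = 1) (n : ℕ) : 0 ≤ fourfold χ ψ n := by
  rcases eq_or_ne n 0 with rfl | hn
  · simp only [ArithmeticFunction.map_zero, le_refl]
  · rw [(isMultiplicative_fourfold χ ψ).multiplicative_factorization _ hn]
    exact Finset.prod_nonneg fun p hp =>
        fourfold_prime_pow_nonneg hχ hψ (Nat.prime_of_mem_primeFactors hp) _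

lemma exists_half_le_zeta_mul_LFunction : ∃ K : ℝ, 1 ≤ K ∧
    ∀ (N : ℕ) [NeZero N] (χ : DirichletCharacter ℂ N), χ ≠ 1 → χ ^ 2 = 1 →
      0 < riemannZeta 2 * χ.LFunction 2 ∧ ∀ σ : ℝ, 7 / 8 ≤ σ → σ < 1 →
      1 / 2 ≤ (riemannZeta σ * χ.LFunction σ).re +
        ‖χ.LFunction 1‖ * ((K * (N : ℝ) ^ 3) ^ (4 * (1 - σ)) / (1 - σ)) := by
  obtain ⟨K, hK, h⟩ := exists_estermann
  refine ⟨K * 21, by linarith, fun N _ χ hχ hχ2 => ?_⟩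
  have hN : (1 : ℝ) ≤ N := by exact_mod_cast NeZero.one_le
  have h1 := h χ.zetaMul χ.LFunction (21 * N ) (fun n => χ.zetaMul_nonneg hχ2 n)
    χ.isMultiplicative_zetaMul.map_one (fun s hs => χ.LSeriesSummable_zetaMul hs)
    (fun s hs => LSeries_zetaMul χ hs) (DirichletCharacter.differentiable_LFunction hχ)
    (by linarith) (fun s hs => norm_LFunction_le_of_norm_sub_two_le hχ hs)
  refine ⟨h1.1, fun σ hσ hσ1 => (h1.2 σ hσ hσ1).trans ?_⟩
  have h1σ : 0 < 1 - σ := by linarith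
  gcongr _ + _ * (?_ ^ _ / _)
  rw [mul_assoc]
  gcongr
  exact le_self_pow₀ hN (by norm_num)

lemma LSeriesSummable_charAF_mul {N : ℕ} [NeZero N] (χ ψ : DirichletCharacter ℂ N) {s : ℂ}
    (hs : 1 < s.re) : LSeriesSummable (fun n => (charAF χ * charAF ψ) n) s :=
  ArithmeticFunction.LSeriesSummable_mul (LSeriesSummable_charAF _ hs) (LSeriesSummable_charAF _ hs)

lemma LSeriesSummable_fourfold {N : ℕ} [NeZero N] (χ ψ : DirichletCharacter ℂ N) {s : ℂ}
    (hs : 1 < s.re) : LSeriesSummable (fourfold χ ψ) s :=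
  ArithmeticFunction.LSeriesSummable_mul (χ.LSeriesSummable_zetaMul hs)
    (LSeriesSummable_charAF_mul _ _ hs)

lemma LSeries_fourfold {N : ℕ} [NeZero N] (χ ψ : DirichletCharacter ℂ N) {s : ℂ}
    (hs : 1 < s.re) : LSeries (fourfold χ ψ) s =
      riemannZeta s * (χ.LFunction s * (ψ.LFunction s * (χ * ψ).LFunction s)) := by
  rw [fourfold, ArithmeticFunction.LSeries_mul' (χ.LSeriesSummable_zetaMul hs)
    (LSeriesSummable_charAF_mul _ _ hs),
    ArithmeticFunction.LSeries_mul' (LSeriesSummable_charAF _ hs) (LSeriesSummable_charAF _ hs),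
    LSeries_zetaMul χ hs, LSeries_charAF _ hs, LSeries_charAF _ hs]
  ring

lemma exists_half_le_fourfold : ∃ K : ℝ, 1 ≤ K ∧
    ∀ (N : ℕ) [NeZero N] (χ ψ : DirichletCharacter ℂ N), χ ≠ 1 → χ ^ 2 = 1 → ψ ≠ 1 → ψ ^ 2 = 1 →
      χ * ψ ≠ 1 → ∀ σ : ℝ, 7 / 8 ≤ σ → σ < 1 →
      1 / 2 ≤ (riemannZeta σ * (χ.LFunction σ * (ψ.LFunction σ * (χ * ψ).LFunction σ))).re +
        ‖χ.LFunction 1 * (ψ.LFunction 1 * (χ * ψ).LFunction 1)‖ *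
          ((K * (N : ℝ) ^ 3) ^ (4 * (1 - σ)) / (1 - σ)) := by
  obtain ⟨K, hK, h⟩ := exists_estermann
  refine ⟨K * 21 ^ 3, by norm_num; linarith, fun N _ χ ψ hχ hχ2 hψ hψ2 hχψ σ hσ hσ1 => ?_⟩
  have hN : (1 : ℝ) ≤ N := by exact_mod_cast NeZero.one_le
  have hd : Differentiable ℂ fun s => χ.LFunction s * (ψ.LFunction s * (χ * ψ).LFunction s) :=
    (DirichletCharacter.differentiable_LFunction hχ).mul
      ((DirichletCharacter.differentiable_LFunction hψ).mul
        (DirichletCharacter.differentiable_LFunction hχψ))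
  have hbound : ∀ s : ℂ, ‖s - 2‖ ≤ 3 / 2 →
      ‖χ.LFunction s * (ψ.LFunction s * (χ * ψ).LFunction s)‖ ≤ (21 * (N : ℝ)) ^ 3 := by
    intro s hs
    rw [norm_mul, norm_mul, pow_succ', pow_two]
    have h1 := norm_LFunction_le_of_norm_sub_two_le hχ hs
    have h2 := norm_LFunction_le_of_norm_sub_two_le hψ hs
    have h3 := norm_LFunction_le_of_norm_sub_two_le hχψ hs
    gcongr
  have h1 := (h (fourfold χ ψ) _ ((21 * (N : ℝ)) ^ 3) (fun n => fourfold_nonneg hχ2 hψ2 n)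
    (isMultiplicative_fourfold χ ψ).map_one (fun s => LSeriesSummable_fourfold χ ψ)
    (fun s => LSeries_fourfold χ ψ) hd (one_le_pow₀ (by linarith)) hbound).2
    σ hσ hσ1
  rwa [show K * 21 ^ 3 * (N : ℝ) ^ 3 = K * (21 * (N : ℝ)) ^ 3 by rw [mul_pow]; ring]

end

lemma im_LFunction_ofReal_eq_zero {q : ℕ} [NeZero q] {χ : DirichletCharacter ℂ q} (hχ : χ ≠ 1)
    (hχ2 : χ ^ 2 = 1) {σ : ℝ} (hσ : 0 < σ) : (χ.LFunction σ).im = 0 := by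
  have hb : ∀ N : ℕ, 1 ≤ N → |(χ.LFunction σ).im| ≤ 3 * q * (‖(σ : ℂ)‖ / σ) * (N : ℝ) ^ (-σ) := by
    intro N hN
    have h := norm_LFunction_sub_sum_le hχ (s := σ) (by simpa using hσ) hN
    have h0 : (∑ n ∈ Ico 1 N, χ n * (n : ℂ) ^ (-(σ : ℂ))).im = 0 := by
      rw [Complex.im_sum]
      refine sum_eq_zero fun n _ => ?_
      have e : (n : ℂ) ^ (-(σ : ℂ)) = (((n : ℝ) ^ (-σ) : ℝ) : ℂ) := by
        rw [Complex.ofReal_cpow (by positivity)]; push_cast; rfl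
      rw [e, Complex.im_mul_ofReal]
      rcases MulChar.isQuadratic_iff_sq_eq_one.mpr hχ2 (n : ZMod q) with h | h | h <;> simp [h]
    have h1 := (Complex.abs_im_le_norm _).trans h
    rwa [Complex.sub_im, h0, sub_zero, Complex.ofReal_re] at h1
  have hlim : Filter.Tendsto (fun N : ℕ => 3 * (q : ℝ) * (‖(σ : ℂ)‖ / σ) * (N : ℝ) ^ (-σ))
      Filter.atTop (nhds (3 * (q : ℝ) * (‖(σ : ℂ)‖ / σ) * 0)) :=
    ((tendsto_rpow_neg_atTop hσ).comp tendsto_natCast_atTop_atTop).const_mul _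
  rw [mul_zero] at hlim
  have := ge_of_tendsto hlim (Filter.eventually_atTop.2 ⟨1, hb⟩)
  exact abs_eq_zero.1 (le_antisymm this (abs_nonneg _))

lemma re_LFunction_pos_of_forall_ne_zero {q : ℕ} [NeZero q] {χ : DirichletCharacter ℂ q}
    (hχ : χ ≠ 1) (hχ2 : χ ^ 2 = 1) {σ : ℝ} (hσ : 0 < σ) (hσ2 : σ ≤ 2)
    (h0 : ∀ x : ℝ, σ ≤ x → x < 1 → χ.LFunction x ≠ 0) : 0 < (χ.LFunction σ).re := by
  obtain ⟨K, -, h⟩ := exists_half_le_zeta_mul_LFunction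
  have h2 : 0 < (χ.LFunction 2).re := by
    have h1 := (Complex.lt_def.1 (h q χ hχ hχ2).1).1
    have e : riemannZeta 2 = ((π ^ 2 / 6 : ℝ) : ℂ) := by rw [riemannZeta_two]; push_cast; ring
    rw [e, Complex.re_ofReal_mul, Complex.zero_re] at h1
    exact (mul_pos_iff_of_pos_left (by positivity)).1 h1
  by_contra hneg
  have hcont : ContinuousOn (fun x : ℝ => (χ.LFunction x).re) (Set.Icc σ 2) :=
    (Complex.continuous_re.comp ((DirichletCharacter.differentiable_LFunction hχ).continuous.comp
      Complex.continuous_ofReal)).continuousOn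
  obtain ⟨x, hx, hx0⟩ := intermediate_value_Icc hσ2 hcont
    (show (0 : ℝ) ∈ Set.Icc _ _ from ⟨not_lt.1 hneg, by simpa using h2.le⟩)
  have hz : χ.LFunction x = 0 :=
    Complex.ext hx0 (im_LFunction_ofReal_eq_zero hχ hχ2 (hσ.trans_le hx.1))
  rcases lt_or_ge x 1 with h1 | h1
  · exact h0 x hx.1 h1 hz
  · exact DirichletCharacter.LFunction_ne_zero_of_one_le_re χ (.inl hχ) (by simpa using h1) hz

lemma exists_re_riemannZeta_neg : ∃ δ > (0 : ℝ), ∀ σ : ℝ, 1 - δ ≤ σ → σ < 1 →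
    (riemannZeta σ).re < 0 := by
  set W : ℂ → ℂ := DirichletCharacter.LFunctionTrivChar₁ 1 with hW
  have hWd : Differentiable ℂ W := DirichletCharacter.differentiable_LFunctionTrivChar₁ 1
  have hW1 : W 1 = 1 := by simp [hW, DirichletCharacter.LFunctionTrivChar₁]
  have hcont : ContinuousAt (fun x : ℝ => (W x).re) 1 :=
    (Complex.continuous_re.comp (hWd.continuous.comp Complex.continuous_ofReal)).continuousAt
  have hpos : ∀ᶠ x : ℝ in nhds 1, 0 < (W x).re := by
    refine hcont.eventually_const_lt ?_
    simp [hW1]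
  obtain ⟨δ, hδ, h⟩ := Metric.eventually_nhds_iff.1 hpos
  refine ⟨δ / 2, by positivity, fun σ hσ hσ1 => ?_⟩
  have h1 := h (y := σ) (by rw [Real.dist_eq, abs_lt]; constructor <;> linarith)
  have hne : (σ : ℂ) ≠ 1 := by exact_mod_cast hσ1.ne
  have e : W σ = ((σ - 1 : ℝ) : ℂ) * riemannZeta σ := by
    simp only [hW, DirichletCharacter.LFunctionTrivChar₁, Function.update_of_ne hne]
    rw [DirichletCharacter.LFunctionTrivChar, DirichletCharacter.LFunction_modOne_eq]
    push_cast; rfl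
  rw [e, Complex.re_ofReal_mul] at h1
  nlinarith

lemma norm_LFunction_changeLevel_one_le {M N : ℕ} [NeZero M] [NeZero N] (hMN : M ∣ N)
    {χ : DirichletCharacter ℂ M} (hχ : χ ≠ 1) :
    ‖(DirichletCharacter.changeLevel hMN χ).LFunction 1‖ ≤
      ‖χ.LFunction 1‖ * 2 ^ #N.primeFactors := by
  rw [DirichletCharacter.LFunction_changeLevel hMN χ (.inl hχ), norm_mul]
  gcongr
  rw [norm_prod]
  refine (Finset.prod_le_prod (fun _ _ => norm_nonneg _) (g := fun _ => (2 : ℝ)) ?_).trans (by simp)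
  intro p hp
  have hp1 : (1 : ℝ) ≤ p := by exact_mod_cast (Nat.prime_of_mem_primeFactors hp).one_le
  refine (norm_sub_le _ _).trans ?_
  have h1 : ‖χ p * (p : ℂ) ^ (-1 : ℂ)‖ ≤ 1 * 1 := by
    rw [norm_mul]
    refine mul_le_mul (χ.norm_le_one _) ?_ (norm_nonneg _) zero_le_one
    rw [Complex.cpow_neg_one, norm_inv, Complex.norm_natCast]
    exact inv_le_one_of_one_le₀ hp1
  rw [norm_one]; linarith

/-- Lower bound for `L(1,χ)` when some real character has a real zero close to `1`. -/
lemma exists_le_norm_LFunction_one_of_zero {ε δ β : ℝ} (hε : 0 < ε) (hδ : 24 * δ ≤ ε)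
    (hδ8 : δ ≤ 1 / 8) {r : ℕ} [NeZero r] {ψ : DirichletCharacter ℂ r} (hψ : ψ ≠ 1)
    (hψ2 : ψ ^ 2 = 1) (hβ : 1 - δ ≤ β) (hβ1 : β < 1) (h0 : ψ.LFunction β = 0) :
    ∃ c > (0 : ℝ), ∀ (q : ℕ) [NeZero q] (χ : DirichletCharacter ℂ q), χ ≠ 1 → χ ^ 2 = 1 →
      c * (q : ℝ) ^ (-ε) ≤ ‖χ.LFunction 1‖ := by
  obtain ⟨K₁, hK₁, h₁⟩ := exists_half_le_zeta_mul_LFunction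
  obtain ⟨K₂, hK₂, h₂⟩ := exists_half_le_fourfold
  obtain ⟨C₁, hC₁, δ₁, hδ₁, -, h₃⟩ := exists_norm_LFunction_deriv_le (div_pos hε (by norm_num : (0 : ℝ) < 8))
  obtain ⟨C₂, hC₂, h₄⟩ := exists_two_pow_card_primeFactors_le (ε := ε / 8) (by linarith)
  set K := max K₁ K₂ with hK
  have hK1 : 1 ≤ K := hK₁.trans (le_max_left _ _)
  set D : ℝ := C₁ * 2 ^ (ε / 8) * C₂ * (C₁ * 2 ^ (ε / 8)) * (K / (1 - β)) with hD
  have h1β : 0 < 1 - β := by linarith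
  have hDpos : 0 < D := by positivity
  have hrpos : (0 : ℝ) < r := by exact_mod_cast NeZero.pos r
  refine ⟨1 / (2 * D * (r : ℝ) ^ ε), by positivity, fun q _ χ hχ hχ2 => ?_⟩
  have hqpos : (0 : ℝ) < q := by exact_mod_cast NeZero.pos q
  set N := r * q with hN
  have : NeZero N := ⟨mul_ne_zero (NeZero.ne r) (NeZero.ne q)⟩
  have hN1 : (1 : ℝ) ≤ N := by exact_mod_cast NeZero.one_le
  set ψ' := DirichletCharacter.changeLevel (Dvd.intro _ rfl : r ∣ N) ψ with hψ'
  set χ' := DirichletCharacter.changeLevel (Dvd.intro_left _ rfl : q ∣ N) χ with hχ'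
  have hψ'1 : ψ' ≠ 1 := (DirichletCharacter.changeLevel_eq_one_iff _).not.2 hψ
  have hχ'1 : χ' ≠ 1 := (DirichletCharacter.changeLevel_eq_one_iff _).not.2 hχ
  have hψ'2 : ψ' ^ 2 = 1 := by rw [hψ', ← map_pow, hψ2, map_one]
  have hχ'2 : χ' ^ 2 = 1 := by rw [hχ', ← map_pow, hχ2, map_one]
  have hψ'0 : ψ'.LFunction β = 0 := by
    rw [hψ', DirichletCharacter.LFunction_changeLevel _ _ (.inl hψ), h0, zero_mul]
  have hL : ‖χ'.LFunction 1‖ ≤ ‖χ.LFunction 1‖ * (C₂ * (N : ℝ) ^ (ε / 8)) := by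
    refine (norm_LFunction_changeLevel_one_le _ hχ).trans ?_
    gcongr
    exact h₄ N (NeZero.ne N)
  have hone : ∀ φ : DirichletCharacter ℂ N, φ ≠ 1 →
      ‖φ.LFunction 1‖ ≤ C₁ * 2 ^ (ε / 8) * (N : ℝ) ^ (ε / 8) := by
    intro φ hφ
    have := (h₃ N φ hφ 1 (by simp; linarith)).1
    simp only [Complex.one_im, abs_zero, zero_add] at this
    rw [mul_comm (N : ℝ) 2, Real.mul_rpow (by norm_num) (by positivity)] at this
    linarith
  have hX : ∀ k : ℝ, 1 ≤ k → k ≤ K → (k * (N : ℝ) ^ 3) ^ (4 * (1 - β)) / (1 - β) ≤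
      K / (1 - β) * (N : ℝ) ^ (ε / 2) := by
    intro k hk1 hk
    rw [div_mul_eq_mul_div]
    gcongr
    rw [Real.mul_rpow (by linarith) (by positivity), ← Real.rpow_natCast (N : ℝ),
      ← Real.rpow_mul (by positivity)]
    refine mul_le_mul ?_ ?_ (by positivity) (by linarith)
    · calc k ^ (4 * (1 - β)) ≤ K ^ (4 * (1 - β)) := by gcongr
        _ ≤ K ^ (1 : ℝ) := Real.rpow_le_rpow_of_exponent_le hK1 (by linarith)
        _ = K := Real.rpow_one K
    · refine Real.rpow_le_rpow_of_exponent_le hN1 ?_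
      push_cast; linarith
  have hA1 : 1 ≤ C₁ * 2 ^ (ε / 8) * (N : ℝ) ^ (ε / 8) := by
    have h1 := Real.one_le_rpow (show (1 : ℝ) ≤ 2 by norm_num) (show 0 ≤ ε / 8 by linarith)
    have h2 := Real.one_le_rpow hN1 (show 0 ≤ ε / 8 by linarith)
    exact one_le_mul_of_one_le_of_one_le (one_le_mul_of_one_le_of_one_le hC₁ h1) h2
  set A : ℝ := C₁ * 2 ^ (ε / 8) * (N : ℝ) ^ (ε / 8) with hA
  have key : 1 / 2 ≤ A * (‖χ.LFunction 1‖ * (C₂ * (N : ℝ) ^ (ε / 8))) * A *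
      (K / (1 - β) * (N : ℝ) ^ (ε / 2)) := by
    by_cases hprod : ψ' * χ' = 1
    · have hχψ : χ' = ψ' := by
        rw [← one_mul χ', ← hψ'2, pow_two, mul_assoc, hprod, mul_one]
      have h := (h₁ N χ' hχ'1 hχ'2).2 β (by linarith) hβ1
      rw [show χ'.LFunction β = 0 by rw [hχψ]; exact hψ'0, mul_zero, Complex.zero_re, zero_add] at h
      refine h.trans ?_
      refine mul_le_mul ?_ (hX K₁ hK₁ (le_max_left _ _)) (by positivity) (by positivity)
      refine hL.trans ?_
      set B := ‖χ.LFunction 1‖ * (C₂ * (N : ℝ) ^ (ε / 8)) with hB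
      have hB0 : 0 ≤ B := by positivity
      nlinarith [mul_le_mul hA1 hA1 zero_le_one (by linarith : 0 ≤ A)]
    · have h := h₂ N ψ' χ' hψ'1 hψ'2 hχ'1 hχ'2 hprod β (by linarith) hβ1
      rw [hψ'0, zero_mul, mul_zero, Complex.zero_re, zero_add] at h
      refine h.trans ?_
      refine mul_le_mul ?_ (hX K₂ hK₂ (le_max_right _ _)) (by positivity) (by positivity)
      rw [norm_mul, norm_mul, mul_assoc]
      have e1 := hone _ hψ'1
      have e2 := hone _ hprod
      gcongr
  have e : A * (‖χ.LFunction 1‖ * (C₂ * (N : ℝ) ^ (ε / 8))) * A *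
      (K / (1 - β) * (N : ℝ) ^ (ε / 2)) ≤ ‖χ.LFunction 1‖ * (D * ((r : ℝ) ^ ε * (q : ℝ) ^ ε)) := by
    have e1 : (N : ℝ) ^ (ε / 8) * (N : ℝ) ^ (ε / 8) * (N : ℝ) ^ (ε / 8) * (N : ℝ) ^ (ε / 2) ≤
        (r : ℝ) ^ ε * (q : ℝ) ^ ε := by
      rw [← Real.mul_rpow hrpos.le hqpos.le, ← Nat.cast_mul, ← hN]
      simp only [← Real.rpow_add (by linarith : (0 : ℝ) < N)]
      exact Real.rpow_le_rpow_of_exponent_le hN1 (by linarith)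
    calc _ = ‖χ.LFunction 1‖ * (D * ((N : ℝ) ^ (ε / 8) * (N : ℝ) ^ (ε / 8) * (N : ℝ) ^ (ε / 8) *
          (N : ℝ) ^ (ε / 2))) := by rw [hA, hD]; ring
      _ ≤ _ := by gcongr
  have hfin := key.trans e
  rw [Real.rpow_neg hqpos.le, ← div_eq_mul_inv, div_div, div_le_iff₀ (by positivity)]
  linarith

/-- Siegel's theorem on `L(1,χ)` for real characters. -/
theorem exists_siegel {ε : ℝ} (hε : 0 < ε) :
    ∃ c > (0 : ℝ), ∀ (q : ℕ) [NeZero q] (χ : DirichletCharacter ℂ q), χ ≠ 1 → χ ^ 2 = 1 →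
      c * (q : ℝ) ^ (-ε) ≤ ‖χ.LFunction 1‖ := by
  obtain ⟨δ₀, hδ₀, hζ⟩ := exists_re_riemannZeta_neg
  set δ := min δ₀ (min (1 / 8) (ε / 24)) with hδ
  have hδpos : 0 < δ := by positivity
  have hδ1 : δ ≤ δ₀ := min_le_left _ _
  have hδ2 : δ ≤ 1 / 8 := (min_le_right _ _).trans (min_le_left _ _)
  have hδ3 : δ ≤ ε / 24 := (min_le_right _ _).trans (min_le_right _ _)
  by_cases h : ∃ (r : ℕ) (_ : NeZero r) (ψ : DirichletCharacter ℂ r) (β : ℝ), ψ ≠ 1 ∧ ψ ^ 2 = 1 ∧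
      1 - δ ≤ β ∧ β < 1 ∧ ψ.LFunction β = 0
  · obtain ⟨r, _, ψ, β, hψ, hψ2, hβ, hβ1, h0⟩ := h
    exact exists_le_norm_LFunction_one_of_zero hε (by linarith) hδ2 hψ hψ2 hβ hβ1 h0
  · obtain ⟨K, hK, h₁⟩ := exists_half_le_zeta_mul_LFunction
    refine ⟨δ / (2 * K), by positivity, fun q _ χ hχ hχ2 => ?_⟩
    have hq1 : (1 : ℝ) ≤ q := by exact_mod_cast NeZero.one_le
    have hpos : 0 < (χ.LFunction (1 - δ : ℝ)).re := by
      refine re_LFunction_pos_of_forall_ne_zero hχ hχ2 (by linarith) (by linarith) ?_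
      intro x hx hx1 h0
      exact h ⟨q, inferInstance, χ, x, hχ, hχ2, hx, hx1, h0⟩
    have hz := hζ (1 - δ) (by linarith) (by linarith)
    have him := im_LFunction_ofReal_eq_zero hχ hχ2 (σ := 1 - δ) (by linarith)
    have h2 := (h₁ q χ hχ hχ2).2 (1 - δ) (by linarith) (by linarith)
    rw [Complex.mul_re, him, mul_zero, sub_zero, sub_sub_cancel] at h2
    have h3 : (riemannZeta (1 - δ : ℝ)).re * (χ.LFunction (1 - δ : ℝ)).re < 0 :=
      mul_neg_of_neg_of_pos hz hpos
    have h4 : (K * (q : ℝ) ^ 3) ^ (4 * δ) / δ ≤ K * (q : ℝ) ^ ε / δ := by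
      gcongr
      rw [Real.mul_rpow (by linarith) (by positivity), ← Real.rpow_natCast (q : ℝ),
        ← Real.rpow_mul (by positivity)]
      refine mul_le_mul ?_ ?_ (by positivity) (by linarith)
      · calc K ^ (4 * δ) ≤ K ^ (1 : ℝ) := Real.rpow_le_rpow_of_exponent_le hK (by linarith)
          _ = K := Real.rpow_one K
      · refine Real.rpow_le_rpow_of_exponent_le hq1 ?_
        push_cast; linarith
    have h5 : 1 / 2 ≤ ‖χ.LFunction 1‖ * (K * (q : ℝ) ^ ε / δ) := by
      have : ‖χ.LFunction 1‖ * ((K * (q : ℝ) ^ 3) ^ (4 * δ) / δ) ≤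
          ‖χ.LFunction 1‖ * (K * (q : ℝ) ^ ε / δ) := by gcongr
      linarith
    rw [Real.rpow_neg (by positivity), ← div_eq_mul_inv, div_div, div_le_iff₀ (by positivity)]
    have h6 : ‖χ.LFunction 1‖ * (K * (q : ℝ) ^ ε / δ) * (2 * δ) =
      ‖χ.LFunction 1‖ * (2 * K * (q : ℝ) ^ ε) := by field_simp
    rw [← h6]
    nlinarith

lemma norm_LSeries_le_tsum {f : ℕ → ℂ} (hf : ∀ n, ‖f n‖ ≤ 1) {s : ℂ} (hs : 1 < s.re) :
    ‖LSeries f s‖ ≤ ∑' n : ℕ, 1 / (n : ℝ) ^ s.re := by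
  have hsum : Summable fun n : ℕ => 1 / (n : ℝ) ^ s.re := Real.summable_one_div_nat_rpow.2 hs
  refine tsum_of_norm_bounded hsum.hasSum fun n => ?_
  rw [LSeries.norm_term_eq]
  split_ifs with h
  · positivity
  · gcongr
    exact hf n

lemma exists_tsum_one_div_rpow_le : ∃ C : ℝ, 1 ≤ C ∧ ∀ σ : ℝ, 1 < σ → σ ≤ 2 →
    ∑' n : ℕ, 1 / (n : ℝ) ^ σ ≤ 4 * C / (σ - 1) := by
  obtain ⟨C, hC, h⟩ := exists_norm_riemannZeta_le (ε := 1) one_pos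
  refine ⟨C, hC, fun σ hs hs2 => ?_⟩
  have h1 := h (σ : ℂ) (by simpa using hs) (by simpa using hs2)
  have h2 : riemannZeta (σ : ℂ) = ((∑' n : ℕ, 1 / (n : ℝ) ^ σ : ℝ) : ℂ) := by
    rw [zeta_eq_tsum_one_div_nat_cpow (by simpa using hs)]
    push_cast
    congr 1
    ext n
    rw [Complex.ofReal_cpow (by positivity)]
    simp
  have h0 : 0 ≤ ∑' n : ℕ, 1 / (n : ℝ) ^ σ := tsum_nonneg fun n => by positivity
  rw [h2, Complex.norm_real, Real.norm_of_nonneg h0] at h1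
  refine h1.trans ?_
  have h3 : ‖(σ : ℂ) - 1‖ = σ - 1 := by
    rw [← Complex.ofReal_one, ← Complex.ofReal_sub, Complex.norm_real,
      Real.norm_of_nonneg (by linarith)]
  rw [h3]
  have h4 : 1 + 1 / (σ - 1) ≤ 2 / (σ - 1) := by
    rw [← sub_nonneg, show 2 / (σ - 1) - (1 + 1 / (σ - 1)) = (2 - σ) / (σ - 1) by
      field_simp [show σ - 1 ≠ 0 by linarith]; ring]
    exact div_nonneg (by linarith) (by linarith)
  calc _ ≤ C * 2 * (2 / (σ - 1)) := by
        simp only [Complex.ofReal_im, abs_zero, zero_add, Real.rpow_one]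
        gcongr
    _ = _ := by ring

lemma exists_mul_le_norm_LFunction :
    ∃ c > (0 : ℝ), ∀ (q : ℕ) [NeZero q] (χ : DirichletCharacter ℂ q), ∀ s : ℂ, 1 < s.re →
      s.re ≤ 2 → c * (s.re - 1) ≤ ‖χ.LFunction s‖ := by
  obtain ⟨C, hC, h⟩ := exists_tsum_one_div_rpow_le
  refine ⟨1 / (4 * C), by positivity, fun q _ χ s hs hs2 => ?_⟩
  have hζ := h s.re hs hs2
  have hmu : ‖LSeries (fun n => χ n * (ArithmeticFunction.moebius n : ℂ)) s‖ ≤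
      4 * C / (s.re - 1) := by
    refine (norm_LSeries_le_tsum (fun n => ?_) hs).trans hζ
    rw [norm_mul]
    refine mul_le_one₀ (χ.norm_le_one _) (norm_nonneg _) ?_
    rw [Complex.norm_intCast]
    exact_mod_cast ArithmeticFunction.abs_moebius_le_one
  have hone := DirichletCharacter.LSeries.mul_mu_eq_one χ hs
  rw [← DirichletCharacter.LFunction_eq_LSeries χ hs] at hone
  have hn := congrArg norm hone
  rw [norm_mul, norm_one] at hn
  have h5 : 0 < s.re - 1 := by linarith
  have h6 : 1 ≤ ‖χ.LFunction s‖ * (4 * C / (s.re - 1)) := by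
    exact hn.symm.le.trans (mul_le_mul_of_nonneg_left hmu (norm_nonneg _))
  rw [mul_div_assoc', le_div_iff₀ h5] at h6
  rw [div_mul_eq_mul_div, div_le_iff₀ (by positivity)]
  linarith

lemma norm_LFunction_sub_le {q : ℕ} [NeZero q] {χ : DirichletCharacter ℂ q} (hχ : χ ≠ 1)
    {M σ₀ T : ℝ} (hM : ∀ s : ℂ, σ₀ ≤ s.re → |s.im| ≤ T → ‖deriv χ.LFunction s‖ ≤ M)
    {s w : ℂ} (hs : σ₀ ≤ s.re) (hsT : |s.im| ≤ T) (hw : σ₀ ≤ w.re) (hwT : |w.im| ≤ T) :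
    ‖χ.LFunction s - χ.LFunction w‖ ≤ M * ‖s - w‖ := by
  have hconv : Convex ℝ {z : ℂ | σ₀ ≤ z.re ∧ |z.im| ≤ T} := by
    have : {z : ℂ | σ₀ ≤ z.re ∧ |z.im| ≤ T} = {z : ℂ | σ₀ ≤ z.re} ∩ ({z : ℂ | -T ≤ z.im} ∩
        {z : ℂ | z.im ≤ T}) := by
      ext z; simp [abs_le]
    rw [this]
    exact (convex_halfSpace_re_ge _).inter
      ((convex_halfSpace_im_ge _).inter (convex_halfSpace_im_le _))
  exact hconv.norm_image_sub_le_of_norm_deriv_le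
    (fun z _ => (DirichletCharacter.differentiable_LFunction hχ) z)
    (fun z hz => hM z hz.1 hz.2) ⟨hw, hwT⟩ ⟨hs, hsT⟩

lemma exists_le_norm_LFunction_of_one_lt_re {ε : ℝ} (hε : 0 < ε) :
    ∃ c > (0 : ℝ), ∀ (q : ℕ) [NeZero q] (χ : DirichletCharacter ℂ q), χ ≠ 1 → ∀ s : ℂ, 1 < s.re →
      s.re ≤ 2 → c * (q * (|s.im| + 2)) ^ (-ε) ≤ ‖χ.LFunction s‖ := by
  have he : 0 < ε / 28 := by positivity
  obtain ⟨c₀, hc₀, h₀⟩ := exists_siegel he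
  obtain ⟨C₁, hC₁, δ, hδ, -, h₁⟩ := exists_norm_LFunction_deriv_le he
  obtain ⟨c₂, hc₂, h₂⟩ := exists_mul_le_norm_LFunction
  set e := ε / 28 with hedef
  have h3e : (0 : ℝ) < 3 ^ e := by positivity
  set c₁ : ℝ := min 1 (c₀ / (2 * C₁ * 3 ^ e)) with hc₁
  have hc₁pos : 0 < c₁ := by positivity
  have hc₁1 : c₁ ≤ 1 := min_le_left _ _
  have hc₁2 : C₁ * 3 ^ e * c₁ ≤ c₀ / 2 := by
    have : c₁ ≤ c₀ / (2 * C₁ * 3 ^ e) := min_le_right _ _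
    rw [le_div_iff₀ (by positivity)] at this
    linarith
  obtain ⟨c₃, hc₃, h₃⟩ := exists_le_norm_LFunction_of_nonexceptional (ε := 2 * e) (κ := c₁ / 2)
    (by positivity) (by positivity) (by linarith)
  refine ⟨min c₃ (min (c₀ / 2) (c₂ * c₁ / 2)), by positivity, fun q _ χ hχ s hs hs2 => ?_⟩
  have hq1 : (1 : ℝ) ≤ q := by exact_mod_cast NeZero.one_le
  have hQ : (q : ℝ) ≤ q * (|s.im| + 2) := by nlinarith [abs_nonneg s.im]
  have hQ1 : (1 : ℝ) ≤ q * (|s.im| + 2) := hq1.trans hQ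
  have hpow : ∀ a : ℝ, 0 ≤ a → a ≤ ε →
      ((q : ℝ) * (|s.im| + 2)) ^ (-ε) ≤ (q : ℝ) ^ (-a) := fun a ha ha' =>
    (Real.rpow_le_rpow_of_exponent_le hQ1 (neg_le_neg ha')).trans
      (Real.rpow_le_rpow_of_nonpos (by linarith) hQ (by linarith))
  by_cases hne : χ ^ 2 ≠ 1 ∨ c₁ / 2 * (q * (|s.im| + 2)) ^ (-(2 * e)) ≤ |s.im|
  · have := h₃ q χ hχ s hs hs2 hne
    rw [show -(14 * (2 * e)) = -ε by rw [hedef]; ring] at this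
    refine le_trans ?_ this
    gcongr
    exact min_le_left _ _
  push Not at hne
  obtain ⟨hχ2, ht⟩ := hne
  have ht2 : |s.im| < c₁ / 2 * (q : ℝ) ^ (-(2 * e)) := by
    exact ht.trans_le (mul_le_mul_of_nonneg_left
      (Real.rpow_le_rpow_of_nonpos (by linarith) hQ (by linarith)) (by positivity))
  have hqe : (q : ℝ) ^ (-(2 * e)) ≤ 1 := Real.rpow_le_one_of_one_le_of_nonpos hq1 (by linarith)
  have hqe0 : (0 : ℝ) < (q : ℝ) ^ (-(2 * e)) := by positivity
  have ht1 : |s.im| ≤ 1 := by nlinarith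
  by_cases hσ : s.re - 1 ≤ c₁ / 2 * (q : ℝ) ^ (-(2 * e))
  · have hsub : ‖s - 1‖ ≤ c₁ * (q : ℝ) ^ (-(2 * e)) := by
      refine (Complex.norm_le_abs_re_add_abs_im _).trans ?_
      simp only [Complex.sub_re, Complex.one_re, Complex.sub_im, Complex.one_im, sub_zero]
      rw [abs_of_pos (by linarith : 0 < s.re - 1)]
      linarith
    have hdiff := norm_LFunction_sub_le (σ₀ := 1) (T := 1) (M := C₁ * (3 ^ e * (q : ℝ) ^ e)) hχ
      (fun z hz hzT => by
        refine (h₁ q χ hχ z (by linarith)).2.trans ?_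
        rw [← Real.mul_rpow (by norm_num) (by positivity), mul_comm (3 : ℝ)]
        gcongr
        linarith) hs.le ht1 (w := 1) (by simp) (by simp)
    have h4 : ‖χ.LFunction s - χ.LFunction 1‖ ≤ c₀ / 2 * (q : ℝ) ^ (-e) := by
      refine hdiff.trans ?_
      calc _ ≤ C₁ * (3 ^ e * (q : ℝ) ^ e) * (c₁ * (q : ℝ) ^ (-(2 * e))) := by gcongr
        _ = C₁ * 3 ^ e * c₁ * ((q : ℝ) ^ e * (q : ℝ) ^ (-(2 * e))) := by ring
        _ = C₁ * 3 ^ e * c₁ * (q : ℝ) ^ (-e) := by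
            rw [← Real.rpow_add (by linarith)]; ring_nf
        _ ≤ _ := by gcongr
    have h5 := h₀ q χ hχ hχ2
    have h6 : ‖χ.LFunction 1‖ ≤ ‖χ.LFunction s‖ + ‖χ.LFunction s - χ.LFunction 1‖ := by
      have := norm_sub_norm_le (χ.LFunction 1) (χ.LFunction s)
      rw [norm_sub_rev] at this
      linarith
    calc _ ≤ c₀ / 2 * (q : ℝ) ^ (-e) := by
          gcongr
          · exact (min_le_right _ _).trans (min_le_left _ _)
          · exact hpow e he.le (by rw [hedef]; linarith)
      _ ≤ _ := by linarith
  · push Not at hσ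
    calc _ ≤ c₂ * c₁ / 2 * (q : ℝ) ^ (-(2 * e)) := by
          gcongr
          · exact (min_le_right _ _).trans (min_le_right _ _)
          · exact hpow (2 * e) (by positivity) (by rw [hedef]; linarith)
      _ = c₂ * (c₁ / 2 * (q : ℝ) ^ (-(2 * e))) := by ring
      _ ≤ c₂ * (s.re - 1) := by gcongr
      _ ≤ _ := h₂ q χ s hs hs2

/-- A zero-free region with a bound for the logarithmic derivative. -/
theorem exists_norm_deriv_div_LFunction_le {ε : ℝ} (hε : 0 < ε) :
    ∃ c > (0 : ℝ), c ≤ 1 / 4 ∧ ∃ C : ℝ, 1 ≤ C ∧ ∀ (q : ℕ) [NeZero q] (χ : DirichletCharacter ℂ q),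
      χ ≠ 1 → ∀ s : ℂ, 1 - c * (q * (|s.im| + 2)) ^ (-ε) ≤ s.re → s.re ≤ 2 →
      χ.LFunction s ≠ 0 ∧
        ‖deriv χ.LFunction s / χ.LFunction s‖ ≤ C * (q * (|s.im| + 2)) ^ ε := by
  have he : 0 < ε / 2 := by positivity
  obtain ⟨c₀, hc₀, h₀⟩ := exists_le_norm_LFunction_of_one_lt_re he
  obtain ⟨C₁, hC₁, δ, hδ, hδ1, h₁⟩ := exists_norm_LFunction_deriv_le he
  set e := ε / 2 with hedef
  set c : ℝ := min δ (c₀ / (4 * C₁)) with hc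
  have hcpos : 0 < c := by positivity
  have hcδ : c ≤ δ := min_le_left _ _
  have hcC : C₁ * (2 * c) ≤ c₀ / 2 := by
    have : c ≤ c₀ / (4 * C₁) := min_le_right _ _
    rw [le_div_iff₀ (by positivity)] at this
    linarith
  refine ⟨c, hcpos, hcδ.trans hδ1, max 1 (C₁ / (c₀ / 2)), le_max_left _ _,
    fun q _ χ hχ s hs hs2 => ?_⟩
  have hq1 : (1 : ℝ) ≤ q := by exact_mod_cast NeZero.one_le
  set Q : ℝ := q * (|s.im| + 2) with hQdef
  have hQ1 : (1 : ℝ) ≤ Q := by nlinarith [abs_nonneg s.im]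
  have hQ0 : 0 < Q := by linarith
  have hQε : Q ^ (-ε) ≤ 1 := Real.rpow_le_one_of_one_le_of_nonpos hQ1 (by linarith)
  have hQε0 : 0 < Q ^ (-ε) := by positivity
  have hlow : c₀ / 2 * Q ^ (-e) ≤ ‖χ.LFunction s‖ := by
    by_cases h : 1 + c * Q ^ (-ε) ≤ s.re
    · have := h₀ q χ hχ s (by nlinarith) hs2
      refine le_trans ?_ this
      gcongr
      linarith
    push Not at h
    set w : ℂ := ⟨1 + c * Q ^ (-ε), s.im⟩ with hw
    have h2 := h₀ q χ hχ w (by simp only [hw]; nlinarith) (by simp only [hw]; nlinarith)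
    have hdiff := norm_LFunction_sub_le (σ₀ := 1 - δ) (T := |s.im|) (M := C₁ * Q ^ e) hχ
      (fun z hz hzT => by
        refine (h₁ q χ hχ z hz).2.trans ?_
        rw [hQdef]
        gcongr) (s := s) (w := w) (by nlinarith) le_rfl (by simp only [hw]; nlinarith) le_rfl
    have hsw : ‖s - w‖ ≤ 2 * c * Q ^ (-ε) := by
      refine (Complex.norm_le_abs_re_add_abs_im _).trans ?_
      simp only [hw, Complex.sub_re, Complex.sub_im, sub_self, abs_zero, add_zero]
      rw [abs_le]
      constructor <;> nlinarith
    have h4 : ‖χ.LFunction s - χ.LFunction w‖ ≤ c₀ / 2 * Q ^ (-e) := by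
      refine hdiff.trans ?_
      calc _ ≤ C₁ * Q ^ e * (2 * c * Q ^ (-ε)) := by gcongr
        _ = C₁ * (2 * c) * (Q ^ e * Q ^ (-ε)) := by ring
        _ = C₁ * (2 * c) * Q ^ (-e) := by
            rw [← Real.rpow_add hQ0, hedef]; ring_nf
        _ ≤ _ := by gcongr
    have h6 : ‖χ.LFunction w‖ ≤ ‖χ.LFunction s‖ + ‖χ.LFunction s - χ.LFunction w‖ := by
      have := norm_sub_norm_le (χ.LFunction w) (χ.LFunction s)
      rw [norm_sub_rev] at this
      linarith
    have h7 : c₀ * Q ^ (-e) ≤ ‖χ.LFunction w‖ := h2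
    linarith
  have hpos : 0 < ‖χ.LFunction s‖ := lt_of_lt_of_le (by positivity) hlow
  refine ⟨norm_pos_iff.1 hpos, ?_⟩
  have hder := (h₁ q χ hχ s (by nlinarith)).2
  rw [norm_div, div_le_iff₀ hpos]
  calc _ ≤ C₁ * Q ^ e := hder
    _ = C₁ / (c₀ / 2) * Q ^ ε * (c₀ / 2 * Q ^ (-e)) := by
        rw [show Q ^ e = Q ^ ε * Q ^ (-e) by rw [← Real.rpow_add hQ0, hedef]; ring_nf]
        field_simp
    _ ≤ _ := by
        gcongr
        exact le_max_right _ _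

section

open MeasureTheory

lemma norm_kernel_le {s : ℂ} (hs : 0 < s.re) : ‖1 / (s * (s + 1))‖ ≤ 1 / (s.re ^ 2 + s.im ^ 2) := by
  have h0 : 0 < s.re ^ 2 + s.im ^ 2 := by positivity
  rw [norm_div, norm_one, norm_mul]
  have h1 : ‖s‖ ^ 2 = s.re ^ 2 + s.im ^ 2 := by
    rw [Complex.sq_norm, Complex.normSq_apply]; ring
  have h2 : ‖s + 1‖ ^ 2 = (s.re + 1) ^ 2 + s.im ^ 2 := by
    rw [Complex.sq_norm, Complex.normSq_apply]; simp; ring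
  have h3 : ‖s‖ ≤ ‖s + 1‖ := by
    rw [← sq_le_sq₀ (norm_nonneg _) (norm_nonneg _), h1, h2]
    nlinarith
  rw [← h1]
  have : 0 < ‖s‖ := norm_pos_iff.2 (by rintro rfl; simp at hs)
  gcongr
  nlinarith

lemma continuous_kernel {σ : ℝ} (hσ : 0 < σ) :
    Continuous fun t : ℝ => 1 / (((σ : ℂ) + t * Complex.I) * ((σ : ℂ) + t * Complex.I + 1)) := by
  refine Continuous.div continuous_const (by fun_prop) fun t => ?_
  refine mul_ne_zero (fun h => ?_) (fun h => ?_)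
  · have := congrArg Complex.re h
    simp at this; linarith
  · have := congrArg Complex.re h
    simp at this; linarith

lemma integrable_kernel {σ : ℝ} (hσ : 1 ≤ σ) :
    Integrable fun t : ℝ => 1 / (((σ : ℂ) + t * Complex.I) * ((σ : ℂ) + t * Complex.I + 1)) := by
  refine Integrable.mono' integrable_inv_one_add_sq
    (continuous_kernel (by linarith)).aestronglyMeasurable (Filter.Eventually.of_forall fun t => ?_)
  refine (norm_kernel_le (by simp; linarith)).trans ?_
  simp only [Complex.add_re, Complex.ofReal_re, Complex.mul_re, Complex.I_re, mul_zero,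
    Complex.ofReal_im, Complex.I_im, mul_one, sub_self, add_zero, Complex.add_im, Complex.mul_im,
    zero_add]
  rw [← one_div]
  gcongr
  nlinarith

/-- The Perron formula with kernel `1/(s(s+1))`. -/
lemma integral_kernel_eq {σ : ℝ} (hσ : 1 ≤ σ) {x : ℝ} (hx : 0 < x) :
    (1 / (2 * π)) • ∫ t : ℝ, (x : ℂ) ^ (-((σ : ℂ) + t * Complex.I)) *
      (1 / (((σ : ℂ) + t * Complex.I) * ((σ : ℂ) + t * Complex.I + 1))) =
      ((max (1 - x) 0 : ℝ) : ℂ) := by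
  set f : ℝ → ℂ := fun t => (Set.Ioc 0 1).indicator (fun _ => 1 : ℝ → ℂ) t -
    (Set.Ioc 0 1).indicator (fun t => (t : ℂ) ^ (1 : ℂ) : ℝ → ℂ) t with hf
  have hmel : ∀ s : ℂ, 0 < s.re → HasMellin f s (1 / (s * (s + 1))) := by
    intro s hs
    have h1 := hasMellin_one_Ioc hs
    have h2 := hasMellin_cpow_Ioc 1 (s := s) (by simp; linarith)
    have h3 := hasMellin_sub h1.1 h2.1
    rw [h1.2, h2.2] at h3
    have hs0 : s ≠ 0 := by rintro rfl; simp at hs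
    have hs1 : s + 1 ≠ 0 := by
      intro h
      have := congrArg Complex.re h
      simp at this; linarith
    have h4 : 1 / (s * (s + 1)) = 1 / s - 1 / (s + 1) := by
      field_simp
      ring
    rw [h4]
    exact h3
  have hfeq : ∀ t : ℝ, 0 < t → f t = ((max (1 - t) 0 : ℝ) : ℂ) := by
    intro t ht
    by_cases h1 : t ≤ 1
    · simp [hf, ht, h1]
    · have : max (1 - t) 0 = 0 := max_eq_right (by linarith)
      simp [hf, h1, this]
  have hcont : ContinuousAt f x := by
    have : Continuous fun t : ℝ => ((max (1 - t) 0 : ℝ) : ℂ) := by fun_prop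
    refine this.continuousAt.congr ?_
    filter_upwards [lt_mem_nhds hx] with t ht using (hfeq t ht).symm
  have hre : ∀ t : ℝ, 0 < ((σ : ℂ) + t * Complex.I).re := fun t => by simp; linarith
  have hval : ∀ t : ℝ, mellin f ((σ : ℂ) + t * Complex.I) =
      1 / (((σ : ℂ) + t * Complex.I) * ((σ : ℂ) + t * Complex.I + 1)) :=
    fun t => (hmel _ (hre t)).2
  have hvert : Complex.VerticalIntegrable (mellin f) σ := by
    unfold Complex.VerticalIntegrable
    simp_rw [hval]
    exact integrable_kernel hσ
  have := mellinInv_mellin_eq σ f hx (hmel σ (by simp; linarith)).1 hvert hcont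
  rw [hfeq x hx] at this
  rw [← this, mellinInv]
  simp_rw [hval, smul_eq_mul]

lemma sum_character_mul_vonMangoldt_eq_integral {q : ℕ} [NeZero q] (χ : DirichletCharacter ℂ q)
    {σ x : ℝ} (hσ : 1 < σ) (hx : 1 ≤ x) :
    Integrable (fun t : ℝ => -deriv χ.LFunction (σ + t * Complex.I) /
      χ.LFunction (σ + t * Complex.I) * (x : ℂ) ^ ((σ : ℂ) + t * Complex.I) *
      (1 / (((σ : ℂ) + t * Complex.I) * ((σ : ℂ) + t * Complex.I + 1)))) ∧
    ∑ n ∈ Icc 1 ⌊x⌋₊, χ n * (ArithmeticFunction.vonMangoldt n : ℂ) * ((1 - n / x : ℝ) : ℂ) =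
      (1 / (2 * π)) • ∫ t : ℝ, -deriv χ.LFunction (σ + t * Complex.I) /
      χ.LFunction (σ + t * Complex.I) * (x : ℂ) ^ ((σ : ℂ) + t * Complex.I) *
      (1 / (((σ : ℂ) + t * Complex.I) * ((σ : ℂ) + t * Complex.I + 1))) := by
  have hx0 : 0 < x := by linarith
  set a : ℕ → ℂ := fun n => χ n * (ArithmeticFunction.vonMangoldt n : ℂ) with ha
  set K : ℝ → ℂ := fun t => 1 / (((σ : ℂ) + t * Complex.I) * ((σ : ℂ) + t * Complex.I + 1)) with hK
  have hKint : Integrable K := integrable_kernel hσ.le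
  have hre : ∀ t : ℝ, ((σ : ℂ) + t * Complex.I).re = σ := fun t => by simp
  have hsum : ∀ t : ℝ, LSeriesSummable a (σ + t * Complex.I) := fun t =>
    DirichletCharacter.LSeriesSummable_twist_vonMangoldt χ (by rw [hre]; exact hσ)
  have hval : ∀ t : ℝ, LSeries a (σ + t * Complex.I) = -deriv χ.LFunction (σ + t * Complex.I) /
      χ.LFunction (σ + t * Complex.I) := by
    intro t
    have h1 : 1 < ((σ : ℂ) + t * Complex.I).re := by rw [hre]; exact hσ
    rw [DirichletCharacter.deriv_LFunction_eq_deriv_LSeries χ h1,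
      DirichletCharacter.LFunction_eq_LSeries χ h1,
      ← DirichletCharacter.LSeries_twist_vonMangoldt_eq χ h1]
    rfl
  have hnorm : ∀ (n : ℕ) (t : ℝ), ‖LSeries.term a (σ + t * Complex.I) n‖ =
      ‖LSeries.term a σ n‖ := by
    intro n t
    rw [LSeries.norm_term_eq, LSeries.norm_term_eq, hre, Complex.ofReal_re]
  have hsum0 : Summable fun n => ‖LSeries.term a σ n‖ := by
    have := (hsum 0).norm
    simpa using this
  have hxn : ∀ t : ℝ, ‖(x : ℂ) ^ ((σ : ℂ) + t * Complex.I)‖ = x ^ σ := fun t => by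
    rw [Complex.norm_cpow_eq_rpow_re_of_pos hx0, hre]
  have hxcont : Continuous fun t : ℝ => (x : ℂ) ^ ((σ : ℂ) + t * Complex.I) :=
    Continuous.const_cpow (by fun_prop) (.inl (by exact_mod_cast hx0.ne'))
  have htcont : ∀ n, Continuous fun t : ℝ => LSeries.term a (σ + t * Complex.I) n := by
    intro n
    rcases eq_or_ne n 0 with rfl | hn
    · simp only [LSeries.term_zero]; exact continuous_const
    · simp only [LSeries.term_of_ne_zero hn]
      refine Continuous.div continuous_const
        (Continuous.const_cpow (by fun_prop) (.inl (by exact_mod_cast hn))) fun t => ?_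
      simp [Complex.cpow_eq_zero_iff, hn]
  set F : ℕ → ℝ → ℂ := fun n t => LSeries.term a (σ + t * Complex.I) n *
    (x : ℂ) ^ ((σ : ℂ) + t * Complex.I) * K t with hF
  have hKcont : Continuous K := continuous_kernel (by linarith)
  have hFint : ∀ n, Integrable (F n) := by
    intro n
    refine hKint.bdd_mul (c := ‖LSeries.term a σ n‖ * x ^ σ)
      ((htcont n).mul hxcont).aestronglyMeasurable (Filter.Eventually.of_forall fun t => ?_)
    rw [norm_mul, hnorm, hxn]
  have hFnorm : ∀ n t, ‖F n t‖ = ‖LSeries.term a σ n‖ * (x ^ σ * ‖K t‖) := by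
    intro n t
    rw [hF]
    simp only
    rw [norm_mul, norm_mul, hnorm, hxn]; ring
  have hFsum : Summable fun n => ∫ t, ‖F n t‖ := by
    simp_rw [hFnorm, integral_const_mul]
    exact hsum0.mul_right _
  have htsum : ∀ t, HasSum (fun n => F n t) (-deriv χ.LFunction (σ + t * Complex.I) /
      χ.LFunction (σ + t * Complex.I) * (x : ℂ) ^ ((σ : ℂ) + t * Complex.I) * K t) := by
    intro t
    rw [← hval]
    exact ((hsum t).hasSum.mul_right _).mul_right _
  have hG := hasSum_integral_of_summable_integral_norm hFint hFsum
  simp_rw [(htsum _).tsum_eq] at hG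
  refine ⟨?_, ?_⟩
  · have hcont : Continuous fun t : ℝ => -deriv χ.LFunction (σ + t * Complex.I) /
        χ.LFunction (σ + t * Complex.I) := by
      simp_rw [← hval]
      refine continuous_tsum htcont hsum0 fun n t => (hnorm n t).le
    refine hKint.bdd_mul (c := (∑' n, ‖LSeries.term a σ n‖) * x ^ σ)
      (hcont.mul hxcont).aestronglyMeasurable (Filter.Eventually.of_forall fun t => ?_)
    rw [norm_mul, hxn, ← hval]
    gcongr
    exact tsum_of_norm_bounded hsum0.hasSum fun n => (hnorm n t).le
  · have hterm : ∀ n, (1 / (2 * π)) • ∫ t, F n t = a n * ((max (1 - n / x) 0 : ℝ) : ℂ) := by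
      intro n
      rcases eq_or_ne n 0 with rfl | hn
      · simp [hF, ha]
      have hn0 : (0 : ℝ) < n := by exact_mod_cast Nat.pos_of_ne_zero hn
      rw [← integral_kernel_eq hσ.le (show 0 < n / x by positivity), mul_smul_comm,
        ← integral_const_mul]
      congr 2
      ext t
      simp only [hF, hK]
      rw [LSeries.term_of_ne_zero hn]
      push_cast
      rw [Complex.cpow_neg, ← Complex.ofReal_natCast, ← Complex.ofReal_div,
        Complex.ofReal_div, div_eq_mul_inv ((n : ℝ) : ℂ) (x : ℂ), ← Complex.ofReal_inv,
        Complex.mul_cpow_ofReal_nonneg hn0.le (by positivity), Complex.ofReal_inv,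
        Complex.inv_cpow _ _ (by rw [Complex.arg_ofReal_of_nonneg hx0.le]; exact Real.pi_pos.ne)]
      rw [mul_inv, inv_inv]
      ring
    have hS : HasSum (fun n => (1 / (2 * π)) • ∫ t, F n t) _ := hG.const_smul (1 / (2 * π))
    simp_rw [hterm] at hS
    rw [← hS.tsum_eq, tsum_eq_sum (s := Icc 1 ⌊x⌋₊)]
    · refine Finset.sum_congr rfl fun n hn => ?_
      rw [Finset.mem_Icc] at hn
      have : (n : ℝ) ≤ x := (Nat.le_floor_iff hx0.le).1 hn.2
      rw [max_eq_left]
      rw [sub_nonneg, div_le_one hx0]; exact this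
    · intro n hn
      rcases eq_or_ne n 0 with rfl | hn0
      · simp [ha]
      have : x < n := by
        by_contra! h
        exact hn (Finset.mem_Icc.2 ⟨Nat.pos_of_ne_zero hn0, Nat.le_floor h⟩)
      rw [max_eq_right]
      · simp
      · rw [sub_nonpos, one_le_div hx0]; exact this.le

end

section

open MeasureTheory

lemma norm_integral_Ioi_le {f : ℝ → ℂ} {T c : ℝ} (hT : 0 < T)
    (h : ∀ t, T < t → ‖f t‖ ≤ c * t ^ (-(3 / 2) : ℝ)) :
    ‖∫ t in Set.Ioi T, f t‖ ≤ 2 * c * T ^ (-(1 / 2) : ℝ) := by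
  have hintegrable : IntegrableOn (fun t : ℝ => c * t ^ (-(3 / 2) : ℝ)) (Set.Ioi T) :=
    (integrableOn_Ioi_rpow_of_lt (by norm_num) hT).const_mul c
  refine (norm_integral_le_of_norm_le hintegrable ?_).trans ?_
  · filter_upwards [ae_restrict_mem measurableSet_Ioi] with t ht using h t ht
  · rw [integral_const_mul, integral_Ioi_rpow_of_lt (by norm_num) hT]
    norm_num
    apply le_of_eq
    ring

lemma norm_integral_le_of_tails {f : ℝ → ℂ} (hf : Integrable f) {T c : ℝ} (hT : 0 < T)
    (h : ∀ t, T ≤ |t| → ‖f t‖ ≤ c * |t| ^ (-(3 / 2) : ℝ)) :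
    ‖∫ t, f t‖ ≤ ‖∫ t in (-T)..T, f t‖ + 4 * c * T ^ (-(1 / 2) : ℝ) := by
  have h1 : ∫ t, f t = (∫ t in Set.Iic (-T), f t) + (∫ t in (-T)..T, f t) +
      ∫ t in Set.Ioi T, f t := by
    rw [add_assoc, intervalIntegral.integral_interval_add_Ioi hf.integrableOn hf.integrableOn,
      intervalIntegral.integral_Iic_add_Ioi hf.integrableOn hf.integrableOn]
  have h2 : ‖∫ t in Set.Ioi T, f t‖ ≤ 2 * c * T ^ (-(1 / 2) : ℝ) :=
    norm_integral_Ioi_le hT fun t ht => by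
      have := h t (by rw [abs_of_pos (hT.trans ht)]; exact ht.le)
      rwa [abs_of_pos (hT.trans ht)] at this
  have h3 : ‖∫ t in Set.Iic (-T), f t‖ ≤ 2 * c * T ^ (-(1 / 2) : ℝ) := by
    rw [← integral_comp_neg_Ioi]
    refine norm_integral_Ioi_le hT fun t ht => ?_
    have := h (-t) (by rw [abs_neg, abs_of_pos (hT.trans ht)]; exact ht.le)
    rwa [abs_neg, abs_of_pos (hT.trans ht)] at this
  rw [h1]
  have := norm_add₃_le (a := ∫ t in Set.Iic (-T), f t) (b := ∫ t in (-T)..T, f t)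
    (c := ∫ t in Set.Ioi T, f t)
  linarith

lemma norm_integral_vertical_le {G : ℂ → ℂ} {a b T : ℝ} (hab : a ≤ b) (hT : 0 ≤ T)
    (hG : ∀ s : ℂ, a ≤ s.re → s.re ≤ b → |s.im| ≤ T → DifferentiableAt ℂ G s) {B₁ B₂ : ℝ}
    (h₁ : ∀ t : ℝ, |t| ≤ T → ‖G (a + t * Complex.I)‖ ≤ B₁)
    (h₂ : ∀ s : ℂ, a ≤ s.re → s.re ≤ b → |s.im| = T → ‖G s‖ ≤ B₂) :
    ‖∫ t in (-T)..T, G (b + t * Complex.I)‖ ≤ 2 * T * B₁ + 2 * (b - a) * B₂ := by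
  have h := Complex.integral_boundary_rect_eq_zero_of_differentiableOn G ⟨a, -T⟩ ⟨b, T⟩
    (fun s hs => by
      rw [Complex.mem_reProdIm, Set.uIcc_of_le hab, Set.uIcc_of_le (by linarith)] at hs
      exact (hG s hs.1.1 hs.1.2 (abs_le.2 hs.2)).differentiableWithinAt)
  simp only at h
  set R := ∫ t in (-T)..T, G (b + t * Complex.I) with hR
  set L := ∫ t in (-T)..T, G (a + t * Complex.I) with hL
  set H₁ := ∫ x in a..b, G (x + (-T : ℝ) * Complex.I) with hH₁
  set H₂ := ∫ x in a..b, G (x + (T : ℝ) * Complex.I) with hH₂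
  have hRe : R = L + Complex.I * (H₁ - H₂) := by
    have h' : H₁ - H₂ + Complex.I * R - Complex.I * L = 0 := h
    have : Complex.I * (H₁ - H₂ + Complex.I * R - Complex.I * L) = 0 := by rw [h', mul_zero]
    linear_combination -this + (R - L) * Complex.I_mul_I
  have bL : ‖L‖ ≤ B₁ * (2 * T) := by
    have := intervalIntegral.norm_integral_le_of_norm_le_const (a := -T) (b := T) (C := B₁)
      (f := fun t : ℝ => G (a + t * Complex.I)) fun t ht => by
        rw [Set.uIoc_of_le (by linarith)] at ht
        exact h₁ t (abs_le.2 ⟨ht.1.le, ht.2⟩)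
    rwa [show T - -T = 2 * T by ring, abs_of_nonneg (by linarith)] at this
  have bH : ∀ U : ℝ, |U| = T → ‖∫ x in a..b, G (x + U * Complex.I)‖ ≤ B₂ * (b - a) := by
    intro U hU
    have := intervalIntegral.norm_integral_le_of_norm_le_const (a := a) (b := b) (C := B₂)
      (f := fun x : ℝ => G (x + U * Complex.I)) fun x hx => by
        rw [Set.uIoc_of_le hab] at hx
        exact h₂ _ (by simpa using hx.1.le) (by simpa using hx.2) (by simpa using hU)
    rwa [abs_of_nonneg (sub_nonneg.2 hab)] at this
  have b1 := bH (-T) (by rw [abs_neg, abs_of_nonneg hT])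
  have b2 := bH T (abs_of_nonneg hT)
  rw [hRe]
  refine (norm_add_le _ _).trans ?_
  rw [norm_mul, Complex.norm_I, one_mul]
  have := norm_sub_le H₁ H₂
  linarith

lemma norm_sum_character_mul_vonMangoldt_le {q : ℕ} [NeZero q] {χ : DirichletCharacter ℂ q}
    (hχ : χ ≠ 1) {σ x T η M M' : ℝ} (hσ : 1 < σ) (hσ2 : σ ≤ 2) (hx : 1 ≤ x) (hT : 1 ≤ T)
    (hη : 0 < η) (hη1 : η ≤ 1 / 4)
    (h₁ : ∀ s : ℂ, 1 - η ≤ s.re → s.re ≤ σ → |s.im| ≤ T → χ.LFunction s ≠ 0 ∧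
      ‖deriv χ.LFunction s / χ.LFunction s‖ ≤ M)
    (h₂ : ∀ t : ℝ, T ≤ |t| → ‖deriv χ.LFunction (σ + t * Complex.I) /
      χ.LFunction (σ + t * Complex.I)‖ ≤ M' * |t| ^ (1 / 2 : ℝ)) :
    ‖∑ n ∈ Icc 1 ⌊x⌋₊, χ n * (ArithmeticFunction.vonMangoldt n : ℂ) * ((1 - n / x : ℝ) : ℂ)‖ ≤
      4 * M * T * x ^ (1 - η) + 3 * M * x ^ σ / T ^ 2 + 4 * M' * x ^ σ * T ^ (-(1 / 2) : ℝ) := by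
  obtain ⟨hintegrable, heq⟩ := sum_character_mul_vonMangoldt_eq_integral χ hσ hx
  have hx0 : 0 < x := by linarith
  have hM : 0 ≤ M := (norm_nonneg _).trans (h₁ 1 (by simp; linarith) (by simp; linarith)
    (by simp; linarith)).2
  set G : ℂ → ℂ := fun s => -deriv χ.LFunction s / χ.LFunction s * (x : ℂ) ^ s *
    (1 / (s * (s + 1))) with hG
  have hGn : ∀ s : ℂ, 0 < s.re → ‖G s‖ ≤ ‖deriv χ.LFunction s / χ.LFunction s‖ * x ^ s.re *
      (1 / (s.re ^ 2 + s.im ^ 2)) := by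
    intro s hs
    simp only [hG]
    rw [norm_mul, norm_mul, neg_div, norm_neg, Complex.norm_cpow_eq_rpow_re_of_pos hx0]
    gcongr
    exact norm_kernel_le hs
  have hdiff : ∀ s : ℂ, 1 - η ≤ s.re → s.re ≤ σ → |s.im| ≤ T → DifferentiableAt ℂ G s := by
    intro s hs hs2 hsT
    have hL := DirichletCharacter.differentiable_LFunction hχ
    have hs0 : s ≠ 0 := by
      rintro rfl; simp at hs; linarith
    have hs1 : s + 1 ≠ 0 := by
      intro h
      have := congrArg Complex.re h
      simp at this; linarith
    refine DifferentiableAt.mul (DifferentiableAt.mul (DifferentiableAt.div ?_ (hL s)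
      (h₁ s hs hs2 hsT).1) ?_) ?_
    · exact (hL.deriv s).neg
    · exact differentiableAt_id.const_cpow (.inl (by exact_mod_cast hx0.ne'))
    · exact (differentiableAt_const _).div (by fun_prop) (mul_ne_zero hs0 hs1)
  have hvert := norm_integral_vertical_le (G := G) (a := 1 - η) (b := σ) (T := T)
    (B₁ := M * x ^ (1 - η) * 2) (B₂ := M * x ^ σ * (1 / T ^ 2)) (by linarith) (by linarith) hdiff
    (fun t ht => by
      have hre : (((1 - η : ℝ) : ℂ) + t * Complex.I).re = 1 - η := by simp
      have him : (((1 - η : ℝ) : ℂ) + t * Complex.I).im = t := by simp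
      refine (hGn _ (by rw [hre]; linarith)).trans ?_
      have := (h₁ (((1 - η : ℝ) : ℂ) + t * Complex.I) (by rw [hre]) (by rw [hre]; linarith)
        (by rw [him]; exact ht)).2
      rw [hre, him]
      have h5 : 1 / ((1 - η) ^ 2 + t ^ 2) ≤ 2 := by
        rw [div_le_iff₀ (by nlinarith)]
        nlinarith
      gcongr)
    (fun s hs hs2 hsT => by
      refine (hGn s (by linarith)).trans ?_
      have := (h₁ s hs hs2 hsT.le).2
      gcongr
      rw [← hsT, sq_abs]
      nlinarith)
  have htail := norm_integral_le_of_tails hintegrable (T := T) (c := M' * x ^ σ) (by linarith)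
    (fun t ht => by
      have hre : ((σ : ℂ) + t * Complex.I).re = σ := by simp
      have him : ((σ : ℂ) + t * Complex.I).im = t := by simp
      have ht0 : 0 < |t| := by linarith
      have h5 := hGn (σ + t * Complex.I) (by rw [hre]; linarith)
      rw [hre, him] at h5
      refine h5.trans ?_
      have h6 := h₂ t ht
      calc _ ≤ M' * |t| ^ (1 / 2 : ℝ) * x ^ σ * (1 / |t| ^ 2) := by
            refine mul_le_mul (by gcongr) ?_ (by positivity) ?_
            · rw [← sq_abs t]
              exact one_div_le_one_div_of_le (by positivity) (by nlinarith)
            · have := (norm_nonneg _).trans h6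
              positivity
        _ = M' * x ^ σ * (|t| ^ (1 / 2 : ℝ) * |t| ^ (-2 : ℝ)) := by
            rw [Real.rpow_neg ht0.le, Real.rpow_two]; ring
        _ = _ := by
            rw [← Real.rpow_add ht0]; norm_num)
  rw [heq, norm_smul, Real.norm_of_nonneg (by positivity)]
  set I := ∫ t : ℝ, -deriv χ.LFunction (σ + t * Complex.I) /
      χ.LFunction (σ + t * Complex.I) * (x : ℂ) ^ ((σ : ℂ) + t * Complex.I) *
      (1 / (((σ : ℂ) + t * Complex.I) * ((σ : ℂ) + t * Complex.I + 1))) with hI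
  have hpi : 1 / (2 * π) ≤ 1 := by
    rw [div_le_one (by positivity)]
    linarith [Real.pi_gt_three]
  have h7 : 1 / (2 * π) * ‖I‖ ≤ ‖I‖ := mul_le_of_le_one_left (norm_nonneg _) hpi
  refine h7.trans (htail.trans ?_)
  refine (add_le_add hvert le_rfl).trans ?_
  have h8 : 2 * (σ - (1 - η)) * (M * x ^ σ * (1 / T ^ 2)) ≤ 3 * (M * x ^ σ * (1 / T ^ 2)) := by
    gcongr
    linarith
  calc _ ≤ 2 * T * (M * x ^ (1 - η) * 2) + 3 * (M * x ^ σ * (1 / T ^ 2)) +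
        4 * (M' * x ^ σ) * T ^ (-(1 / 2) : ℝ) := by linarith
    _ = _ := by ring

end

lemma exists_exp_neg_mul_sqrt_le {a : ℝ} (ha : 0 < a) (k : ℝ) :
    ∃ C > (0 : ℝ), ∀ l : ℝ, 1 ≤ l → Real.exp (-(a * l ^ (1 / 2 : ℝ))) ≤ C * l ^ (-k) := by
  set n : ℕ := ⌈2 * k⌉₊ with hn
  refine ⟨n.factorial / a ^ n, by positivity, fun l hl => ?_⟩
  have hl0 : 0 < l := by linarith
  have h1 := Real.pow_div_factorial_le_exp (a * l ^ (1 / 2 : ℝ)) (by positivity) n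
  rw [Real.exp_neg]
  have h2 : l ^ k ≤ (l ^ (1 / 2 : ℝ)) ^ n := by
    rw [← Real.rpow_natCast, ← Real.rpow_mul hl0.le]
    refine Real.rpow_le_rpow_of_exponent_le hl ?_
    have := Nat.le_ceil (2 * k)
    rw [← hn] at this
    linarith
  have h3 : a ^ n / n.factorial * l ^ k ≤ Real.exp (a * l ^ (1 / 2 : ℝ)) := by
    refine le_trans ?_ h1
    rw [mul_pow, div_mul_eq_mul_div]
    gcongr
  calc (Real.exp (a * l ^ (1 / 2 : ℝ)))⁻¹ ≤ (a ^ n / n.factorial * l ^ k)⁻¹ := by gcongr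
    _ = _ := by
        rw [mul_inv, inv_div, Real.rpow_neg hl0.le]

lemma one_lt_log_of_three_le {x : ℝ} (hx : 3 ≤ x) : 1 < Real.log x := by
  rw [Real.lt_log_iff_exp_lt (by linarith)]
  have := Real.exp_one_lt_d9
  norm_num at this ⊢
  linarith

/-- The Siegel–Walfisz theorem for `χΛ` with a Cesàro weight. -/
lemma exists_norm_smoothed_sum_le {A B : ℝ} (hA : 0 < A) (hB : 0 < B) :
    ∃ C > (0 : ℝ), ∀ (q : ℕ) [NeZero q] (χ : DirichletCharacter ℂ q), χ ≠ 1 → ∀ x : ℝ, 3 ≤ x →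
      (q : ℝ) ≤ Real.log x ^ B →
      ‖∑ n ∈ Icc 1 ⌊x⌋₊, χ n * (ArithmeticFunction.vonMangoldt n : ℂ) *
        ((1 - n / x : ℝ) : ℂ)‖ ≤ C * x * Real.log x ^ (-A) := by
  set D : ℝ := 2 * (A + B) + 1 with hD
  have hDpos : 0 < D := by positivity
  set ε : ℝ := 1 / (2 * (B + D)) with hε
  have hεpos : 0 < ε := by positivity
  have hε2 : ε ≤ 1 / 2 := by
    rw [hε]
    exact one_div_le_one_div_of_le (by norm_num) (by linarith)
  obtain ⟨c, hc, hc4, C, hC, h⟩ := exists_norm_deriv_div_LFunction_le hεpos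
  obtain ⟨E, hE, hexp⟩ := exists_exp_neg_mul_sqrt_le (a := c / 3) (by positivity) (A + D + 1 / 2)
  refine ⟨12 * C * E + 27 * C + 36 * C, by positivity, fun q _ χ hχ x hx hq => ?_⟩
  have hl := (one_lt_log_of_three_le hx).le
  set l := Real.log x with hldef
  have hl0 : 0 < l := by linarith
  have hx0 : 0 < x := by linarith
  have hq1 : (1 : ℝ) ≤ q := by exact_mod_cast NeZero.one_le
  set T : ℝ := l ^ D with hT
  have hT1 : 1 ≤ T := Real.one_le_rpow hl hDpos.le
  set P : ℝ := (q * (T + 2)) ^ ε with hP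
  have hqT : 1 ≤ q * (T + 2) := by nlinarith
  have hP1 : 1 ≤ P := Real.one_le_rpow hqT hεpos.le
  have hP3 : P ≤ 3 * l ^ (1 / 2 : ℝ) := by
    calc P ≤ (3 * l ^ (B + D)) ^ ε := by
          rw [hP]
          refine Real.rpow_le_rpow (by linarith) ?_ hεpos.le
          rw [Real.rpow_add hl0]
          nlinarith [mul_le_mul hq (show T + 2 ≤ 3 * T by linarith) (by linarith) (by positivity)]
      _ = 3 ^ ε * l ^ (1 / 2 : ℝ) := by
          rw [Real.mul_rpow (by norm_num) (by positivity), ← Real.rpow_mul hl0.le]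
          congr 2
          rw [hε]
          field_simp
      _ ≤ 3 ^ (1 : ℝ) * l ^ (1 / 2 : ℝ) := by
          gcongr
          · norm_num
          · linarith
      _ = _ := by rw [Real.rpow_one]
  set η : ℝ := c * P⁻¹ with hη
  have hηpos : 0 < η := by positivity
  have hη4 : η ≤ 1 / 4 := by
    have : P⁻¹ ≤ 1 := inv_le_one_of_one_le₀ hP1
    calc η ≤ c * 1 := by rw [hη]; gcongr
      _ ≤ _ := by linarith
  have hηlow : c / 3 * l ^ (1 / 2 : ℝ) ≤ η * l := by
    have h1 : (3 * l ^ (1 / 2 : ℝ))⁻¹ ≤ P⁻¹ := by gcongr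
    calc c / 3 * l ^ (1 / 2 : ℝ) = c * (3 * l ^ (1 / 2 : ℝ))⁻¹ *
          (l ^ (1 / 2 : ℝ) * l ^ (1 / 2 : ℝ)) := by field_simp
      _ = c * (3 * l ^ (1 / 2 : ℝ))⁻¹ * l := by rw [← Real.rpow_add hl0]; norm_num
      _ ≤ η * l := by rw [hη]; gcongr
  set σ : ℝ := 1 + 1 / l with hσ
  have hl1 : 1 / l ≤ 1 := by rw [div_le_one hl0]; exact hl
  have hl1' : 0 < 1 / l := by positivity
  have hxσ : x ^ σ ≤ 3 * x := by
    rw [hσ, Real.rpow_add hx0, Real.rpow_one, Real.rpow_def_of_pos hx0, ← hldef,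
      mul_one_div_cancel hl0.ne']
    have := Real.exp_one_lt_d9
    nlinarith
  have hmain := norm_sum_character_mul_vonMangoldt_le hχ (σ := σ) (x := x) (T := T) (η := η)
    (M := C * P) (M' := 3 * C * q) (by linarith) (by linarith) (by linarith) hT1 hηpos hη4
    (fun s hs hs2 hsT => by
      have hle : q * (|s.im| + 2) ≤ q * (T + 2) := by gcongr
      have hpos : 0 < q * (|s.im| + 2) := by positivity
      have h1 : (q * (|s.im| + 2)) ^ ε ≤ P := Real.rpow_le_rpow hpos.le hle hεpos.le
      have h2 : P⁻¹ ≤ (q * (|s.im| + 2)) ^ (-ε) := by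
        rw [Real.rpow_neg hpos.le]
        gcongr
      obtain ⟨h3, h4⟩ := h q χ hχ s (by
        have : c * P⁻¹ ≤ c * (q * (|s.im| + 2)) ^ (-ε) := by gcongr
        linarith) (by linarith)
      exact ⟨h3, h4.trans (by gcongr)⟩)
    (fun t ht => by
      have hre : ((σ : ℂ) + t * Complex.I).re = σ := by simp
      have him : ((σ : ℂ) + t * Complex.I).im = t := by simp
      have h1 := (h q χ hχ (σ + t * Complex.I) (by
        rw [hre]
        have : 0 ≤ c * (q * (|((σ : ℂ) + t * Complex.I).im| + 2)) ^ (-ε) := by positivity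
        linarith) (by rw [hre]; linarith)).2
      rw [him] at h1
      refine h1.trans ?_
      have ht0 : 0 < |t| := by linarith
      calc C * (q * (|t| + 2)) ^ ε ≤ C * (3 * q * |t|) ^ ε := by
            have : q * (|t| + 2) ≤ 3 * q * |t| := by nlinarith
            gcongr
        _ ≤ C * (3 * q * |t|) ^ (1 / 2 : ℝ) := by
            gcongr
            nlinarith
        _ = C * ((3 * q) ^ (1 / 2 : ℝ) * |t| ^ (1 / 2 : ℝ)) := by
            rw [Real.mul_rpow (by positivity) ht0.le]
        _ ≤ C * ((3 * q) ^ (1 : ℝ) * |t| ^ (1 / 2 : ℝ)) := by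
            gcongr
            · linarith
            · norm_num
        _ = _ := by rw [Real.rpow_one]; ring)
  refine hmain.trans ?_
  have t1 : 4 * (C * P) * T * x ^ (1 - η) ≤ 12 * C * E * x * l ^ (-A) := by
    have hxη : x ^ (1 - η) ≤ x * (E * l ^ (-(A + D + 1 / 2))) := by
      rw [Real.rpow_sub hx0, Real.rpow_one, div_eq_mul_inv, ← Real.rpow_neg hx0.le,
        Real.rpow_def_of_pos hx0, ← hldef]
      gcongr
      refine le_trans ?_ (hexp l hl)
      rw [Real.exp_le_exp]
      linarith
    calc _ ≤ 4 * (C * (3 * l ^ (1 / 2 : ℝ))) * l ^ D * (x * (E * l ^ (-(A + D + 1 / 2)))) := by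
          gcongr
      _ = 12 * C * E * x * (l ^ (1 / 2 : ℝ) * l ^ D * l ^ (-(A + D + 1 / 2))) := by ring
      _ = _ := by
          rw [← Real.rpow_add hl0, ← Real.rpow_add hl0]
          ring_nf
  have t2 : 3 * (C * P) * x ^ σ / T ^ 2 ≤ 27 * C * x * l ^ (-A) := by
    have hT2 : l ^ (A + 1 / 2) ≤ T ^ 2 := by
      rw [hT, ← Real.rpow_natCast, ← Real.rpow_mul hl0.le]
      refine Real.rpow_le_rpow_of_exponent_le hl ?_
      push_cast
      rw [hD]
      linarith
    calc _ ≤ 3 * (C * (3 * l ^ (1 / 2 : ℝ))) * (3 * x) / l ^ (A + 1 / 2) := by gcongr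
      _ = 27 * C * x * (l ^ (1 / 2 : ℝ) / l ^ (A + 1 / 2)) := by ring
      _ = _ := by
          rw [← Real.rpow_sub hl0]
          ring_nf
  have t3 : 4 * (3 * C * q) * x ^ σ * T ^ (-(1 / 2) : ℝ) ≤ 36 * C * x * l ^ (-A) := by
    have hTh : T ^ (-(1 / 2) : ℝ) ≤ l ^ (-(A + B)) := by
      rw [hT, ← Real.rpow_mul hl0.le]
      refine Real.rpow_le_rpow_of_exponent_le hl ?_
      rw [hD]
      linarith
    calc _ ≤ 4 * (3 * C * l ^ B) * (3 * x) * l ^ (-(A + B)) := by gcongr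
      _ = 36 * C * x * (l ^ B * l ^ (-(A + B))) := by ring
      _ = _ := by
          rw [← Real.rpow_add hl0]
          ring_nf
  linarith

lemma norm_sum_le_of_smoothed {a : ℕ → ℂ} (ha : ∀ n, ‖a n‖ ≤ Real.log n) {x h S : ℝ} (hx : 1 ≤ x)
    (hh : 0 < h)
    (h₁ : ‖∑ n ∈ Icc 1 ⌊x⌋₊, a n * ((1 - n / x : ℝ) : ℂ)‖ ≤ S)
    (h₂ : ‖∑ n ∈ Icc 1 ⌊x + h⌋₊, a n * ((1 - n / (x + h) : ℝ) : ℂ)‖ ≤ S) :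
    ‖∑ n ∈ Icc 1 ⌊x⌋₊, a n‖ ≤ (2 * x + h) / h * S + (h + 1) * Real.log (x + h) := by
  have hx0 : 0 < x := by linarith
  have hxh : 0 < x + h := by linarith
  have hfl : ⌊x⌋₊ ≤ ⌊x + h⌋₊ := Nat.floor_mono (by linarith)
  set R := ∑ n ∈ Ioc ⌊x⌋₊ ⌊x + h⌋₊, a n * ((x + h - n : ℝ) : ℂ) with hR
  have hsplit : ∀ g : ℕ → ℂ, ∑ n ∈ Icc 1 ⌊x + h⌋₊, g n =
      ∑ n ∈ Icc 1 ⌊x⌋₊, g n + ∑ n ∈ Ioc ⌊x⌋₊ ⌊x + h⌋₊, g n := fun g => by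
    have h1 : ∀ N, Icc 1 N = Ioc 0 N := fun N => by ext; simp [Nat.lt_iff_add_one_le]
    rw [h1, h1, Finset.sum_Ioc_consecutive _ (Nat.zero_le _) hfl]
  have hscale : ∀ (y : ℝ), 0 < y → ∀ s : Finset ℕ, (y : ℂ) * ∑ n ∈ s, a n * ((1 - n / y : ℝ) : ℂ) =
      ∑ n ∈ s, a n * ((y - n : ℝ) : ℂ) := by
    intro y hy s
    rw [Finset.mul_sum]
    refine Finset.sum_congr rfl fun n _ => ?_
    have : (y : ℂ) ≠ 0 := by exact_mod_cast hy.ne'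
    push_cast
    field_simp
  have hid : (h : ℂ) * ∑ n ∈ Icc 1 ⌊x⌋₊, a n =
      ((x + h : ℝ) : ℂ) * ∑ n ∈ Icc 1 ⌊x + h⌋₊, a n * ((1 - n / (x + h) : ℝ) : ℂ) -
      (x : ℂ) * ∑ n ∈ Icc 1 ⌊x⌋₊, a n * ((1 - n / x : ℝ) : ℂ) - R := by
    rw [hscale _ hxh, hscale _ hx0, hsplit, hR, add_sub_right_comm, add_sub_cancel_right,
      ← Finset.sum_sub_distrib, Finset.mul_sum]
    refine Finset.sum_congr rfl fun n _ => ?_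
    push_cast
    ring
  have hcard : ((#(Ioc ⌊x⌋₊ ⌊x + h⌋₊) : ℕ) : ℝ) ≤ h + 1 := by
    rw [Nat.card_Ioc, Nat.cast_sub hfl]
    have h1 := Nat.floor_le hxh.le
    have h2 := Nat.lt_floor_add_one x
    linarith
  have hRn : ‖R‖ ≤ (h + 1) * (Real.log (x + h) * h) := by
    refine (norm_sum_le _ _).trans ?_
    refine (Finset.sum_le_card_nsmul _ _ (Real.log (x + h) * h) fun n hn => ?_).trans ?_
    · rw [Finset.mem_Ioc] at hn
      have hn1 : (n : ℝ) ≤ x + h := (Nat.le_floor_iff hxh.le).1 hn.2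
      have hn2 : x < n := (Nat.floor_lt hx0.le).1 hn.1
      rw [norm_mul, Complex.norm_real, Real.norm_of_nonneg (by linarith)]
      have : Real.log n ≤ Real.log (x + h) := Real.log_le_log (by linarith) hn1
      have h3 : 0 ≤ Real.log n := Real.log_nonneg (by linarith)
      exact mul_le_mul ((ha n).trans this) (by linarith) (by linarith) (by linarith)
    · rw [nsmul_eq_mul]
      have : 0 ≤ Real.log (x + h) := Real.log_nonneg (by linarith)
      gcongr
  have hn := congrArg norm hid
  rw [norm_mul, Complex.norm_real, Real.norm_of_nonneg hh.le] at hn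
  have h3 : h * ‖∑ n ∈ Icc 1 ⌊x⌋₊, a n‖ ≤ (x + h) * S + x * S +
      (h + 1) * (Real.log (x + h) * h) := by
    rw [hn]
    refine (norm_sub_le _ _).trans (add_le_add ((norm_sub_le _ _).trans (add_le_add ?_ ?_)) hRn)
    · rw [norm_mul, Complex.norm_real, Real.norm_of_nonneg hxh.le]
      gcongr
    · rw [norm_mul, Complex.norm_real, Real.norm_of_nonneg hx0.le]
      gcongr
  have h4 : (2 * x + h) / h * S + (h + 1) * Real.log (x + h) =
      ((x + h) * S + x * S + (h + 1) * (Real.log (x + h) * h)) / h := by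
    field_simp
    ring
  rw [h4, le_div_iff₀ hh]
  linarith

/-- The Siegel–Walfisz theorem for `ψ(x,χ)`. -/
theorem exists_norm_sum_character_mul_vonMangoldt_le {A B : ℝ} (hA : 0 < A) (hB : 0 < B) :
    ∃ C > (0 : ℝ), ∀ (q : ℕ) [NeZero q] (χ : DirichletCharacter ℂ q), χ ≠ 1 → ∀ x : ℝ, 3 ≤ x →
      (q : ℝ) ≤ Real.log x ^ B →
      ‖∑ n ∈ Icc 1 ⌊x⌋₊, χ n * (ArithmeticFunction.vonMangoldt n : ℂ)‖ ≤
        C * x * Real.log x ^ (-A) := by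
  obtain ⟨C, hC, h⟩ := exists_norm_smoothed_sum_le (A := 2 * A + 1) (by positivity) hB
  obtain ⟨E, hE, hexp⟩ := exists_exp_neg_mul_sqrt_le (a := 1) one_pos (A + 1)
  refine ⟨6 * C + 2 + 2 * E, by positivity, fun q _ χ hχ x hx hq => ?_⟩
  have hl := (one_lt_log_of_three_le hx).le
  set l := Real.log x with hldef
  have hl0 : 0 < l := by linarith
  have hx0 : 0 < x := by linarith
  set d : ℝ := l ^ (-(A + 1)) with hd
  have hd0 : 0 < d := by positivity
  have hd1 : d ≤ 1 := Real.rpow_le_one_of_one_le_of_nonpos hl (by linarith)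
  set y := x * d with hy
  have hy0 : 0 < y := by positivity
  have hyx : y ≤ x := by rw [hy]; nlinarith
  have hlxy : l ≤ Real.log (x + y) := Real.log_le_log hx0 (by linarith)
  have h1 := h q χ hχ x hx hq
  have h2 := h q χ hχ (x + y) (by linarith) (hq.trans (by gcongr))
  have hle : C * (x + y) * Real.log (x + y) ^ (-(2 * A + 1)) ≤
      C * (2 * x) * l ^ (-(2 * A + 1)) := by
    have h3 : Real.log (x + y) ^ (-(2 * A + 1)) ≤ l ^ (-(2 * A + 1)) :=
      Real.rpow_le_rpow_of_nonpos hl0 hlxy (by linarith)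
    exact mul_le_mul (by nlinarith) h3 (Real.rpow_nonneg (hl0.le.trans hlxy) _) (by positivity)
  have hle1 : C * x * l ^ (-(2 * A + 1)) ≤ C * (2 * x) * l ^ (-(2 * A + 1)) := by
    gcongr
    linarith
  have hmain := norm_sum_le_of_smoothed (a := fun n => χ n * (ArithmeticFunction.vonMangoldt n : ℂ))
    (x := x) (h := y) (S := C * (2 * x) * l ^ (-(2 * A + 1))) (fun n => by
      rw [norm_mul, Complex.norm_real, Real.norm_of_nonneg ArithmeticFunction.vonMangoldt_nonneg]
      exact (mul_le_of_le_one_left ArithmeticFunction.vonMangoldt_nonneg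
        (χ.norm_le_one _)).trans ArithmeticFunction.vonMangoldt_le_log)
    (by linarith) hy0 (h1.trans hle1) (h2.trans hle)
  refine hmain.trans ?_
  have hlog : Real.log (x + y) ≤ 2 * l := by
    have : Real.log (x + y) ≤ Real.log (x ^ 2) := Real.log_le_log (by linarith) (by nlinarith)
    rwa [Real.log_pow] at this
  have t1 : (2 * x + y) / y * (C * (2 * x) * l ^ (-(2 * A + 1))) ≤ 6 * C * x * l ^ (-A) := by
    calc _ ≤ (2 * x + x) / y * (C * (2 * x) * l ^ (-(2 * A + 1))) := by gcongr
      _ = 6 * C * x * (l ^ (-(2 * A + 1)) / d) := by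
          rw [hy]
          field_simp
          ring
      _ = _ := by
          rw [hd, ← Real.rpow_sub hl0]
          ring_nf
  have hlA : l ^ (-(A + 1)) * l = l ^ (-A) := by
    rw [← Real.rpow_add_one hl0.ne']
    ring_nf
  have t2 : y * Real.log (x + y) ≤ 2 * x * l ^ (-A) := by
    calc _ ≤ y * (2 * l) := by gcongr
      _ = 2 * x * (l ^ (-(A + 1)) * l) := by rw [hy, hd]; ring
      _ = _ := by rw [hlA]
  have t3 : Real.log (x + y) ≤ 2 * E * x * l ^ (-A) := by
    have h5 := hexp l hl
    have h6 : Real.exp (-l) ≤ E * l ^ (-(A + 1)) := by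
      refine le_trans ?_ h5
      rw [Real.exp_le_exp, one_mul, neg_le_neg_iff]
      calc l ^ (1 / 2 : ℝ) ≤ l ^ (1 : ℝ) := Real.rpow_le_rpow_of_exponent_le hl (by norm_num)
        _ = l := Real.rpow_one l
    have h7 : 1 ≤ x * (E * l ^ (-(A + 1))) := by
      rw [Real.exp_neg, hldef, Real.exp_log hx0, ← hldef] at h6
      calc 1 = x * x⁻¹ := (mul_inv_cancel₀ hx0.ne').symm
        _ ≤ _ := by gcongr
    calc _ ≤ 2 * l * 1 := by linarith
      _ ≤ 2 * l * (x * (E * l ^ (-(A + 1)))) := by gcongr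
      _ = 2 * E * x * (l ^ (-(A + 1)) * l) := by ring
      _ = _ := by rw [hlA]
  linarith

theorem YInd_nonneg (y : ℝ) (n : ℕ) : 0 ≤ YInd y n := by
  unfold YInd
  split_ifs <;> norm_num

theorem YInd_le_one (y : ℝ) (n : ℕ) : YInd y n ≤ 1 := by
  unfold YInd
  split_ifs <;> norm_num

theorem YInd_mul (y : ℝ) {m n : ℕ} (hm : m ≠ 0) (hn : n ≠ 0) :
    YInd y (m * n) = YInd y m * YInd y n := by
  unfold YInd
  rw [Nat.primeFactors_mul hm hn]
  simp only [mem_union, or_imp, forall_and]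
  split_ifs <;> simp_all

/-- `χ(n)` restricted to the integers without prime factors below `y`. -/
noncomputable def sievedCharacter {q : ℕ} (χ : DirichletCharacter ℂ q) (y : ℝ) (n : ℕ) : ℂ :=
  χ n * (YInd y n : ℂ)

theorem norm_sievedCharacter_le_one {q : ℕ} (χ : DirichletCharacter ℂ q) (y : ℝ) (n : ℕ) :
    ‖sievedCharacter χ y n‖ ≤ 1 := by
  rw [sievedCharacter, norm_mul, Complex.norm_real, Real.norm_of_nonneg (YInd_nonneg _ _)]
  exact mul_le_one₀ (χ.norm_le_one _) (YInd_nonneg _ _) (YInd_le_one _ _)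

theorem sievedCharacter_mul {q : ℕ} (χ : DirichletCharacter ℂ q) (y : ℝ) {m n : ℕ}
    (hm : m ≠ 0) (hn : n ≠ 0) :
    sievedCharacter χ y (m * n) = sievedCharacter χ y m * sievedCharacter χ y n := by
  simp only [sievedCharacter, YInd_mul y hm hn, Nat.cast_mul, map_mul, Complex.ofReal_mul]
  ring

theorem YInd_mul_vonMangoldt_eq_zero {y : ℝ} {k : ℕ} (hk : (k : ℝ) < y) :
    YInd y k * ArithmeticFunction.vonMangoldt k = 0 := by
  by_cases hΛ : ArithmeticFunction.vonMangoldt k = 0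
  · rw [hΛ, mul_zero]
  rw [← ne_eq, ArithmeticFunction.vonMangoldt_ne_zero_iff] at hΛ
  obtain ⟨p, j, hp, hj, rfl⟩ := (isPrimePow_nat_iff _).1 hΛ
  rw [YInd, if_neg, zero_mul]
  intro h
  have h1 := h p (by rw [Nat.primeFactors_prime_pow hj.ne' hp]; simp)
  have h2 : p ≤ p ^ j := Nat.le_self_pow hj.ne' p
  have h3 : (p : ℝ) ≤ (p ^ j : ℕ) := by exact_mod_cast h2
  linarith

theorem norm_sum_sievedCharacter_mul_vonMangoldt_sub_le {q : ℕ} (χ : DirichletCharacter ℂ q)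
    {y : ℝ} (M N : ℕ) (hM : y ≤ M + 1) :
    ‖∑ k ∈ Ioc M N, (sievedCharacter χ y k - χ k) * (ArithmeticFunction.vonMangoldt k : ℂ)‖ ≤
      Chebyshev.psi N - Chebyshev.theta N := by
  rw [Chebyshev.psi_sub_theta_eq_sum_not_prime, Nat.floor_natCast, sum_filter]
  refine (norm_sum_le _ _).trans ?_
  refine le_trans (sum_le_sum (g := fun k => if ¬ k.Prime then
    ArithmeticFunction.vonMangoldt k else 0) fun k hk => ?_)
    (sum_le_sum_of_subset_of_nonneg (Ioc_subset_Ioc_left (Nat.zero_le M)) fun k _ _ => ?_)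
  · rw [mem_Ioc] at hk
    split_ifs with hp
    · have hy : YInd y k = 1 := by
        rw [YInd, if_pos]
        intro p hp'
        rw [hp.primeFactors, mem_singleton] at hp'
        rw [hp']
        refine hM.trans ?_
        exact_mod_cast hk.1
      simp [sievedCharacter, hy]
    · rw [norm_mul, Complex.norm_real, Real.norm_of_nonneg ArithmeticFunction.vonMangoldt_nonneg]
      refine mul_le_of_le_one_left ArithmeticFunction.vonMangoldt_nonneg ?_
      have : sievedCharacter χ y k - χ k = χ k * (((YInd y k - 1 : ℝ)) : ℂ) := by
        rw [sievedCharacter]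
        push_cast
        ring
      rw [this, norm_mul, Complex.norm_real, Real.norm_eq_abs]
      refine mul_le_one₀ (χ.norm_le_one _) (abs_nonneg _) ?_
      rw [abs_le]
      constructor <;> linarith [YInd_nonneg y k, YInd_le_one y k]
  · split_ifs
    · exact le_rfl
    · exact ArithmeticFunction.vonMangoldt_nonneg

theorem exists_norm_sum_sievedCharacter_mul_vonMangoldt_le {A B : ℝ} (hA : 0 < A) (hB : 0 < B) :
    ∃ C > 0, ∀ (q : ℕ) [NeZero q] (χ : DirichletCharacter ℂ q), χ ≠ 1 →
      ∀ l y : ℝ, 4 ≤ l → Real.exp l ≤ y → (q : ℝ) ≤ l ^ B → ∀ N : ℕ,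
        ‖∑ k ∈ Ioc 0 N, sievedCharacter χ y k * (ArithmeticFunction.vonMangoldt k : ℂ)‖ ≤
          C * N * l ^ (-A) := by
  obtain ⟨C, hC, h⟩ := exists_norm_sum_character_mul_vonMangoldt_le hA (B := 2 * B) (by positivity)
  obtain ⟨D, hD⟩ := Chebyshev.psi_sub_theta_le_mul_sqrt
  obtain ⟨E, hE, hexp⟩ := exists_exp_neg_mul_sqrt_le (a := 1 / 2) (by norm_num) A
  refine ⟨2 * (C * 2 ^ A) + |D| * E, by positivity, ?_⟩
  intro q _ χ hχ l y hl hy hq N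
  have hl0 : 0 < l := by linarith
  rcases lt_or_ge (N : ℝ) y with hN | hN
  · rw [sum_eq_zero]
    · rw [norm_zero]
      positivity
    · intro k hk
      rw [mem_Ioc] at hk
      have hk' : (k : ℝ) < y := lt_of_le_of_lt (by exact_mod_cast hk.2) hN
      rw [sievedCharacter, mul_assoc, ← Complex.ofReal_mul, YInd_mul_vonMangoldt_eq_zero hk',
        Complex.ofReal_zero, mul_zero]
  have hy0 : 0 < y := (Real.exp_pos _).trans_le hy
  have he2 : 4 ≤ Real.exp (l / 2) := by
    have := Real.add_one_le_exp (1 : ℝ)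
    have h3 : Real.exp 1 ^ 2 ≤ Real.exp (l / 2) := by
      rw [← Real.exp_nat_mul]
      apply Real.exp_le_exp.2
      push_cast
      linarith
    nlinarith
  have hsq : Real.exp l = Real.exp (l / 2) ^ 2 := by
    rw [← Real.exp_nat_mul]
    push_cast
    ring_nf
  obtain ⟨M, hM⟩ : ∃ M, ⌈y⌉₊ = M + 1 :=
    Nat.exists_eq_succ_of_ne_zero (Nat.ceil_pos.2 hy0).ne'
  have hM1 : y ≤ M + 1 := by
    have := Nat.le_ceil y
    rw [hM] at this
    exact_mod_cast this
  have hMy : (M : ℝ) < y := by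
    have := Nat.ceil_lt_add_one hy0.le
    rw [hM] at this
    push_cast at this
    linarith
  have hMe : Real.exp (l / 2) ≤ M := by nlinarith
  have hM3 : (3 : ℝ) ≤ M := by linarith
  have hMN' : (M : ℝ) ≤ N := by linarith
  have hMN : M ≤ N := by exact_mod_cast hMN'
  have hkey : ∀ T : ℕ, M ≤ T → T ≤ N →
      ‖∑ k ∈ Ioc 0 T, χ k * (ArithmeticFunction.vonMangoldt k : ℂ)‖ ≤
        C * 2 ^ A * N * l ^ (-A) := by
    intro T hMT hTN
    have hMT' : (M : ℝ) ≤ T := by exact_mod_cast hMT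
    have hTN' : (T : ℝ) ≤ N := by exact_mod_cast hTN
    have hlog : l / 2 ≤ Real.log T := by
      rw [Real.le_log_iff_exp_le (by linarith)]
      linarith
    have h1 := h q χ hχ T (by linarith) (by
      refine hq.trans ?_
      calc l ^ B ≤ ((l / 2) ^ (2 : ℝ)) ^ B := by
            gcongr
            rw [Real.rpow_two]
            nlinarith
        _ = (l / 2) ^ (2 * B) := by rw [← Real.rpow_mul (by positivity)]
        _ ≤ _ := by gcongr)
    rw [Nat.floor_natCast] at h1
    have e : Icc 1 T = Ioc 0 T := Icc_add_one_left_eq_Ioc 0 T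
    rw [e] at h1
    refine h1.trans ?_
    have h2 : Real.log T ^ (-A) ≤ (l / 2) ^ (-A) :=
      Real.rpow_le_rpow_of_nonpos (by positivity) hlog (by linarith)
    have h3 : (l / 2) ^ (-A) = 2 ^ A * l ^ (-A) := by
      rw [Real.div_rpow hl0.le (by norm_num), Real.rpow_neg (by norm_num : (0:ℝ) ≤ 2)]
      field_simp
    rw [h3] at h2
    calc _ ≤ C * N * (2 ^ A * l ^ (-A)) := by
          have : (0:ℝ) ≤ Real.log T ^ (-A) := Real.rpow_nonneg (by linarith) _
          exact mul_le_mul (by gcongr) h2 this (by positivity)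
      _ = _ := by ring
  have hsplit : ∀ g : ℕ → ℂ, ∑ k ∈ Ioc 0 N, g k = ∑ k ∈ Ioc 0 M, g k + ∑ k ∈ Ioc M N, g k :=
    fun g => (sum_Ioc_consecutive g (Nat.zero_le M) hMN).symm
  have hzero : ∑ k ∈ Ioc 0 M, sievedCharacter χ y k * (ArithmeticFunction.vonMangoldt k : ℂ) = 0 := by
    refine sum_eq_zero fun k hk => ?_
    rw [mem_Ioc] at hk
    have hk' : (k : ℝ) < y := lt_of_le_of_lt (by exact_mod_cast hk.2) hMy
    rw [sievedCharacter, mul_assoc, ← Complex.ofReal_mul, YInd_mul_vonMangoldt_eq_zero hk',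
      Complex.ofReal_zero, mul_zero]
  have hdec : ∑ k ∈ Ioc 0 N, sievedCharacter χ y k * (ArithmeticFunction.vonMangoldt k : ℂ) =
      (∑ k ∈ Ioc 0 N, χ k * (ArithmeticFunction.vonMangoldt k : ℂ) -
        ∑ k ∈ Ioc 0 M, χ k * (ArithmeticFunction.vonMangoldt k : ℂ)) +
      ∑ k ∈ Ioc M N, (sievedCharacter χ y k - χ k) * (ArithmeticFunction.vonMangoldt k : ℂ) := by
    rw [hsplit, hzero, hsplit (fun k => χ k * (ArithmeticFunction.vonMangoldt k : ℂ))]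
    simp only [sub_mul, sum_sub_distrib]
    ring
  rw [hdec]
  have hN0 : (0 : ℝ) < N := by linarith
  have h4 := (norm_sum_sievedCharacter_mul_vonMangoldt_sub_le χ M N hM1).trans (hD N)
  have h5 : D * √(N : ℝ) ≤ |D| * E * N * l ^ (-A) := by
    have h6 : Real.exp (-(l / 2)) ≤ E * l ^ (-A) := by
      refine le_trans ?_ (hexp l (by linarith))
      rw [Real.exp_le_exp]
      have : l ^ (1 / 2 : ℝ) ≤ l := by
        calc l ^ (1 / 2 : ℝ) ≤ l ^ (1 : ℝ) :=
              Real.rpow_le_rpow_of_exponent_le (by linarith) (by norm_num)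
          _ = l := Real.rpow_one l
      linarith
    have h7 : Real.exp (l / 2) ≤ √(N : ℝ) := Real.le_sqrt_of_sq_le (by rw [← hsq]; linarith)
    have h8 : √(N : ℝ) ≤ N * Real.exp (-(l / 2)) := by
      rw [Real.exp_neg, ← div_eq_mul_inv, le_div_iff₀ (Real.exp_pos _)]
      calc _ ≤ √(N : ℝ) * √(N : ℝ) := by gcongr
        _ = N := Real.mul_self_sqrt hN0.le
    calc D * √(N : ℝ) ≤ |D| * √(N : ℝ) := by gcongr; exact le_abs_self D
      _ ≤ |D| * (N * (E * l ^ (-A))) := by gcongr; exact h8.trans (by gcongr)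
      _ = _ := by ring
  calc _ ≤ (C * 2 ^ A * N * l ^ (-A) + C * 2 ^ A * N * l ^ (-A)) + |D| * E * N * l ^ (-A) :=
        (norm_add_le _ _).trans (add_le_add ((norm_sub_le _ _).trans
          (add_le_add (hkey N hMN le_rfl) (hkey M le_rfl hMN))) (h4.trans h5))
    _ = _ := by ring

/-- `∑ f(n) log n = ∑ f(m) ∑ f(k) Λ(k)` for completely multiplicative `f`. -/
theorem sum_Ioc_sievedCharacter_mul_log {q : ℕ} (χ : DirichletCharacter ℂ q) (y : ℝ) (N : ℕ) :
    ∑ n ∈ Ioc 0 N, sievedCharacter χ y n * (Real.log n : ℂ) =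
      ∑ m ∈ Ioc 0 N, sievedCharacter χ y m * ∑ k ∈ Ioc 0 (N / m),
        sievedCharacter χ y k * (ArithmeticFunction.vonMangoldt k : ℂ) := by
  let f : ArithmeticFunction ℂ := ⟨fun n => if n = 0 then 0 else sievedCharacter χ y n, by simp⟩
  let g : ArithmeticFunction ℂ :=
    ⟨fun n => sievedCharacter χ y n * (ArithmeticFunction.vonMangoldt n : ℂ), by simp⟩
  have hf : ∀ n, f n = if n = 0 then 0 else sievedCharacter χ y n := fun n => rfl
  have hg : ∀ n, g n = sievedCharacter χ y n * (ArithmeticFunction.vonMangoldt n : ℂ) :=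
    fun n => rfl
  have h := ArithmeticFunction.sum_Ioc_mul_eq_sum_sum f g N
  have e1 : ∑ n ∈ Ioc 0 N, (f * g) n =
      ∑ n ∈ Ioc 0 N, sievedCharacter χ y n * (Real.log n : ℂ) := by
    refine sum_congr rfl fun n hn => ?_
    have hn0 : n ≠ 0 := by
      rw [mem_Ioc] at hn
      omega
    rw [ArithmeticFunction.mul_apply, ← ArithmeticFunction.vonMangoldt_sum, Complex.ofReal_sum,
      mul_sum, ← Nat.sum_divisorsAntidiagonal' (f := fun _ j => sievedCharacter χ y n *
        (ArithmeticFunction.vonMangoldt j : ℂ))]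
    refine sum_congr rfl fun p hp => ?_
    rw [Nat.mem_divisorsAntidiagonal] at hp
    have h1 : p.1 ≠ 0 := by
      intro h
      rw [h, zero_mul] at hp
      exact hp.2 hp.1.symm
    have h2 : p.2 ≠ 0 := by
      intro h
      rw [h, mul_zero] at hp
      exact hp.2 hp.1.symm
    rw [hf, hg, if_neg h1, ← hp.1, sievedCharacter_mul χ y h1 h2]
    ring
  rw [← e1, h]
  refine sum_congr rfl fun m hm => ?_
  have hm0 : m ≠ 0 := by
    rw [mem_Ioc] at hm
    omega
  rw [hf, if_neg hm0]
  simp only [hg]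

theorem norm_sum_Ioc_sievedCharacter_mul_log_le {q : ℕ} (χ : DirichletCharacter ℂ q) (y : ℝ)
    {D : ℝ} (hD : 0 ≤ D) (h : ∀ N : ℕ, ‖∑ k ∈ Ioc 0 N,
      sievedCharacter χ y k * (ArithmeticFunction.vonMangoldt k : ℂ)‖ ≤ D * N) (N : ℕ) :
    ‖∑ n ∈ Ioc 0 N, sievedCharacter χ y n * (Real.log n : ℂ)‖ ≤ D * N * (1 + Real.log N) := by
  rw [sum_Ioc_sievedCharacter_mul_log]
  have hH : ∑ m ∈ Ioc 0 N, (m : ℝ)⁻¹ ≤ 1 + Real.log N := by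
    have := harmonic_le_one_add_log N
    rw [harmonic_eq_sum_Icc] at this
    push_cast at this
    exact this
  calc _ ≤ ∑ m ∈ Ioc 0 N, D * N * (m : ℝ)⁻¹ := by
        refine (norm_sum_le _ _).trans (sum_le_sum fun m _ => ?_)
        rw [norm_mul]
        calc _ ≤ 1 * (D * (N / m : ℕ)) := by
              gcongr
              · exact norm_sievedCharacter_le_one χ y m
              · exact h _
          _ ≤ 1 * (D * ((N : ℝ) / m)) := by
              gcongr
              exact Nat.cast_div_le
          _ = _ := by ring
    _ ≤ _ := by
        rw [← mul_sum]
        gcongr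

theorem norm_sum_Ioc_mul_antitone_le {g : ℕ → ℂ} {w : ℕ → ℝ} {K N : ℕ} {B : ℝ} (hKN : K ≤ N)
    (hw : ∀ n, K ≤ n → w (n + 1) ≤ w n) (hw0 : ∀ n, K ≤ n → 0 ≤ w n)
    (hB : ∀ n, K ≤ n → n ≤ N → ‖∑ k ∈ Ioc K n, g k‖ ≤ B) :
    ‖∑ n ∈ Ioc K N, g n * (w n : ℂ)‖ ≤ B * w K := by
  have key : ∀ n, K ≤ n → n ≤ N →
      ‖∑ k ∈ Ioc K n, g k * (w k : ℂ) - (w n : ℂ) * ∑ k ∈ Ioc K n, g k‖ ≤ B * (w K - w n) := by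
    intro n hn
    induction n, hn using Nat.le_induction with
    | base => simp
    | succ n hn ih =>
      intro hN
      have h1 := ih (by omega)
      have h2 := hB n hn (by omega)
      rw [sum_Ioc_succ_top (by omega), sum_Ioc_succ_top (by omega)]
      have e : ∑ k ∈ Ioc K n, g k * (w k : ℂ) + g (n + 1) * (w (n + 1) : ℂ) -
          (w (n + 1) : ℂ) * (∑ k ∈ Ioc K n, g k + g (n + 1)) =
          (∑ k ∈ Ioc K n, g k * (w k : ℂ) - (w n : ℂ) * ∑ k ∈ Ioc K n, g k) +
          ((w n - w (n + 1) : ℝ) : ℂ) * ∑ k ∈ Ioc K n, g k := by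
        push_cast
        ring
      rw [e]
      refine (norm_add_le _ _).trans ?_
      rw [norm_mul, Complex.norm_real, Real.norm_of_nonneg (by linarith [hw n hn])]
      have h3 : (w n - w (n + 1)) * ‖∑ k ∈ Ioc K n, g k‖ ≤ (w n - w (n + 1)) * B := by
        gcongr
        linarith [hw n hn]
      linarith
  have h1 := key N hKN le_rfl
  have h2 : ‖(w N : ℂ) * ∑ k ∈ Ioc K N, g k‖ ≤ w N * B := by
    rw [norm_mul, Complex.norm_real, Real.norm_of_nonneg (hw0 N hKN)]
    gcongr
    · exact hw0 N hKN
    · exact hB N hKN le_rfl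
  have h3 := norm_add_le (∑ k ∈ Ioc K N, g k * (w k : ℂ) - (w N : ℂ) * ∑ k ∈ Ioc K N, g k)
    ((w N : ℂ) * ∑ k ∈ Ioc K N, g k)
  rw [sub_add_cancel] at h3
  linarith

theorem exists_norm_sum_sievedCharacter_le_of_exp_sqrt_le {A B : ℝ} (hA : 0 < A) (hB : 0 < B) :
    ∃ C > 0, ∀ (q : ℕ) [NeZero q] (χ : DirichletCharacter ℂ q), χ ≠ 1 →
      ∀ x y : ℝ, 16 ≤ Real.log x → 0 < x → Real.exp √(Real.log x) ≤ y →
        (q : ℝ) ≤ Real.log x ^ B →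
        ‖∑ n ∈ Ioc 0 ⌊x⌋₊, sievedCharacter χ y n‖ ≤ C * x * Real.log x ^ (-A) := by
  obtain ⟨C, hC, h⟩ := exists_norm_sum_sievedCharacter_mul_vonMangoldt_le
    (A := 2 * A) (B := 2 * B) (by positivity) (by positivity)
  obtain ⟨E, hE, hexp⟩ := exists_exp_neg_mul_sqrt_le (a := 1 / 2) (by norm_num) A
  refine ⟨2 * E + 8 * C, by positivity, ?_⟩
  intro q _ χ hχ x y hl hx0 hy hq
  set l := Real.log x with hldef
  have hl0 : 0 < l := by linarith
  have hsq : √l * √l = l := Real.mul_self_sqrt hl0.le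
  have hpow : ∀ k : ℝ, √l ^ (2 * k) = l ^ k := by
    intro k
    rw [Real.rpow_mul (Real.sqrt_nonneg _), Real.rpow_two, Real.sq_sqrt hl0.le]
  have h1 := fun N => h q χ hχ √l y (Real.le_sqrt_of_sq_le (by linarith)) hy
    (by rwa [hpow]) N
  have e : -(2 * A) = 2 * (-A) := by ring
  simp only [e, hpow] at h1
  have hG := norm_sum_Ioc_sievedCharacter_mul_log_le χ y (D := C * l ^ (-A)) (by positivity)
    (fun N => (h1 N).trans_eq (by ring))
  set N := ⌊x⌋₊ with hN
  have hx16 : 17 ≤ x := by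
    have := Real.add_one_le_exp l
    rw [hldef, Real.exp_log hx0, ← hldef] at this
    linarith
  have hs0 : 0 ≤ √x := Real.sqrt_nonneg x
  have hs2 : √x * √x = x := Real.mul_self_sqrt hx0.le
  have hs4 : 4 ≤ √x := Real.le_sqrt_of_sq_le (by linarith)
  set K := ⌈√x⌉₊ with hK
  have hK1 : √x ≤ K := Nat.le_ceil _
  have hK2 : (K : ℝ) < √x + 1 := Nat.ceil_lt_add_one hs0
  have hKN : K ≤ N := Nat.le_floor (by nlinarith)
  have hNx : (N : ℝ) ≤ x := Nat.floor_le hx0.le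
  have hKpos : (1 : ℝ) < K := by linarith
  have hlogK : l / 2 ≤ Real.log K := by
    rw [hldef, ← Real.log_sqrt hx0.le]
    exact Real.log_le_log (by positivity) hK1
  have hGn : ∀ n, n ≤ N → ‖∑ k ∈ Ioc 0 n, sievedCharacter χ y k * (Real.log k : ℂ)‖ ≤
      2 * C * x * l ^ (-A) * l := by
    intro n hn
    have hnx : (n : ℝ) ≤ x := (by exact_mod_cast hn : (n : ℝ) ≤ N).trans hNx
    refine (hG n).trans ?_
    have hlogn : 1 + Real.log n ≤ 2 * l := by
      rcases Nat.eq_zero_or_pos n with h0 | h0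
      · rw [h0, Nat.cast_zero, Real.log_zero]
        linarith
      · have := Real.log_le_log (by exact_mod_cast h0) hnx
        linarith
    calc _ ≤ C * l ^ (-A) * x * (2 * l) := by
          have : (0:ℝ) ≤ Real.log n := Real.log_natCast_nonneg n
          gcongr
      _ = _ := by ring
  have habel := norm_sum_Ioc_mul_antitone_le
    (g := fun n => sievedCharacter χ y n * (Real.log n : ℂ)) (w := fun n => (Real.log n)⁻¹)
    (B := 4 * C * x * l ^ (-A) * l) hKN (fun n hn => by
      have hn' : (1 : ℝ) < n := hKpos.trans_le (by exact_mod_cast hn)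
      have := Real.log_pos hn'
      gcongr
      linarith) (fun n _ => by
      have := Real.log_natCast_nonneg n
      positivity) (fun n hn hnN => by
      have e2 := sum_Ioc_consecutive (fun k => sievedCharacter χ y k * (Real.log k : ℂ))
        (Nat.zero_le K) hn
      have e3 := hGn n hnN
      have e4 := hGn K hKN
      rw [← e2] at e3
      have e5 := norm_sub_le (∑ k ∈ Ioc 0 K, sievedCharacter χ y k * (Real.log k : ℂ) +
        ∑ k ∈ Ioc K n, sievedCharacter χ y k * (Real.log k : ℂ))
        (∑ k ∈ Ioc 0 K, sievedCharacter χ y k * (Real.log k : ℂ))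
      rw [add_sub_cancel_left] at e5
      linarith)
  have e6 : ∑ n ∈ Ioc K N, sievedCharacter χ y n * (Real.log n : ℂ) * (((Real.log n)⁻¹ : ℝ) : ℂ) =
      ∑ n ∈ Ioc K N, sievedCharacter χ y n := by
    refine sum_congr rfl fun n hn => ?_
    rw [mem_Ioc] at hn
    have hn' : (1 : ℝ) < n := hKpos.trans (by exact_mod_cast hn.1)
    rw [mul_assoc, ← Complex.ofReal_mul, mul_inv_cancel₀ (Real.log_pos hn').ne', Complex.ofReal_one,
      mul_one]
  rw [e6] at habel
  have h8 : 4 * C * x * l ^ (-A) * l * (Real.log K)⁻¹ ≤ 8 * C * x * l ^ (-A) := by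
    calc _ ≤ 4 * C * x * l ^ (-A) * l * (l / 2)⁻¹ := by gcongr
      _ = _ := by field_simp; norm_num
  have h9 : ‖∑ n ∈ Ioc 0 K, sievedCharacter χ y n‖ ≤ 2 * √x := by
    refine (norm_sum_le _ _).trans ((sum_le_sum fun n _ => norm_sievedCharacter_le_one χ y n).trans ?_)
    simp
    linarith
  have h10 : √x ≤ E * x * l ^ (-A) := by
    have h6 : Real.exp (-(l / 2)) ≤ E * l ^ (-A) := by
      refine le_trans ?_ (hexp l (by linarith))
      rw [Real.exp_le_exp]
      have : l ^ (1 / 2 : ℝ) ≤ l := by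
        calc l ^ (1 / 2 : ℝ) ≤ l ^ (1 : ℝ) :=
              Real.rpow_le_rpow_of_exponent_le (by linarith) (by norm_num)
          _ = l := Real.rpow_one l
      linarith
    have h7 : Real.exp (-(l / 2)) = (√x)⁻¹ := by
      rw [Real.exp_neg, hldef, ← Real.log_sqrt hx0.le, Real.exp_log (by linarith)]
    rw [h7] at h6
    calc √x = x * (√x)⁻¹ := by
          rw [eq_mul_inv_iff_mul_eq₀ (by linarith), hs2]
      _ ≤ x * (E * l ^ (-A)) := by gcongr
      _ = _ := by ring
  rw [← sum_Ioc_consecutive _ (Nat.zero_le K) hKN]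
  refine (norm_add_le _ _).trans ?_
  linarith

theorem YInd_eq_sum_powerset (y : ℝ) {n : ℕ} (hn : n ≠ 0) :
    YInd y n = ∑ t ∈ ((range ⌈y⌉₊).filter Nat.Prime).powerset,
      (-1 : ℝ) ^ #t * (if ∏ p ∈ t, p ∣ n then 1 else 0) := by
  have h1 : YInd y n = ∏ p ∈ (range ⌈y⌉₊).filter Nat.Prime, (1 + -(if p ∣ n then (1 : ℝ) else 0)) := by
    unfold YInd
    split_ifs with h
    · refine (prod_eq_one fun p hp => ?_).symm
      rw [mem_filter, mem_range, Nat.lt_ceil] at hp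
      rw [if_neg, neg_zero, add_zero]
      intro hpn
      have := h p (Nat.mem_primeFactors.2 ⟨hp.2, hpn, hn⟩)
      linarith
    · push Not at h
      obtain ⟨p, hp, hpy⟩ := h
      rw [Nat.mem_primeFactors] at hp
      refine (prod_eq_zero (i := p) ?_ ?_).symm
      · rw [mem_filter, mem_range, Nat.lt_ceil]
        exact ⟨hpy, hp.1⟩
      · rw [if_pos hp.2.1]
        norm_num
  rw [h1, prod_one_add]
  refine sum_congr rfl fun t ht => ?_
  rw [prod_neg]
  congr 1
  rw [mem_powerset] at ht
  have hprime : ∀ p ∈ t, Prime p := fun p hp => ((mem_filter.1 (ht hp)).2).prime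
  split_ifs with h
  · exact prod_eq_one fun p hp => if_pos ((dvd_prod_of_mem _ hp).trans h)
  · have : ∃ p ∈ t, ¬ p ∣ n := by
      by_contra! hall
      exact h (prod_primes_dvd n hprime hall)
    obtain ⟨p, hp, hpn⟩ := this
    exact prod_eq_zero hp (if_neg hpn)

theorem sum_Ioc_character_mul_ite_dvd {q : ℕ} (χ : DirichletCharacter ℂ q) {d : ℕ} (hd : d ≠ 0)
    (N : ℕ) : ∑ n ∈ Ioc 0 N, χ n * (if d ∣ n then 1 else 0) = χ d * ∑ m ∈ Ioc 0 (N / d), χ m := by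
  have hd0 : 0 < d := Nat.pos_of_ne_zero hd
  simp only [mul_ite, mul_one, mul_zero]
  rw [← sum_filter, mul_sum]
  symm
  refine sum_bij (fun m _ => d * m) ?_ ?_ ?_ ?_
  · intro m hm
    rw [mem_Ioc] at hm
    rw [mem_filter, mem_Ioc]
    exact ⟨⟨Nat.mul_pos hd0 hm.1, by
      rw [mul_comm]
      exact (Nat.le_div_iff_mul_le hd0).1 hm.2⟩, dvd_mul_right _ _⟩
  · intro a _ b _ h
    exact Nat.eq_of_mul_eq_mul_left hd0 h
  · intro n hn
    rw [mem_filter, mem_Ioc] at hn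
    obtain ⟨m, rfl⟩ := hn.2
    refine ⟨m, ?_, rfl⟩
    rw [mem_Ioc]
    exact ⟨Nat.pos_of_mul_pos_left hn.1.1, (Nat.le_div_iff_mul_le hd0).2 (by
      rw [mul_comm]
      exact hn.1.2)⟩
  · intro m _
    rw [Nat.cast_mul, map_mul]

theorem norm_sum_Ioc_character_le_rpow {q : ℕ} [NeZero q] {χ : DirichletCharacter ℂ q}
    (hχ : χ ≠ 1) {ε u : ℝ} (hε : 0 ≤ ε) (hε1 : ε ≤ 1) {M : ℕ} (hu : (M : ℝ) ≤ u) :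
    ‖∑ m ∈ Ioc 0 M, χ m‖ ≤ (q : ℝ) ^ ε * u ^ (1 - ε) := by
  have h1 : ‖∑ m ∈ Ioc 0 M, χ m‖ ≤ q := by
    have hq : q ≠ 1 := by
      rintro rfl
      exact hχ (DirichletCharacter.level_one χ)
    have h0 : χ ((0 : ℕ) : ZMod q) = 0 := by
      have : Fact (1 < q) := ⟨lt_of_le_of_ne (Nat.one_le_iff_ne_zero.2 (NeZero.ne q)) hq.symm⟩
      rw [Nat.cast_zero]
      exact χ.map_nonunit not_isUnit_zero
    have h := norm_sum_range_character_le hχ (M + 1)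
    have e : ∑ n ∈ range (M + 1), χ (n : ZMod q) = ∑ m ∈ Ioc 0 M, χ (m : ZMod q) := by
      rw [Nat.range_succ_eq_Icc_zero, ← add_sum_Ioc_eq_sum_Icc (Nat.zero_le M), h0, zero_add]
    rwa [e] at h
  have h2 : ‖∑ m ∈ Ioc 0 M, χ m‖ ≤ u := by
    refine (norm_sum_le _ _).trans ((sum_le_sum fun n _ => χ.norm_le_one _).trans ?_)
    simpa using hu
  set v := ‖∑ m ∈ Ioc 0 M, χ (m : ZMod q)‖ with hv
  have hv0 : 0 ≤ v := norm_nonneg _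
  calc v = v ^ (ε + (1 - ε)) := by rw [add_sub_cancel, Real.rpow_one]
    _ = v ^ ε * v ^ (1 - ε) := Real.rpow_add_of_nonneg hv0 hε (by linarith)
    _ ≤ _ := by
        have : 0 ≤ 1 - ε := by linarith
        gcongr

theorem prod_one_add_rpow_le_tsum {S : Finset ℕ} (hS : ∀ p ∈ S, p.Prime) {σ : ℝ} (hσ : 1 < σ) :
    ∏ p ∈ S, (1 + (p : ℝ) ^ (-σ)) ≤ ∑' n : ℕ, 1 / (n : ℝ) ^ σ := by
  have hsum : Summable fun n : ℕ => 1 / (n : ℝ) ^ σ := Real.summable_one_div_nat_rpow.2 hσ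
  have hinj : Set.InjOn (fun t : Finset ℕ => ∏ p ∈ t, p) (S.powerset : Set (Finset ℕ)) := by
    intro s hs t ht hst
    rw [mem_coe, mem_powerset] at hs ht
    rw [← Nat.primeFactors_prod (s := s) fun p hp => hS p (hs hp),
      ← Nat.primeFactors_prod (s := t) fun p hp => hS p (ht hp)]
    exact congrArg Nat.primeFactors hst
  rw [prod_one_add]
  calc _ = ∑ t ∈ S.powerset, 1 / ((∏ p ∈ t, p : ℕ) : ℝ) ^ σ := by
        refine sum_congr rfl fun t _ => ?_
        rw [Nat.cast_prod, ← Real.finsetProd_rpow _ _ (fun p _ => Nat.cast_nonneg p),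
          one_div, ← prod_inv_distrib]
        exact prod_congr rfl fun p _ => Real.rpow_neg (Nat.cast_nonneg p) σ
    _ = ∑ n ∈ S.powerset.image (fun t => ∏ p ∈ t, p), 1 / (n : ℝ) ^ σ := by
        rw [sum_image hinj]
    _ ≤ _ := hsum.sum_le_tsum _ fun n _ => by positivity

theorem one_add_rpow_le_pow {p ε : ℝ} (hp : 1 ≤ p) (hε : 0 < ε) (h : p ≤ Real.exp ε⁻¹) :
    1 + p ^ (-(1 - ε)) ≤ (1 + p ^ (-(1 + ε))) ^ 8 := by
  have hp0 : 0 < p := by linarith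
  have h1 : p ^ (2 * ε) ≤ 8 := by
    calc p ^ (2 * ε) ≤ (Real.exp ε⁻¹) ^ (2 * ε) := by gcongr
      _ = Real.exp 1 ^ 2 := by
          rw [← Real.exp_mul, ← Real.exp_nat_mul]
          congr 1
          push_cast
          field_simp
      _ ≤ 8 := by
          have := Real.exp_one_lt_d9
          have := Real.exp_pos 1
          nlinarith
  have h2 : p ^ (-(1 - ε)) = p ^ (2 * ε) * p ^ (-(1 + ε)) := by
    rw [← Real.rpow_add hp0]
    ring_nf
  have h3 : 0 ≤ p ^ (-(1 + ε)) := by positivity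
  have h4 := one_add_mul_le_pow (a := p ^ (-(1 + ε))) (by linarith) 8
  push_cast at h4
  rw [h2]
  nlinarith

theorem norm_sum_sievedCharacter_le_prod {q : ℕ} [NeZero q] {χ : DirichletCharacter ℂ q}
    (hχ : χ ≠ 1) {ε x y : ℝ} (hx : 0 < x) (hε : 0 ≤ ε) (hε1 : ε ≤ 1) :
    ‖∑ n ∈ Ioc 0 ⌊x⌋₊, sievedCharacter χ y n‖ ≤ (q : ℝ) ^ ε * x ^ (1 - ε) *
      ∏ p ∈ (range ⌈y⌉₊).filter Nat.Prime, (1 + (p : ℝ) ^ (-(1 - ε))) := by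
  set S := (range ⌈y⌉₊).filter Nat.Prime with hS
  have hSp : ∀ t ∈ S.powerset, ∏ p ∈ t, p ≠ 0 := by
    intro t ht
    rw [mem_powerset] at ht
    exact prod_ne_zero_iff.2 fun p hp => ((mem_filter.1 (ht hp)).2).ne_zero
  have e : ∑ n ∈ Ioc 0 ⌊x⌋₊, sievedCharacter χ y n =
      ∑ t ∈ S.powerset, (-1 : ℂ) ^ #t * (χ (∏ p ∈ t, p : ℕ) *
        ∑ m ∈ Ioc 0 (⌊x⌋₊ / ∏ p ∈ t, p), χ m) := by
    calc _ = ∑ n ∈ Ioc 0 ⌊x⌋₊, ∑ t ∈ S.powerset,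
          (-1 : ℂ) ^ #t * (χ n * (if ∏ p ∈ t, p ∣ n then 1 else 0)) := by
          refine sum_congr rfl fun n hn => ?_
          have hn0 : n ≠ 0 := by
            rw [mem_Ioc] at hn
            omega
          rw [sievedCharacter, YInd_eq_sum_powerset y hn0, Complex.ofReal_sum, mul_sum]
          refine sum_congr rfl fun t _ => ?_
          split_ifs <;> (push_cast; ring)
      _ = _ := by
          rw [sum_comm]
          refine sum_congr rfl fun t ht => ?_
          rw [← mul_sum, sum_Ioc_character_mul_ite_dvd χ (hSp t ht)]
  rw [e, prod_one_add, mul_sum]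
  refine (norm_sum_le _ _).trans (sum_le_sum fun t ht => ?_)
  set d := ∏ p ∈ t, p with hd
  have hd0 : (0 : ℝ) < d := by
    exact_mod_cast Nat.pos_of_ne_zero (hSp t ht)
  have hM : ((⌊x⌋₊ / d : ℕ) : ℝ) ≤ x / d := by
    refine Nat.cast_div_le.trans ?_
    gcongr
    exact Nat.floor_le hx.le
  have h1 := norm_sum_Ioc_character_le_rpow hχ hε hε1 hM
  have h2 : ∏ p ∈ t, (p : ℝ) ^ (-(1 - ε)) = (d : ℝ) ^ (-(1 - ε)) := by
    rw [hd, Nat.cast_prod, Real.finsetProd_rpow _ _ (fun p _ => Nat.cast_nonneg p)]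
  rw [h2, norm_mul, norm_mul, norm_pow, norm_neg, norm_one, one_pow, one_mul]
  calc _ ≤ 1 * ((q : ℝ) ^ ε * (x / d) ^ (1 - ε)) := by
        gcongr
        exact χ.norm_le_one _
    _ = _ := by
        rw [Real.div_rpow hx.le hd0.le, Real.rpow_neg hd0.le, one_mul, div_eq_mul_inv, mul_assoc]

theorem exists_norm_sum_sievedCharacter_le_of_le_exp_sqrt {A B : ℝ} :
    ∃ C > 0, ∀ (q : ℕ) [NeZero q] (χ : DirichletCharacter ℂ q), χ ≠ 1 →
      ∀ x y : ℝ, 16 ≤ Real.log x → 0 < x → y ≤ Real.exp √(Real.log x) →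
        (q : ℝ) ≤ Real.log x ^ B →
        ‖∑ n ∈ Ioc 0 ⌊x⌋₊, sievedCharacter χ y n‖ ≤ C * x * Real.log x ^ (-A) := by
  obtain ⟨C, hC, h⟩ := exists_tsum_one_div_rpow_le
  obtain ⟨E, hE, hexp⟩ := exists_exp_neg_mul_sqrt_le (a := 1) one_pos (A + B + 4)
  refine ⟨(4 * C) ^ 8 * E, by positivity, ?_⟩
  intro q _ χ hχ x y hl hx0 hy hq
  set l := Real.log x with hldef
  have hl0 : 0 < l := by linarith
  have hs : 4 ≤ √l := Real.le_sqrt_of_sq_le (by linarith)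
  have hs0 : 0 < √l := by linarith
  have hsq : √l * √l = l := Real.mul_self_sqrt hl0.le
  set ε := (√l)⁻¹ with hε
  have hε0 : 0 < ε := by positivity
  have hε1 : ε ≤ 1 := inv_le_one_of_one_le₀ (by linarith)
  refine (norm_sum_sievedCharacter_le_prod hχ hx0 hε0.le hε1).trans ?_
  have hprod : ∏ p ∈ (range ⌈y⌉₊).filter Nat.Prime, (1 + (p : ℝ) ^ (-(1 - ε))) ≤
      (4 * C) ^ 8 * l ^ 4 := by
    have h1 := prod_one_add_rpow_le_tsum (S := (range ⌈y⌉₊).filter Nat.Prime)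
      (fun p hp => (mem_filter.1 hp).2) (σ := 1 + ε) (by linarith)
    have h2 := h (1 + ε) (by linarith) (by linarith)
    have e : 4 * C / (1 + ε - 1) = 4 * C * √l := by
      rw [add_sub_cancel_left, hε, div_inv_eq_mul]
    rw [e] at h2
    calc _ ≤ ∏ p ∈ (range ⌈y⌉₊).filter Nat.Prime, (1 + (p : ℝ) ^ (-(1 + ε))) ^ 8 := by
          refine prod_le_prod (fun p _ => by positivity) fun p hp => ?_
          rw [mem_filter, mem_range, Nat.lt_ceil] at hp
          refine one_add_rpow_le_pow (by exact_mod_cast hp.2.one_le) hε0 ?_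
          rw [hε, inv_inv]
          linarith
      _ = (∏ p ∈ (range ⌈y⌉₊).filter Nat.Prime, (1 + (p : ℝ) ^ (-(1 + ε)))) ^ 8 :=
          prod_pow _ _ _
      _ ≤ (4 * C * √l) ^ 8 := by
          gcongr
          exact h1.trans h2
      _ = (4 * C) ^ 8 * (√l * √l) ^ 4 := by ring
      _ = _ := by rw [hsq]
  have hq1 : (1 : ℝ) ≤ q := by exact_mod_cast NeZero.one_le
  have hqε : (q : ℝ) ^ ε ≤ l ^ B := by
    refine le_trans ?_ hq
    calc (q : ℝ) ^ ε ≤ (q : ℝ) ^ (1 : ℝ) := Real.rpow_le_rpow_of_exponent_le hq1 hε1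
      _ = q := Real.rpow_one _
  have hxε : x ^ (1 - ε) ≤ x * (E * l ^ (-(A + B + 4))) := by
    have h1 := hexp l (by linarith)
    rw [one_mul, ← Real.sqrt_eq_rpow] at h1
    have h2 : x ^ (-ε) = Real.exp (-√l) := by
      rw [Real.rpow_def_of_pos hx0, ← hldef, hε]
      congr 1
      field_simp
      rw [pow_two, hsq]
    calc x ^ (1 - ε) = x * x ^ (-ε) := by
          rw [sub_eq_add_neg, Real.rpow_add hx0, Real.rpow_one]
      _ ≤ _ := by
          rw [h2]
          gcongr
  calc _ ≤ l ^ B * (x * (E * l ^ (-(A + B + 4)))) * ((4 * C) ^ 8 * l ^ 4) := by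
        gcongr
    _ = (4 * C) ^ 8 * E * x * (l ^ B * l ^ (-(A + B + 4)) * l ^ (4 : ℝ)) := by
        rw [show (4 : ℝ) = ((4 : ℕ) : ℝ) by norm_num, Real.rpow_natCast]
        push_cast
        ring
    _ = _ := by
        rw [← Real.rpow_add hl0, ← Real.rpow_add hl0]
        ring_nf

theorem exists_norm_sum_sievedCharacter_le {A B : ℝ} (hA : 0 < A) (hB : 0 < B) :
    ∃ C > 0, ∀ (q : ℕ) [NeZero q] (χ : DirichletCharacter ℂ q), χ ≠ 1 →
      ∀ x y : ℝ, 16 ≤ Real.log x → 0 < x → (q : ℝ) ≤ Real.log x ^ B →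
        ‖∑ n ∈ Ioc 0 ⌊x⌋₊, sievedCharacter χ y n‖ ≤ C * x * Real.log x ^ (-A) := by
  obtain ⟨C₁, hC₁, h₁⟩ := exists_norm_sum_sievedCharacter_le_of_exp_sqrt_le hA hB
  obtain ⟨C₂, hC₂, h₂⟩ := exists_norm_sum_sievedCharacter_le_of_le_exp_sqrt (A := A) (B := B)
  refine ⟨C₁ + C₂, by positivity, fun q _ χ hχ x y hl hx hq => ?_⟩
  have hnn : 0 ≤ x * Real.log x ^ (-A) :=
    mul_nonneg hx.le (Real.rpow_nonneg (by linarith) _)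
  rcases le_total (Real.exp √(Real.log x)) y with hy | hy
  · exact (h₁ q χ hχ x y hl hx hy hq).trans (by nlinarith)
  · exact (h₂ q χ hχ x y hl hx hy hq).trans (by nlinarith)

theorem exists_mul_sqrt_le_totient : ∃ c > (0 : ℝ), ∀ q : ℕ,
    c * (q : ℝ) ^ (1 / 2 : ℝ) ≤ q.totient := by
  obtain ⟨C, hC, h⟩ := exists_two_pow_card_primeFactors_le (ε := 1 / 2) (by norm_num)
  refine ⟨C⁻¹, by positivity, fun q => ?_⟩
  rcases Nat.eq_zero_or_pos q with rfl | hq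
  · simp
  have hq0 : (0 : ℝ) < q := by exact_mod_cast hq
  have h1 : (q.totient : ℝ) = q * ∏ p ∈ q.primeFactors, (1 - (p : ℝ)⁻¹) := by
    have := congrArg (Rat.cast : ℚ → ℝ) (Nat.totient_eq_mul_prod_factors q)
    push_cast at this
    exact this
  have h2 : ((2 : ℝ) ^ #q.primeFactors)⁻¹ ≤ ∏ p ∈ q.primeFactors, (1 - (p : ℝ)⁻¹) := by
    rw [← inv_pow, ← prod_const]
    refine prod_le_prod (fun _ _ => by norm_num) fun p hp => ?_
    have : (2 : ℝ) ≤ p := by exact_mod_cast (Nat.prime_of_mem_primeFactors hp).two_le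
    have : (p : ℝ)⁻¹ ≤ 2⁻¹ := by gcongr
    linarith
  have h3 : (C * (q : ℝ) ^ (1 / 2 : ℝ))⁻¹ ≤ ((2 : ℝ) ^ #q.primeFactors)⁻¹ := by
    gcongr
    exact h q hq.ne'
  rw [h1]
  calc C⁻¹ * (q : ℝ) ^ (1 / 2 : ℝ) = q * (C * (q : ℝ) ^ (1 / 2 : ℝ))⁻¹ := by
        have e : (q : ℝ) = (q : ℝ) ^ (1 / 2 : ℝ) * (q : ℝ) ^ (1 / 2 : ℝ) := by
          rw [← Real.rpow_add hq0]
          norm_num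
        have : 0 < (q : ℝ) ^ (1 / 2 : ℝ) := by positivity
        nth_rewrite 2 [e]
        field_simp
    _ ≤ _ := by
        gcongr
        exact h3.trans h2

theorem card_filter_emod_le (N q : ℕ) (a : ℤ) :
    #((Icc 1 N).filter (fun n : ℕ => (n : ℤ) % q = a % q)) ≤ N / q + 1 := by
  rw [← card_range (N / q + 1)]
  refine card_le_card_of_injOn (fun n => n / q) (fun n hn => ?_) fun m hm n hn hmn => ?_
  · rw [mem_coe, mem_filter, mem_Icc] at hn
    rw [mem_coe, mem_range]
    exact Nat.lt_succ_of_le (Nat.div_le_div_right hn.1.2)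
  · rw [mem_coe, mem_filter] at hm hn
    have h : m % q = n % q := by exact_mod_cast hm.2.trans hn.2.symm
    dsimp only at hmn
    rw [← Nat.div_add_mod m q, ← Nat.div_add_mod n q, h, hmn]

theorem sum_YInd_residue_sub_eq {q : ℕ} [NeZero q] (y : ℝ) {a : ℤ} (ha : Int.gcd a q = 1)
    (N : ℕ) : (((∑ n ∈ (Icc 1 N).filter (fun n : ℕ => (n : ℤ) % q = a % q), YInd y n)
        - (1 / (Nat.totient q : ℝ)) *
            ∑ n ∈ (Icc 1 N).filter (fun n => Nat.Coprime n q), YInd y n : ℝ) : ℂ) =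
      (1 / (Nat.totient q : ℂ)) * ∑ χ ∈ {χ : DirichletCharacter ℂ q | χ ≠ 1},
        χ (a : ZMod q)⁻¹ * ∑ n ∈ Ioc 0 N, sievedCharacter χ y n := by
  classical
  have hφ : (Nat.totient q : ℂ) ≠ 0 := by
    exact_mod_cast (Nat.totient_pos.2 (Nat.pos_of_ne_zero (NeZero.ne q))).ne'
  have hunit : IsUnit (a : ZMod q) := by
    rw [ZMod.coe_int_isUnit_iff_isCoprime]
    exact (Int.isCoprime_iff_gcd_eq_one.2 ha).symm
  have hIcc : Icc 1 N = Ioc 0 N := Icc_add_one_left_eq_Ioc 0 N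
  have h1 : ∑ χ : DirichletCharacter ℂ q, χ (a : ZMod q)⁻¹ * ∑ n ∈ Ioc 0 N, sievedCharacter χ y n =
      (Nat.totient q : ℂ) *
        ∑ n ∈ (Ioc 0 N).filter (fun n : ℕ => (n : ℤ) % q = a % q), (YInd y n : ℂ) := by
    simp only [mul_sum]
    rw [sum_comm, sum_filter]
    refine sum_congr rfl fun n _ => ?_
    have h2 := DirichletCharacter.sum_char_inv_mul_char_eq ℂ hunit (n : ZMod q)
    have h3 : (a : ZMod q) = (n : ZMod q) ↔ (n : ℤ) % q = a % q := by
      rw [← Int.cast_natCast n, eq_comm, ZMod.intCast_eq_intCast_iff]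
      rfl
    simp only [sievedCharacter, ← mul_assoc, ← sum_mul]
    rw [h2]
    simp only [h3]
    split_ifs <;> simp
  have h4 : (1 : DirichletCharacter ℂ q) (a : ZMod q)⁻¹ *
      ∑ n ∈ Ioc 0 N, sievedCharacter (1 : DirichletCharacter ℂ q) y n =
      ∑ n ∈ (Ioc 0 N).filter (fun n => Nat.Coprime n q), (YInd y n : ℂ) := by
    have hinv : IsUnit (a : ZMod q)⁻¹ := by
      obtain ⟨u, hu⟩ := hunit
      rw [← hu, ZMod.inv_coe_unit]
      exact Units.isUnit _
    rw [MulChar.one_apply hinv, one_mul, sum_filter]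
    refine sum_congr rfl fun n _ => ?_
    rw [sievedCharacter]
    split_ifs with hn
    · rw [MulChar.one_apply ((ZMod.isUnit_iff_coprime n q).2 hn), one_mul]
    · rw [MulChar.map_nonunit _ (fun h => hn ((ZMod.isUnit_iff_coprime n q).1 h)), zero_mul]
  have h5 := sum_filter_add_sum_filter_not (univ : Finset (DirichletCharacter ℂ q)) (fun χ => χ ≠ 1)
    (fun χ => χ (a : ZMod q)⁻¹ * ∑ n ∈ Ioc 0 N, sievedCharacter χ y n)
  simp only [not_not, filter_eq', mem_univ, if_true, sum_singleton] at h5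
  rw [h4, h1] at h5
  rw [eq_sub_of_add_eq h5, hIcc]
  push_cast
  field_simp

theorem norm_sum_YInd_residue_sub_le {q : ℕ} [NeZero q] (y : ℝ) {a : ℤ} (ha : Int.gcd a q = 1)
    (N : ℕ) {D : ℝ} (hD : ∀ χ : DirichletCharacter ℂ q, χ ≠ 1 →
      ‖∑ n ∈ Ioc 0 N, sievedCharacter χ y n‖ ≤ D) (hD0 : 0 ≤ D) :
    |(∑ n ∈ (Icc 1 N).filter (fun n : ℕ => (n : ℤ) % q = a % q), YInd y n)
        - (1 / (Nat.totient q : ℝ)) *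
            ∑ n ∈ (Icc 1 N).filter (fun n => Nat.Coprime n q), YInd y n| ≤ D := by
  classical
  have hφ : (0 : ℝ) < Nat.totient q := by
    exact_mod_cast Nat.totient_pos.2 (Nat.pos_of_ne_zero (NeZero.ne q))
  rw [← Real.norm_eq_abs, ← Complex.norm_real, sum_YInd_residue_sub_eq y ha, norm_mul, norm_div,
    norm_one, Complex.norm_natCast]
  have hcard : ((univ : Finset (DirichletCharacter ℂ q)).card : ℝ) = Nat.totient q := by
    rw [card_univ, ← Nat.card_eq_fintype_card,
      DirichletCharacter.card_eq_totient_of_hasEnoughRootsOfUnity]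
  have h1 : ‖∑ χ ∈ {χ : DirichletCharacter ℂ q | χ ≠ 1},
      χ (a : ZMod q)⁻¹ * ∑ n ∈ Ioc 0 N, sievedCharacter χ y n‖ ≤ Nat.totient q * D := by
    rw [← hcard, ← nsmul_eq_mul, ← sum_const]
    refine (norm_sum_le _ _).trans (le_trans (sum_le_sum fun χ hχ => ?_)
      (sum_le_sum_of_subset_of_nonneg (filter_subset _ _) fun _ _ _ => hD0))
    rw [mem_filter] at hχ
    rw [norm_mul]
    calc _ ≤ 1 * D := by
          gcongr
          · exact χ.norm_le_one _
          · exact hD χ hχ.2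
      _ = D := one_mul D
  calc _ ≤ 1 / (Nat.totient q : ℝ) * (Nat.totient q * D) := by gcongr
    _ = D := by field_simp

theorem sum_YInd_le_card (y : ℝ) (s : Finset ℕ) : ∑ n ∈ s, YInd y n ≤ #s := by
  refine (sum_le_sum fun n _ => YInd_le_one y n).trans ?_
  simp

end SiegelWalfisz

open SiegelWalfisz

/-- Siegel–Walfisz theorem for integers free of small prime factors, uniform in `Y₀`:
for every `A > 0` there is `C(A)` such that for all `Y₀ > 1`, `x ≥ 1` and coprime
`a`, `q` with `q ≥ 1`,
`|∑_{n≤x, n≡a (q)} 𝔜₀(n) − (1/φ(q)) ∑_{n≤x,(n,q)=1} 𝔜₀(n)| ≤ C(A) x/(log 3x)^A`. -/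
theorem stmt_14 (A : ℝ) (hA : 0 < A) :
    ∃ C : ℝ, 0 < C ∧ ∀ (Y₀ x : ℝ) (a : ℤ) (q : ℕ), 1 < Y₀ → 1 ≤ x → 1 ≤ q →
      Int.gcd a q = 1 →
      |(∑ n ∈ (Finset.Icc 1 ⌊x⌋₊).filter (fun n : ℕ => (n : ℤ) % q = a % q), YInd Y₀ n)
        - (1 / (Nat.totient q : ℝ)) *
            ∑ n ∈ (Finset.Icc 1 ⌊x⌋₊).filter (fun n => Nat.Coprime n q), YInd Y₀ n|
      ≤ C * x / Real.log (3 * x) ^ A := by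
  obtain ⟨C, hC, h⟩ := exists_norm_sum_sievedCharacter_le hA (B := 2 * A) (by positivity)
  obtain ⟨c, hc, hφ⟩ := exists_mul_sqrt_le_totient
  obtain ⟨E, hE, hexp⟩ := exists_exp_neg_mul_sqrt_le (a := 1) one_pos A
  refine ⟨18 ^ A + (C + 1 + E + c⁻¹) * 2 ^ A, by positivity, ?_⟩
  intro y x a q hy hx hq ha
  have : NeZero q := ⟨by omega⟩
  have hx0 : 0 < x := by linarith
  have hNx : (⌊x⌋₊ : ℝ) ≤ x := Nat.floor_le hx0.le
  have hq0 : (0 : ℝ) < q := by exact_mod_cast hq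
  have hφ1 : (1 : ℝ) ≤ Nat.totient q := by exact_mod_cast Nat.totient_pos.2 hq
  have hL : Real.log (3 * x) = Real.log 3 + Real.log x := Real.log_mul (by norm_num) hx0.ne'
  have hlog3 : 1 < Real.log 3 := one_lt_log_of_three_le le_rfl
  have hlog3' : Real.log 3 ≤ 2 := by
    have := Real.log_le_sub_one_of_pos (x := 3) (by norm_num)
    linarith
  have hlx : 0 ≤ Real.log x := Real.log_nonneg hx
  have hL0 : 0 < Real.log (3 * x) := by linarith
  rw [le_div_iff₀ (by positivity)]
  have hs1 := sum_nonneg fun n (_ : n ∈ (Icc 1 ⌊x⌋₊).filter (fun n : ℕ => (n : ℤ) % q = a % q)) =>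
    YInd_nonneg y n
  have hs2 := sum_nonneg fun n (_ : n ∈ (Icc 1 ⌊x⌋₊).filter (fun n => Nat.Coprime n q)) =>
    YInd_nonneg y n
  have hcard : ∀ p : ℕ → Prop, ∀ [DecidablePred p],
      ∑ n ∈ (Icc 1 ⌊x⌋₊).filter p, YInd y n ≤ x := by
    intro p _
    refine (sum_YInd_le_card y _).trans (le_trans ?_ hNx)
    have := card_filter_le (Icc 1 ⌊x⌋₊) p
    rw [Nat.card_Icc, Nat.add_sub_cancel] at this
    exact_mod_cast this
  have hb2 : (1 / (Nat.totient q : ℝ)) *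
      ∑ n ∈ (Icc 1 ⌊x⌋₊).filter (fun n => Nat.Coprime n q), YInd y n ≤
      (1 / (Nat.totient q : ℝ)) * x := by
    gcongr
    exact hcard _
  have hb20 : 0 ≤ (1 / (Nat.totient q : ℝ)) *
      ∑ n ∈ (Icc 1 ⌊x⌋₊).filter (fun n => Nat.Coprime n q), YInd y n := by positivity
  have hb1 := hcard (fun n : ℕ => (n : ℤ) % q = a % q)
  rcases lt_or_ge (Real.log x) 16 with hl | hl
  · have h1 : |(∑ n ∈ (Icc 1 ⌊x⌋₊).filter (fun n : ℕ => (n : ℤ) % q = a % q), YInd y n)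
        - (1 / (Nat.totient q : ℝ)) *
            ∑ n ∈ (Icc 1 ⌊x⌋₊).filter (fun n => Nat.Coprime n q), YInd y n| ≤ x := by
      have h2 : 1 / (Nat.totient q : ℝ) * x ≤ x :=
        mul_le_of_le_one_left hx0.le (by rw [div_le_one (by linarith)]; exact hφ1)
      rw [abs_le]
      constructor <;> linarith
    have h3 : Real.log (3 * x) ^ A ≤ 18 ^ A := by
      gcongr
      linarith
    calc _ ≤ x * 18 ^ A := by gcongr
      _ ≤ _ := by
          have : 0 ≤ (C + 1 + E + c⁻¹) * 2 ^ A * x := by positivity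
          linarith
  set l := Real.log x with hldef
  have hl0 : 0 < l := by linarith
  have hlA : l ^ (-A) * Real.log (3 * x) ^ A ≤ 2 ^ A := by
    calc _ ≤ l ^ (-A) * (2 * l) ^ A := by
          gcongr
          linarith
      _ = 2 ^ A * (l ^ (-A) * l ^ A) := by
          rw [Real.mul_rpow (by norm_num) hl0.le]
          ring
      _ = 2 ^ A := by rw [← Real.rpow_add hl0, neg_add_cancel, Real.rpow_zero, mul_one]
  suffices hmain : |(∑ n ∈ (Icc 1 ⌊x⌋₊).filter (fun n : ℕ => (n : ℤ) % q = a % q), YInd y n)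
        - (1 / (Nat.totient q : ℝ)) *
            ∑ n ∈ (Icc 1 ⌊x⌋₊).filter (fun n => Nat.Coprime n q), YInd y n| ≤
      (C + 1 + E + c⁻¹) * x * l ^ (-A) by
    calc _ ≤ (C + 1 + E + c⁻¹) * x * l ^ (-A) * Real.log (3 * x) ^ A := by gcongr
      _ = (C + 1 + E + c⁻¹) * x * (l ^ (-A) * Real.log (3 * x) ^ A) := by ring
      _ ≤ (C + 1 + E + c⁻¹) * x * 2 ^ A := by gcongr
      _ ≤ _ := by
          have : (0 : ℝ) ≤ 18 ^ A * x := by positivity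
          linarith
  have hX0 : 0 ≤ x * l ^ (-A) := by positivity
  rcases le_or_gt (q : ℝ) (l ^ (2 * A)) with hql | hql
  · refine (norm_sum_YInd_residue_sub_le y ha ⌊x⌋₊ (fun χ hχ => h q χ hχ x y hl hx0 hql)
      (by positivity)).trans ?_
    have : 0 ≤ (1 + E + c⁻¹) * (x * l ^ (-A)) := by positivity
    linarith
  have hqA : l ^ A ≤ (q : ℝ) ^ (1 / 2 : ℝ) := by
    calc l ^ A = (l ^ (2 * A)) ^ (1 / 2 : ℝ) := by
          rw [← Real.rpow_mul hl0.le]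
          ring_nf
      _ ≤ _ := by gcongr
  have hq1 : (1 : ℝ) ≤ q := by exact_mod_cast hq
  have hqA' : l ^ A ≤ q := hqA.trans (by
    calc (q : ℝ) ^ (1 / 2 : ℝ) ≤ (q : ℝ) ^ (1 : ℝ) :=
          Real.rpow_le_rpow_of_exponent_le hq1 (by norm_num)
      _ = q := Real.rpow_one _)
  have hlApos : 0 < l ^ A := by positivity
  have hr1 : ∑ n ∈ (Icc 1 ⌊x⌋₊).filter (fun n : ℕ => (n : ℤ) % q = a % q), YInd y n ≤
      x * l ^ (-A) + E * (x * l ^ (-A)) := by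
    have h1 : ((#((Icc 1 ⌊x⌋₊).filter (fun n : ℕ => (n : ℤ) % q = a % q)) : ℕ) : ℝ) ≤
        (⌊x⌋₊ / q + 1 : ℕ) := by
      exact_mod_cast card_filter_emod_le ⌊x⌋₊ q a
    have h2 : ((⌊x⌋₊ / q : ℕ) : ℝ) ≤ x * l ^ (-A) := by
      calc _ ≤ (⌊x⌋₊ : ℝ) / q := Nat.cast_div_le
        _ ≤ x / l ^ A := by gcongr
        _ = _ := by rw [Real.rpow_neg hl0.le, div_eq_mul_inv]
    have h3 : 1 ≤ E * (x * l ^ (-A)) := by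
      have h4 : Real.exp (-l) ≤ E * l ^ (-A) := by
        refine le_trans ?_ (hexp l (by linarith))
        rw [Real.exp_le_exp, one_mul, neg_le_neg_iff]
        calc l ^ (1 / 2 : ℝ) ≤ l ^ (1 : ℝ) :=
              Real.rpow_le_rpow_of_exponent_le (by linarith) (by norm_num)
          _ = l := Real.rpow_one l
      rw [Real.exp_neg, hldef, Real.exp_log hx0, ← hldef] at h4
      calc 1 = x * x⁻¹ := (mul_inv_cancel₀ hx0.ne').symm
        _ ≤ x * (E * l ^ (-A)) := by gcongr
        _ = _ := by ring
    push_cast at h1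
    have := sum_YInd_le_card y ((Icc 1 ⌊x⌋₊).filter (fun n : ℕ => (n : ℤ) % q = a % q))
    linarith
  have hr2 : (1 / (Nat.totient q : ℝ)) * x ≤ c⁻¹ * (x * l ^ (-A)) := by
    have h1 : c * l ^ A ≤ Nat.totient q := le_trans (by gcongr) (hφ q)
    calc _ ≤ 1 / (c * l ^ A) * x := by gcongr
      _ = _ := by
          rw [Real.rpow_neg hl0.le]
          field_simp
  have hC0 : 0 ≤ C * (x * l ^ (-A)) := by positivity
  have hE0 : 0 ≤ E * (x * l ^ (-A)) := by positivity
  have hc0 : 0 ≤ c⁻¹ * (x * l ^ (-A)) := by positivity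
  rw [abs_le]
  constructor <;> linarith
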